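/- arXiv:1608.01016 — 2 statements merged into one kernel-verified Lean document; each statement's English description precedes it below -/
import Mathlib

section
/- Fix an integer x ≥ 1 and a real number 0 < μ < 1, set T = T(n) = ⌊n^μ⌋, and let t = t(n) be a sequence of order n³ (i.e. t/n³ converges to a positive constant). Let Γ be the set of nearest-neighbour paths γ = (γ_0, …, γ_T) in ℤ with γ_0 = x. Then the total variation distance between the law of the first T steps of the conditioned walk on the positive integers started at x and the law of the first T steps of the simple random walk started at x conditioned on {τ_{{0,2n}} > t} satisfies (1/2) Σ_{γ ∈ Γ} | P̂_x[(X_0,…,X_T) = γ] − P_x[(S_0,…,S_T) = γ | τ_{{0,2n}} > t] | = O(n^{−2} T²); in particular it is O(n^{2μ−2}) and tends to 0 as n → ∞. -/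
open MeasureTheory ProbabilityTheory Finset Filter
open scoped ENNReal Topology

/-- One step transition probability of the simple random walk on `ℤ`. -/
noncomputable def srwStep (u v : ℤ) : ℝ≥0∞ :=
  if v = u + 1 ∨ v = u - 1 then (1 : ℝ≥0∞) / 2 else 0

/-- `P x` is the law of the simple random walk `S` on `ℤ` started at `x`:
for every finite path `γ` with `γ 0 = x`, the probability of following `γ`
during the first `t` steps is the product of the one-step transition
probabilities. -/
def IsSRW {Ω : Type*} [MeasurableSpace Ω] (P : ℤ → Measure Ω) (S : ℕ → Ω → ℤ) : Prop :=
  (∀ x, IsProbabilityMeasure (P x)) ∧ (∀ t, Measurable (S t)) ∧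
    ∀ (x : ℤ) (t : ℕ) (γ : ℕ → ℤ), γ 0 = x →
      P x {ω | ∀ s ≤ t, S s ω = γ s} = ∏ s ∈ Finset.range t, srwStep (γ s) (γ (s + 1))

/-- One step transition probability of the simple random walk on the positive
integers conditioned to never hit the origin:
`P(x, x+1) = (x+1)/(2x)` and `P(x, x-1) = (x-1)/(2x)`. -/
noncomputable def condStep (u v : ℤ) : ℝ≥0∞ :=
  ENNReal.ofReal
    (if v = u + 1 then ((u : ℝ) + 1) / (2 * u)
      else if v = u - 1 then ((u : ℝ) - 1) / (2 * u) else 0)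

/-- `Pr` is the law of the conditioned walk `X` (the walk on the positive
integers with transition probabilities `condStep`) started at `x`. -/
def IsCondWalk {Ω : Type*} [MeasurableSpace Ω] (Pr : Measure Ω) (X : ℕ → Ω → ℤ)
    (x : ℤ) : Prop :=
  IsProbabilityMeasure Pr ∧ (∀ t, Measurable (X t)) ∧
    ∀ (t : ℕ) (γ : ℕ → ℤ), γ 0 = x →
      Pr {ω | ∀ s ≤ t, X s ω = γ s} = ∏ s ∈ Finset.range t, condStep (γ s) (γ (s + 1))

/-- The nearest-neighbour path of length `T` started at `x` whose successive
steps are `+1` or `-1` according to the signs `ε`; every nearest-neighbour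
path `γ` with `γ 0 = x` arises from exactly one `ε : Fin T → Bool`. -/
def pathOf (x : ℤ) {T : ℕ} (ε : Fin T → Bool) (s : ℕ) : ℤ :=
  x + ∑ i ∈ Finset.univ.filter (fun i : Fin T => (i : ℕ) < s),
        (if ε i then (1 : ℤ) else -1)

/-- Angular frequencies of the odd eigenmodes on `{1, …, 2n - 1}`. -/
noncomputable def oddFreq (n j : ℕ) : ℝ := (2 * j + 1) * (Real.pi / (2 * n))

/-- Spectral form of the probability that simple random walk started at `y` stays in
`(0, 2n)` for `r` steps. -/
noncomputable def survivalSum (n r : ℕ) (y : ℤ) : ℝ :=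
  (1 / n) * ∑ j ∈ range n, Real.cos (oddFreq n j / 2) / Real.sin (oddFreq n j / 2) *
    Real.sin (y * oddFreq n j) * Real.cos (oddFreq n j) ^ r

lemma oddFreq_pos {n : ℕ} (hn : 0 < n) (j : ℕ) : 0 < oddFreq n j := by
  unfold oddFreq; positivity

lemma oddFreq_lt_pi {n j : ℕ} (hj : j < n) : oddFreq n j < Real.pi := by
  have hn : (0 : ℝ) < n := by exact_mod_cast (Nat.zero_le j).trans_lt hj
  have hj' : (j : ℝ) + 1 ≤ n := by exact_mod_cast hj
  have h : oddFreq n j = (2 * j + 1) / (2 * n) * Real.pi := by unfold oddFreq; ring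
  rw [h]
  have : ((2 * j + 1) / (2 * n) : ℝ) < 1 := by rw [div_lt_one (by positivity)]; linarith
  nlinarith [Real.pi_pos]

lemma sin_half_oddFreq_pos {n j : ℕ} (hj : j < n) : 0 < Real.sin (oddFreq n j / 2) := by
  have h1 := oddFreq_pos ((Nat.zero_le j).trans_lt hj) j
  have h2 := oddFreq_lt_pi hj
  exact Real.sin_pos_of_pos_of_lt_pi (by linarith) (by linarith [Real.pi_pos])

lemma survivalSum_zero_right (n r : ℕ) : survivalSum n r 0 = 0 := by
  simp [survivalSum]

lemma survivalSum_right_end {n : ℕ} (hn : 0 < n) (r : ℕ) : survivalSum n r (2 * n) = 0 := by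
  have hn' : (n : ℝ) ≠ 0 := by positivity
  unfold survivalSum
  rw [sum_eq_zero, mul_zero]
  intro j _
  have : (((2 * n : ℤ)) : ℝ) * oddFreq n j = ((2 * j + 1 : ℕ) : ℝ) * Real.pi := by
    unfold oddFreq; push_cast; field_simp
  rw [this, Real.sin_nat_mul_pi]; ring

lemma survivalSum_succ (n r : ℕ) (y : ℤ) :
    survivalSum n (r + 1) y = (survivalSum n r (y + 1) + survivalSum n r (y - 1)) / 2 := by
  unfold survivalSum
  rw [← mul_add, ← sum_add_distrib, mul_div_assoc, sum_div]
  congr 1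
  refine sum_congr rfl fun j _ => ?_
  push_cast
  rw [add_mul, sub_mul, one_mul, Real.sin_add, Real.sin_sub]
  ring

lemma two_sin_mul_sum_cos (n : ℕ) (a : ℝ) :
    2 * Real.sin a * ∑ j ∈ range n, Real.cos ((2 * j + 1) * a) = Real.sin (2 * n * a) := by
  induction n with
  | zero => simp
  | succ n ih =>
    rw [sum_range_succ, mul_add, ih]
    have h1 : 2 * (n : ℝ) * a = (2 * n + 1) * a - a := by ring
    have h2 : 2 * ((n + 1 : ℕ) : ℝ) * a = (2 * n + 1) * a + a := by push_cast; ring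
    rw [h1, h2, Real.sin_add, Real.sin_sub]; ring

lemma sum_cos_oddFreq {n y : ℕ} (hy0 : 0 < y) (hy : y < 2 * n) :
    ∑ j ∈ range n, Real.cos (y * oddFreq n j) = 0 := by
  have hn : (0 : ℝ) < n := by exact_mod_cast (by omega : 0 < n)
  have hy0' : (0 : ℝ) < y := by exact_mod_cast hy0
  have hy' : (y : ℝ) < 2 * n := by exact_mod_cast hy
  have h := two_sin_mul_sum_cos n (y * (Real.pi / (2 * n)))
  have h2 : 2 * (n : ℝ) * (y * (Real.pi / (2 * n))) = y * Real.pi := by field_simp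
  rw [h2, Real.sin_nat_mul_pi] at h
  have hs : 0 < Real.sin (y * (Real.pi / (2 * n))) := by
    apply Real.sin_pos_of_pos_of_lt_pi
    · positivity
    · rw [show (y * (Real.pi / (2 * n)) : ℝ) = y / (2 * n) * Real.pi by ring]
      have : (y / (2 * n) : ℝ) < 1 := by rw [div_lt_one (by positivity)]; exact hy'
      nlinarith [Real.pi_pos]
  have h3 := (mul_eq_zero.1 h).resolve_left (by positivity)
  rw [← h3]
  refine sum_congr rfl fun j _ => ?_
  congr 1; unfold oddFreq; ring

lemma survivalSum_zero_add_one (n y : ℕ) :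
    survivalSum n 0 ((y + 1 : ℕ) : ℤ) - survivalSum n 0 (y : ℤ) =
      (1 / n) * (∑ j ∈ range n, Real.cos (((y + 1 : ℕ) : ℝ) * oddFreq n j)
        + ∑ j ∈ range n, Real.cos (y * oddFreq n j)) := by
  unfold survivalSum
  rw [← mul_sub, ← sum_sub_distrib, ← sum_add_distrib]
  congr 1
  refine sum_congr rfl fun j hj => ?_
  have hs := (sin_half_oddFreq_pos (mem_range.1 hj)).ne'
  set φ := oddFreq n j
  push_cast
  have e1 : ((y : ℝ) + 1) * φ = ((y + 1 / 2) * φ) + φ / 2 := by ring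
  have e2 : (y : ℝ) * φ = ((y + 1 / 2) * φ) - φ / 2 := by ring
  rw [e1, e2, Real.sin_add, Real.sin_sub, Real.cos_add, Real.cos_sub]
  field_simp
  ring

lemma survivalSum_zero_left {n y : ℕ} (hy : y + 1 < 2 * n) :
    survivalSum n 0 ((y + 1 : ℕ) : ℤ) = 1 := by
  have hn : 0 < n := by omega
  have hn' : (n : ℝ) ≠ 0 := by positivity
  induction y with
  | zero =>
    have h := survivalSum_zero_add_one n 0
    rw [sum_cos_oddFreq (by omega) hy] at h
    simp only [Nat.cast_zero, zero_mul, Real.cos_zero, survivalSum_zero_right] at h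
    simpa [hn'] using h
  | succ y ih =>
    have h := survivalSum_zero_add_one n (y + 1)
    rw [sum_cos_oddFreq (by omega) hy, sum_cos_oddFreq (by omega) (by omega), ih (by omega)] at h
    linarith

lemma abs_sin_natCast_mul_le (y : ℕ) (a : ℝ) : |Real.sin (y * a)| ≤ y * |Real.sin a| := by
  induction y with
  | zero => simp
  | succ y ih =>
    push_cast
    rw [add_mul, one_mul, Real.sin_add]
    refine (abs_add_le _ _).trans ?_
    rw [abs_mul, abs_mul, add_mul, one_mul]
    have h1 := mul_le_of_le_one_right (abs_nonneg (Real.sin (y * a))) (Real.abs_cos_le_one a)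
    have h2 := mul_le_of_le_one_left (abs_nonneg (Real.sin a)) (Real.abs_cos_le_one (y * a))
    linarith

lemma abs_cot_half_mul_sin_le {φ : ℝ} (h : Real.sin (φ / 2) ≠ 0) (y : ℕ) :
    |Real.cos (φ / 2) / Real.sin (φ / 2) * Real.sin (y * φ)| ≤ 2 * y := by
  rw [abs_mul]
  calc _ ≤ |Real.cos (φ / 2) / Real.sin (φ / 2)| * (y * |Real.sin φ|) := by
        gcongr; exact abs_sin_natCast_mul_le y φ
    _ = y * |2 * Real.cos (φ / 2) ^ 2| := by
        rw [mul_left_comm, ← abs_mul]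
        congr 2
        rw [show Real.sin φ = 2 * Real.sin (φ / 2) * Real.cos (φ / 2) by
          rw [← Real.sin_two_mul]; congr 1; ring]
        field_simp
    _ ≤ 2 * y := by
        rw [abs_of_nonneg (by positivity)]
        nlinarith [Real.cos_sq_le_one (φ / 2), (Nat.cast_nonneg y : (0 : ℝ) ≤ y)]

lemma abs_cos_le_cos_of_mem {a φ : ℝ} (ha : 0 ≤ a) (h1 : a ≤ φ) (h2 : φ ≤ Real.pi - a) :
    |Real.cos φ| ≤ Real.cos a := by
  rw [abs_le]
  constructor
  · rw [← Real.cos_pi_sub]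
    exact Real.cos_le_cos_of_nonneg_of_le_pi (by linarith) (by linarith) h2
  · exact Real.cos_le_cos_of_nonneg_of_le_pi ha (by linarith) h1

/-- The amplitude of the two leading modes `k = 1` and `k = 2n - 1`, which depends on the
parity `σ = ±1`. -/
noncomputable def leadingAmp (n : ℕ) (σ : ℝ) : ℝ :=
  (1 / n) * (Real.cos (Real.pi / (2 * n) / 2) / Real.sin (Real.pi / (2 * n) / 2)
    - σ * (Real.sin (Real.pi / (2 * n) / 2) / Real.cos (Real.pi / (2 * n) / 2)))

lemma abs_survivalSum_sub_le {n : ℕ} (hn : 3 ≤ n) (r y : ℕ) :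
    |survivalSum n r y - leadingAmp n ((-1) ^ (y + r)) *
        Real.cos (Real.pi / (2 * n)) ^ r * Real.sin (y * (Real.pi / (2 * n)))|
      ≤ 2 * y * Real.cos (3 * (Real.pi / (2 * n))) ^ r := by
  obtain ⟨p, rfl⟩ : ∃ p, n = p + 2 := ⟨n - 2, by omega⟩
  have hn0 : (0 : ℝ) < ((p + 2 : ℕ) : ℝ) := by positivity
  set θ : ℝ := Real.pi / (2 * ((p + 2 : ℕ) : ℝ)) with hθ
  have hθ0 : 0 < θ := by positivity
  have hθn : 2 * ((p : ℝ) + 2) * θ = Real.pi := by rw [hθ]; push_cast; field_simp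
  have hfirst : oddFreq (p + 2) 0 = θ := by simp [oddFreq, hθ]
  have hlast : oddFreq (p + 2) (p + 1) = Real.pi - θ := by
    rw [← hθn]; unfold oddFreq; rw [← hθ]; push_cast; ring
  have hp1 : (1 : ℝ) ≤ p := by exact_mod_cast (by omega : 1 ≤ p)
  have hcos3 : 0 ≤ Real.cos (3 * θ) :=
    Real.cos_nonneg_of_neg_pi_div_two_le_of_le (by nlinarith) (by nlinarith)
  have hmid : |∑ j ∈ range p, Real.cos (oddFreq (p + 2) (j + 1) / 2) /
      Real.sin (oddFreq (p + 2) (j + 1) / 2) *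
      Real.sin (y * oddFreq (p + 2) (j + 1)) * Real.cos (oddFreq (p + 2) (j + 1)) ^ r|
      ≤ p * (2 * y * Real.cos (3 * θ) ^ r) := by
    refine (abs_sum_le_sum_abs _ _).trans ?_
    refine (sum_le_card_nsmul _ _ (2 * y * Real.cos (3 * θ) ^ r) ?_).trans (by simp)
    intro j hj
    have hj' : (j : ℝ) + 1 ≤ p := by exact_mod_cast mem_range.1 hj
    have hj0 : (0 : ℝ) ≤ j := Nat.cast_nonneg j
    have hs := (sin_half_oddFreq_pos (n := p + 2) (j := j + 1)
      (by have := mem_range.1 hj; omega)).ne'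
    rw [abs_mul, abs_pow]
    have hf : oddFreq (p + 2) (j + 1) = (2 * j + 3) * θ := by
      unfold oddFreq; rw [← hθ]; push_cast; ring
    refine mul_le_mul (abs_cot_half_mul_sin_le hs y) ?_ (by positivity) (by positivity)
    refine pow_le_pow_left₀ (abs_nonneg _) (abs_cos_le_cos_of_mem (by positivity) ?_ ?_) r
    · rw [hf]; nlinarith
    · rw [hf, ← hθn]; nlinarith
  have hlead : survivalSum (p + 2) r y - leadingAmp (p + 2) ((-1) ^ (y + r)) *
        Real.cos θ ^ r * Real.sin (y * θ) = (1 / ((p + 2 : ℕ) : ℝ)) *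
      ∑ j ∈ range p, Real.cos (oddFreq (p + 2) (j + 1) / 2) /
      Real.sin (oddFreq (p + 2) (j + 1) / 2) *
      Real.sin (y * oddFreq (p + 2) (j + 1)) * Real.cos (oddFreq (p + 2) (j + 1)) ^ r := by
    unfold survivalSum leadingAmp
    rw [sum_range_succ, sum_range_succ', hfirst, hlast, ← hθ, Real.cos_pi_sub,
      show (Real.pi - θ) / 2 = Real.pi / 2 - θ / 2 by ring, Real.cos_pi_div_two_sub,
      Real.sin_pi_div_two_sub, neg_pow (Real.cos θ) r]
    have hy : Real.sin (((y : ℤ) : ℝ) * (Real.pi - θ)) = -((-1) ^ y * Real.sin (y * θ)) := by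
      rw [mul_sub, Int.cast_natCast, Real.sin_nat_mul_pi_sub]
    rw [hy, Int.cast_natCast, pow_add]
    ring
  rw [hlead, abs_mul, abs_of_nonneg (by positivity)]
  refine (mul_le_mul_of_nonneg_left hmid (by positivity)).trans ?_
  have : (1 / ((p + 2 : ℕ) : ℝ)) * p ≤ 1 := by
    rw [one_div_mul_eq_div, div_le_one hn0]; push_cast; linarith
  rw [← mul_assoc]
  exact mul_le_of_le_one_left (by positivity) this

lemma half_le_leadingAmp {n : ℕ} (hn : 3 ≤ n) {σ : ℝ} (hσ : σ ≤ 1) :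
    1 / 2 ≤ leadingAmp n σ := by
  have hn3 : (3 : ℝ) ≤ n := by exact_mod_cast hn
  unfold leadingAmp
  set θ : ℝ := Real.pi / (2 * n) with hθ
  have hθ0 : 0 < θ := by positivity
  have hθn : 2 * n * θ = Real.pi := by rw [hθ]; field_simp
  have hθ3 : θ ≤ Real.pi / 3 := by nlinarith
  have hc : 1 / 2 ≤ Real.cos θ := by
    rw [← Real.cos_pi_div_three]
    exact Real.cos_le_cos_of_nonneg_of_le_pi hθ0.le (by linarith [Real.pi_pos]) hθ3
  have hs2 : 0 < Real.sin (θ / 2) :=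
    Real.sin_pos_of_pos_of_lt_pi (by linarith) (by linarith [Real.pi_pos])
  have hc2 : 0 < Real.cos (θ / 2) :=
    Real.cos_pos_of_mem_Ioo ⟨by linarith [Real.pi_pos], by linarith [Real.pi_pos]⟩
  have hs : 0 < Real.sin θ := Real.sin_pos_of_pos_of_lt_pi hθ0 (by linarith [Real.pi_pos])
  have key : Real.cos (θ / 2) / Real.sin (θ / 2) - Real.sin (θ / 2) / Real.cos (θ / 2)
      = 2 * Real.cos θ / Real.sin θ := by
    have h1 : Real.sin θ = 2 * Real.sin (θ / 2) * Real.cos (θ / 2) := by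
      rw [← Real.sin_two_mul]; congr 1; ring
    have h2 : Real.cos θ = Real.cos (θ / 2) ^ 2 - Real.sin (θ / 2) ^ 2 := by
      rw [← Real.cos_two_mul']; congr 1; ring
    rw [h1, h2]; field_simp
  have h4 : n / 2 ≤ 2 * Real.cos θ / Real.sin θ := by
    rw [le_div_iff₀ hs]
    have : Real.sin θ ≤ θ := Real.sin_le hθ0.le
    nlinarith [Real.pi_lt_four]
  have h5 : σ * (Real.sin (θ / 2) / Real.cos (θ / 2)) ≤ Real.sin (θ / 2) / Real.cos (θ / 2) :=
    mul_le_of_le_one_left (by positivity) hσ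
  calc (1 / 2 : ℝ) = 1 / n * (n / 2) := by field_simp
    _ ≤ _ := by gcongr; linarith

lemma cos_three_mul_le {n : ℕ} (hn : 3 ≤ n) :
    Real.cos (3 * (Real.pi / (2 * n))) ≤
      Real.cos (Real.pi / (2 * n)) * Real.exp (-4 / (n : ℝ) ^ 2) := by
  have hn3 : (3 : ℝ) ≤ n := by exact_mod_cast hn
  set θ : ℝ := Real.pi / (2 * n) with hθ
  have hθ0 : 0 < θ := by positivity
  have hθn : 2 * n * θ = Real.pi := by rw [hθ]; field_simp
  have hθ2 : θ ≤ Real.pi / 2 := by nlinarith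
  have hc : 0 ≤ Real.cos θ :=
    Real.cos_nonneg_of_neg_pi_div_two_le_of_le (by linarith [Real.pi_pos]) hθ2
  have hs : 1 / (n : ℝ) ≤ Real.sin θ := by
    have := Real.mul_le_sin hθ0.le hθ2
    rwa [show 2 / Real.pi * θ = 1 / n by rw [hθ]; field_simp] at this
  have hs2 : 1 / (n : ℝ) ^ 2 ≤ Real.sin θ ^ 2 := by
    rw [← one_div_pow]; exact pow_le_pow_left₀ (by positivity) hs 2
  have h1 : Real.cos (3 * θ) = Real.cos θ * (1 - 4 * Real.sin θ ^ 2) := by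
    rw [Real.cos_three_mul, Real.sin_sq]; ring
  rw [h1]
  refine mul_le_mul_of_nonneg_left ?_ hc
  have := Real.add_one_le_exp (-4 / (n : ℝ) ^ 2)
  have h4 : -4 / (n : ℝ) ^ 2 = -4 * (1 / (n : ℝ) ^ 2) := by ring
  linarith

lemma abs_survivalSum_sub_linear_le {n : ℕ} (hn : 3 ≤ n) (r y : ℕ) :
    |survivalSum n r y - leadingAmp n ((-1) ^ (y + r)) *
        Real.cos (Real.pi / (2 * n)) ^ r * (Real.pi / (2 * n)) * y|
      ≤ leadingAmp n ((-1) ^ (y + r)) * Real.cos (Real.pi / (2 * n)) ^ r *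
        (Real.pi / (2 * n)) * y *
        ((y * (Real.pi / (2 * n))) ^ 2 / 6 + 4 * n * Real.exp (-4 / (n : ℝ) ^ 2) ^ r) := by
  have hn3 : (3 : ℝ) ≤ n := by exact_mod_cast hn
  have h := abs_survivalSum_sub_le hn r y
  have hB := half_le_leadingAmp hn (σ := (-1) ^ (y + r)) (by
    rcases neg_one_pow_eq_or ℝ (y + r) with h | h <;> rw [h]; norm_num)
  set B := leadingAmp n ((-1) ^ (y + r))
  have h3 := cos_three_mul_le hn
  set θ : ℝ := Real.pi / (2 * n) with hθ
  have hθ0 : 0 < θ := by positivity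
  have hθn : 2 * n * θ = Real.pi := by rw [hθ]; field_simp
  have hc : 0 ≤ Real.cos θ :=
    Real.cos_nonneg_of_neg_pi_div_two_le_of_le (by linarith [Real.pi_pos]) (by nlinarith)
  have hc3 : 0 ≤ Real.cos (3 * θ) :=
    Real.cos_nonneg_of_neg_pi_div_two_le_of_le (by nlinarith) (by nlinarith)
  set ρ := Real.exp (-4 / (n : ℝ) ^ 2)
  have hρ : 0 < ρ := Real.exp_pos _
  have h3r : Real.cos (3 * θ) ^ r ≤ Real.cos θ ^ r * ρ ^ r := by
    rw [← mul_pow]; exact pow_le_pow_left₀ hc3 h3 r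
  have hy0 : (0 : ℝ) ≤ y := Nat.cast_nonneg y
  have hsin : |Real.sin (y * θ) - y * θ| ≤ (y * θ) * ((y * θ) ^ 2 / 6) := by
    have hyθ : 0 ≤ y * θ := by positivity
    rw [abs_sub_comm, abs_of_nonneg (by linarith [Real.sin_le hyθ])]
    rcases hyθ.eq_or_lt with h0 | h0
    · simp [← h0]
    · nlinarith [Real.sin_gt_sub_cube h0]
  have hBn : 1 ≤ B * θ * (2 * n) := by
    have : B * θ * (2 * n) = B * Real.pi := by rw [← hθn]; ring
    rw [this]; nlinarith [Real.pi_gt_three]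
  have e : survivalSum n r y - B * Real.cos θ ^ r * θ * y =
      (survivalSum n r y - B * Real.cos θ ^ r * Real.sin (y * θ)) +
        B * Real.cos θ ^ r * (Real.sin (y * θ) - y * θ) := by ring
  rw [e]
  refine (abs_add_le _ _).trans ?_
  rw [abs_mul (B * Real.cos θ ^ r), abs_of_nonneg (a := B * Real.cos θ ^ r) (by positivity)]
  have t1 := mul_le_mul_of_nonneg_left hsin (by positivity : 0 ≤ B * Real.cos θ ^ r)
  have t2 : 2 * y * Real.cos (3 * θ) ^ r ≤
      B * Real.cos θ ^ r * θ * y * (4 * n * ρ ^ r) := by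
    calc _ ≤ 2 * y * (Real.cos θ ^ r * ρ ^ r) := by gcongr
      _ ≤ 2 * y * (Real.cos θ ^ r * ρ ^ r) * (B * θ * (2 * n)) :=
        le_mul_of_one_le_right (by positivity) hBn
      _ = _ := by ring
  linarith

lemma abs_div_sub_div_le {Q₁ Q₂ D x y ε : ℝ} (hD : 0 < D) (hx : 0 < x) (hy : 0 ≤ y)
    (hε : ε ≤ 1 / 2) (h1 : |Q₁ - D * y| ≤ D * y * ε) (h2 : |Q₂ - D * x| ≤ D * x * ε) :
    |Q₁ / Q₂ - y / x| ≤ 4 * ε * (y / x) := by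
  have hDx : 0 < D * x := by positivity
  have hQ : D * x / 2 ≤ Q₂ := by
    have := (abs_le.1 h2).1
    nlinarith
  have hQ0 : 0 < Q₂ := by linarith
  have hε0 : 0 ≤ ε := nonneg_of_mul_nonneg_right ((abs_nonneg _).trans h2) hDx
  rw [div_sub_div _ _ hQ0.ne' hx.ne', abs_div, abs_of_pos (a := Q₂ * x) (by positivity),
    div_le_iff₀ (by positivity)]
  have e : Q₁ * x - Q₂ * y = (Q₁ - D * y) * x - (Q₂ - D * x) * y := by ring
  rw [e]
  refine (abs_sub _ _).trans ?_
  rw [abs_mul, abs_mul, abs_of_pos hx, abs_of_nonneg hy]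
  have t1 := mul_le_mul_of_nonneg_right h1 hx.le
  have t2 := mul_le_mul_of_nonneg_right h2 hy
  have t3 : 4 * ε * y * (D * x / 2) ≤ 4 * ε * y * Q₂ := by gcongr
  have t4 : 4 * ε * (y / x) * (Q₂ * x) = 4 * ε * y * Q₂ := by field_simp
  nlinarith

set_option maxHeartbeats 800000 in
lemma abs_survivalSum_div_sub_le {n x y T r : ℕ} {A : ℝ} (hn : 3 ≤ n) (hx : 1 ≤ x)
    (hT : 1 ≤ T) (hy : y ≤ x + T) (hpar : (-1 : ℝ) ^ (y + r) = (-1) ^ (x + (r + T)))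
    (hA : 4 * n * Real.exp (-4 / (n : ℝ) ^ 2) ^ r ≤ A / n ^ 2)
    (hε : (((x : ℝ) + 1) ^ 2 + A + 2) * T ^ 2 / n ^ 2 ≤ 1 / 2) :
    |survivalSum n r y / survivalSum n (r + T) x - y / x| ≤
      4 * ((((x : ℝ) + 1) ^ 2 + A + 2) * T ^ 2 / n ^ 2) * (y / x) := by
  have hn3 : (3 : ℝ) ≤ n := by exact_mod_cast hn
  have hx1 : (1 : ℝ) ≤ x := by exact_mod_cast hx
  have hT1 : (1 : ℝ) ≤ T := by exact_mod_cast hT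
  have hy1 : (y : ℝ) ≤ x + T := by exact_mod_cast hy
  have hy0 : (0 : ℝ) ≤ y := Nat.cast_nonneg y
  have h1 := abs_survivalSum_sub_linear_le hn r y
  have h2 := abs_survivalSum_sub_linear_le hn (r + T) x
  rw [hpar] at h1
  have hB := half_le_leadingAmp hn (σ := (-1) ^ (x + (r + T))) (by
    rcases neg_one_pow_eq_or ℝ (x + (r + T)) with h | h <;> rw [h]; norm_num)
  set B := leadingAmp n ((-1) ^ (x + (r + T)))
  set θ : ℝ := Real.pi / (2 * n) with hθ
  have hθ0 : 0 < θ := by positivity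
  have hθn : 2 * n * θ = Real.pi := by rw [hθ]; field_simp
  have hc : 0 < Real.cos θ :=
    Real.cos_pos_of_mem_Ioo ⟨by linarith [Real.pi_pos], by nlinarith⟩
  have hc1 : Real.cos θ ≤ 1 := Real.cos_le_one θ
  set ρ := Real.exp (-4 / (n : ℝ) ^ 2)
  have hρ : 0 < ρ := Real.exp_pos _
  have hρ1 : ρ ≤ 1 := Real.exp_le_one_iff.2 (by
    rw [neg_div]; linarith [show 0 ≤ 4 / (n : ℝ) ^ 2 by positivity])
  have hA0 : 0 ≤ A / n ^ 2 := le_trans (by positivity) hA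
  have hA0' : 0 ≤ A := by
    by_contra! h
    exact absurd hA0 (not_le.2 (div_neg_of_neg_of_pos h (by positivity)))
  have hθsq : θ ^ 2 ≤ 4 / (n : ℝ) ^ 2 := by
    rw [hθ, div_pow, mul_pow, div_le_div_iff₀ (by positivity) (by positivity)]
    have : Real.pi ^ 2 ≤ 16 := by nlinarith [Real.pi_pos, Real.pi_lt_four]
    nlinarith [sq_nonneg (n : ℝ)]
  clear_value B θ ρ
  have hT2 : (T : ℝ) ≤ T ^ 2 := by nlinarith
  have hT21 : (1 : ℝ) ≤ T ^ 2 := by nlinarith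
  have hAT : A / (n : ℝ) ^ 2 ≤ A * T ^ 2 / n ^ 2 := by
    gcongr; exact le_mul_of_one_le_right hA0' hT21
  have hquad : ∀ z : ℝ, 0 ≤ z → z ≤ x + T →
      (z * θ) ^ 2 / 6 ≤ ((x : ℝ) + 1) ^ 2 * T ^ 2 / n ^ 2 := by
    intro z hz0 hz
    have hz2 : z ≤ (x + 1) * T := by nlinarith
    have : z ^ 2 ≤ ((x + 1) * T) ^ 2 := pow_le_pow_left₀ hz0 hz2 2
    calc (z * θ) ^ 2 / 6 = z ^ 2 * θ ^ 2 / 6 := by ring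
      _ ≤ (((x : ℝ) + 1) * T) ^ 2 * (4 / (n : ℝ) ^ 2) / 6 := by gcongr
      _ = (4 / 6) * (((x : ℝ) + 1) ^ 2 * T ^ 2 / n ^ 2) := by ring
      _ ≤ _ := mul_le_of_le_one_left (by positivity) (by norm_num)
  have hsplit : (((x : ℝ) + 1) ^ 2 + A + 2) * T ^ 2 / n ^ 2 =
    ((x : ℝ) + 1) ^ 2 * T ^ 2 / n ^ 2 + A * T ^ 2 / n ^ 2 + 2 * T ^ 2 / n ^ 2 := by ring
  have h2pos : 0 ≤ 2 * (T : ℝ) ^ 2 / n ^ 2 := by positivity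
  have hD : 0 < B * Real.cos θ ^ r * θ := by positivity
  refine abs_div_sub_div_le hD (by linarith) hy0 hε (h1.trans ?_) ?_
  · refine mul_le_mul_of_nonneg_left ?_ (by positivity)
    have := hquad y hy0 hy1
    linarith
  · have hbern : 1 - Real.cos θ ^ T ≤ 2 * T ^ 2 / n ^ 2 := by
      have b1 := one_add_mul_le_pow (a := Real.cos θ - 1)
        (show (-2 : ℝ) ≤ Real.cos θ - 1 by linarith) T
      have b2 := Real.one_sub_sq_div_two_le_cos (x := θ)
      rw [show 1 + (Real.cos θ - 1) = Real.cos θ by ring] at b1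
      calc 1 - Real.cos θ ^ T ≤ T * (1 - Real.cos θ) := by linarith
        _ ≤ (T : ℝ) ^ 2 * (4 / (n : ℝ) ^ 2 / 2) := by
          refine mul_le_mul hT2 ?_ (by linarith) (by positivity)
          linarith
        _ = _ := by ring
    have hcT : Real.cos θ ^ T ≤ 1 := pow_le_one₀ hc.le hc1
    have hdiff : |B * Real.cos θ ^ (r + T) * θ * x - B * Real.cos θ ^ r * θ * x| ≤
        B * Real.cos θ ^ r * θ * x * (2 * T ^ 2 / n ^ 2) := by
      rw [show B * Real.cos θ ^ (r + T) * θ * x - B * Real.cos θ ^ r * θ * x =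
        -(B * Real.cos θ ^ r * θ * x * (1 - Real.cos θ ^ T)) by rw [pow_add]; ring, abs_neg,
        abs_of_nonneg (mul_nonneg (by positivity) (by linarith))]
      exact mul_le_mul_of_nonneg_left hbern (by positivity)
    have hmain : B * Real.cos θ ^ (r + T) * θ * x *
        ((x * θ) ^ 2 / 6 + 4 * n * ρ ^ (r + T)) ≤ B * Real.cos θ ^ r * θ * x *
        (((x : ℝ) + 1) ^ 2 * T ^ 2 / n ^ 2 + A * T ^ 2 / n ^ 2) := by
      have hq := hquad x (by linarith) (by linarith)
      have hp : 4 * n * ρ ^ (r + T) ≤ A * T ^ 2 / n ^ 2 := by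
        refine le_trans ?_ (hA.trans hAT)
        gcongr ?_ * ?_
        exact pow_le_pow_of_le_one hρ.le hρ1 (by omega)
      have hcc : Real.cos θ ^ (r + T) ≤ Real.cos θ ^ r :=
        pow_le_pow_of_le_one hc.le hc1 (by omega)
      gcongr
    calc _ ≤ _ := abs_sub_le _ (B * Real.cos θ ^ (r + T) * θ * x) _
      _ ≤ _ := add_le_add (h2.trans hmain) hdiff
      _ = _ := by rw [hsplit]; ring

lemma exp_pow_le_of_cube_le {n r : ℕ} {d : ℝ} (hn : 0 < n) (hd : 0 < d)
    (hr : d * (n : ℝ) ^ 3 ≤ r) :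
    4 * n * Real.exp (-4 / (n : ℝ) ^ 2) ^ r ≤ 3 / (8 * d ^ 3) / n ^ 2 := by
  have hn0 : (0 : ℝ) < n := by exact_mod_cast hn
  have h1 : Real.exp (-4 / (n : ℝ) ^ 2) ^ r ≤ Real.exp (-(4 * d * n)) := by
    rw [← Real.exp_nat_mul]
    apply Real.exp_le_exp.2
    rw [show (r : ℝ) * (-4 / (n : ℝ) ^ 2) = -(4 * r / n ^ 2) by ring]
    apply neg_le_neg
    rw [le_div_iff₀ (by positivity)]
    nlinarith
  have h2 : Real.exp (-(4 * d * n)) ≤ 6 / (4 * d * n) ^ 3 := by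
    have := Real.pow_div_factorial_le_exp (4 * d * n) (by positivity) 3
    rw [Real.exp_neg, inv_le_comm₀ (Real.exp_pos _) (by positivity), inv_div]
    simpa [Nat.factorial] using this
  calc _ ≤ 4 * n * (6 / (4 * d * n) ^ 3) := by gcongr; exact h1.trans h2
    _ = _ := by field_simp; norm_num

lemma IsSRW.measureReal_follow {Ω : Type*} [MeasurableSpace Ω] {P : ℤ → Measure Ω}
    {S : ℕ → Ω → ℤ} (hS : IsSRW P S) (k : ℕ) (γ : ℕ → ℤ)
    (hstep : ∀ s < k, γ (s + 1) = γ s + 1 ∨ γ (s + 1) = γ s - 1) :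
    (P (γ 0)).real {ω | ∀ s ≤ k, S s ω = γ s} = (1 / 2) ^ k := by
  rw [measureReal_def, hS.2.2 (γ 0) k γ rfl, prod_congr rfl fun s hs =>
    show srwStep (γ s) (γ (s + 1)) = 1 / 2 from if_pos (hstep s (mem_range.1 hs))]
  simp

lemma measurableSet_follow {Ω : Type*} [MeasurableSpace Ω] {S : ℕ → Ω → ℤ}
    (hS : ∀ t, Measurable (S t)) (k : ℕ) (γ : ℕ → ℤ) :
    MeasurableSet {ω | ∀ s ≤ k, S s ω = γ s} := by
  have : {ω | ∀ s ≤ k, S s ω = γ s} = ⋂ s ∈ Set.Iic k, S s ⁻¹' {γ s} := by ext; simp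
  rw [this]
  exact MeasurableSet.biInter (Set.to_countable _) fun s _ => hS s (measurableSet_singleton _)

lemma measurableSet_survive {Ω : Type*} [MeasurableSpace Ω] {S : ℕ → Ω → ℤ}
    (hS : ∀ t, Measurable (S t)) (k : ℕ) (B : Set ℤ) :
    MeasurableSet {ω | ∀ s ≤ k, S s ω ∉ B} := by
  have : {ω | ∀ s ≤ k, S s ω ∉ B} = ⋂ s ∈ Set.Iic k, S s ⁻¹' Bᶜ := by ext; simp
  rw [this]
  exact MeasurableSet.biInter (Set.to_countable _) fun s _ => hS s (MeasurableSet.of_discrete)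

lemma survive_inter_follow_eq_empty {Ω : Type*} {S : ℕ → Ω → ℤ} {m k s : ℕ} {B : Set ℤ}
    {γ : ℕ → ℤ} (hm : s ≤ m) (hk : s ≤ k) (hB : γ s ∈ B) :
    {ω | ∀ s ≤ m, S s ω ∉ B} ∩ {ω | ∀ s ≤ k, S s ω = γ s} = ∅ := by
  ext ω
  simp only [Set.mem_inter_iff, Set.mem_ofPred_eq, Set.mem_empty_iff_false, iff_false, not_and]
  intro h1 h2
  exact h1 s hm (h2 s hk ▸ hB)

lemma IsSRW.measureReal_survive_inter_follow {Ω : Type*} [MeasurableSpace Ω]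
    {P : ℤ → Measure Ω} {S : ℕ → Ω → ℤ} (hS : IsSRW P S) {n : ℕ} (x : ℤ) (r k : ℕ) (γ : ℕ → ℤ)
    (h0 : γ 0 = x) (hstep : ∀ s < k, γ (s + 1) = γ s + 1 ∨ γ (s + 1) = γ s - 1)
    (hγ : ∀ s ≤ k, 0 < γ s ∧ γ s < 2 * n) :
    (P x).real ({ω | ∀ s ≤ k + r, S s ω ∉ ({0, (2 * n : ℤ)} : Set ℤ)} ∩
      {ω | ∀ s ≤ k, S s ω = γ s}) = (1 / 2) ^ k * survivalSum n r (γ k) := by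
  have := hS.1 x
  induction r generalizing k γ with
  | zero =>
    have hsub : {ω | ∀ s ≤ k, S s ω = γ s} ⊆
        {ω | ∀ s ≤ k + 0, S s ω ∉ ({0, (2 * n : ℤ)} : Set ℤ)} := by
      intro ω hω s hs
      have := hγ s hs
      simp only [hω s hs, Set.mem_insert_iff, Set.mem_singleton_iff]
      omega
    rw [Set.inter_eq_right.2 hsub, ← h0, hS.measureReal_follow k γ hstep]
    have hk := hγ k le_rfl
    obtain ⟨y, hy⟩ : ∃ y : ℕ, γ k = ((y + 1 : ℕ) : ℤ) := ⟨(γ k - 1).toNat, by omega⟩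
    rw [hy, survivalSum_zero_left (by omega), mul_one]
  | succ r ih =>
    have hk := hγ k le_rfl
    have hn : 0 < n := by omega
    set ext : ℤ → ℕ → ℤ := fun e => Function.update γ (k + 1) (γ k + e) with hext
    have hext_le : ∀ e, ∀ s ≤ k, ext e s = γ s := fun e s hs =>
      Function.update_of_ne (by omega) _ _
    have hext_last : ∀ e, ext e (k + 1) = γ k + e := fun e => Function.update_self _ _ _
    have hext_step : ∀ e, e = 1 ∨ e = -1 → ∀ s < k + 1,
        ext e (s + 1) = ext e s + 1 ∨ ext e (s + 1) = ext e s - 1 := by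
      intro e he s hs
      rcases (Nat.lt_succ_iff.1 hs).lt_or_eq with h | rfl
      · rw [hext_le e _ h, hext_le e _ h.le]; exact hstep s h
      · rw [hext_last, hext_le e _ le_rfl]; omega
    set A : Set Ω := {ω | ∀ s ≤ k + 1 + r, S s ω ∉ ({0, (2 * n : ℤ)} : Set ℤ)} with hA
    set F : ℤ → Set Ω := fun e => {ω | ∀ s ≤ k + 1, S s ω = ext e s} with hF
    have hone : ∀ e, e = 1 ∨ e = -1 →
        (P x).real (A ∩ F e) = (1 / 2) ^ (k + 1) * survivalSum n r (γ k + e) := by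
      intro e he
      by_cases hin : 0 < γ k + e ∧ γ k + e < 2 * n
      · have := ih (k + 1) (ext e) (by rw [hext_le e 0 (Nat.zero_le _), h0]) (hext_step e he) (by
          intro s hs
          rcases hs.lt_or_eq with h | rfl
          · rw [hext_le e s (by omega)]; exact hγ s (by omega)
          · rw [hext_last]; exact hin)
        rw [this, hext_last]
      · have hbd : γ k + e = 0 ∨ γ k + e = 2 * n := by omega
        have : A ∩ F e = ∅ := survive_inter_follow_eq_empty (s := k + 1) (by omega) le_rfl (by
          rw [hext_last]; simpa using hbd)
        rw [this, measureReal_empty]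
        rcases hbd with h | h <;> rw [h]
        · rw [survivalSum_zero_right, mul_zero]
        · rw [survivalSum_right_end hn, mul_zero]
    have hFm : ∀ e, MeasurableSet (F e) := fun e => measurableSet_follow hS.2.1 _ _
    have hdisj : Disjoint (F 1) (F (-1)) := by
      rw [Set.disjoint_left]
      intro ω h1 h2
      have e1 := h1 (k + 1) le_rfl
      have e2 := h2 (k + 1) le_rfl
      rw [hext_last] at e1 e2
      omega
    have hsub : F 1 ∪ F (-1) ⊆ {ω | ∀ s ≤ k, S s ω = γ s} := by
      rintro ω (h | h) s hs <;> rw [h s (by omega), hext_le _ s hs]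
    have hFmeas : ∀ e, e = 1 ∨ e = -1 → (P x).real (F e) = (1 / 2) ^ (k + 1) := by
      intro e he
      have := hS.measureReal_follow (k + 1) (ext e) (hext_step e he)
      rwa [hext_le e 0 (Nat.zero_le _), h0] at this
    have hae : (F 1 ∪ F (-1) : Set Ω) =ᵐ[P x] {ω | ∀ s ≤ k, S s ω = γ s} := by
      refine ae_eq_of_subset_of_measure_ge hsub ?_
        ((hFm 1).union (hFm (-1))).nullMeasurableSet (measure_ne_top _ _)
      rw [← ENNReal.toReal_le_toReal (measure_ne_top _ _) (measure_ne_top _ _)]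
      change (P x).real _ ≤ (P x).real _
      rw [measureReal_union hdisj (hFm _), hFmeas 1 (by simp), hFmeas (-1) (by simp), ← h0,
        hS.measureReal_follow k γ hstep, pow_succ]
      linarith
    have hAeq : {ω | ∀ s ≤ k + (r + 1), S s ω ∉ ({0, (2 * n : ℤ)} : Set ℤ)} = A := by
      rw [hA, show k + (r + 1) = k + 1 + r by omega]
    rw [hAeq, ← measureReal_congr ((ae_eq_refl A).inter hae), Set.inter_union_distrib_left,
      measureReal_union (hdisj.mono Set.inter_subset_right Set.inter_subset_right)
        ((measurableSet_survive hS.2.1 _ _).inter (hFm _)), hone 1 (by simp), hone (-1) (by simp),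
      survivalSum_succ, pow_succ, sub_eq_add_neg]
    ring

lemma IsSRW.measureReal_survive {Ω : Type*} [MeasurableSpace Ω]
    {P : ℤ → Measure Ω} {S : ℕ → Ω → ℤ} (hS : IsSRW P S) {n : ℕ} {x : ℤ} (r : ℕ)
    (hx0 : 0 < x) (hx : x < 2 * n) :
    (P x).real {ω | ∀ s ≤ r, S s ω ∉ ({0, (2 * n : ℤ)} : Set ℤ)} = survivalSum n r x := by
  have := hS.1 x
  have h := hS.measureReal_survive_inter_follow (n := n) x r 0 (fun _ => x) rfl (by simp)
    (fun _ _ => ⟨hx0, hx⟩)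
  have hfull : {ω | ∀ s ≤ 0, S s ω = x} =ᵐ[P x] Set.univ := by
    rw [ae_eq_univ_iff_measure_eq (measurableSet_follow hS.2.1 0 fun _ => x).nullMeasurableSet,
      hS.2.2 x 0 (fun _ => x) rfl]
    simp
  rw [measureReal_congr ((ae_eq_refl _).inter hfull), Set.inter_univ, zero_add] at h
  simpa using h

lemma condStep_prod_eq {γ : ℕ → ℤ} (k : ℕ)
    (hstep : ∀ s < k, γ (s + 1) = γ s + 1 ∨ γ (s + 1) = γ s - 1) (hγ : ∀ s ≤ k, 0 < γ s) :
    (∏ s ∈ range k, condStep (γ s) (γ (s + 1))).toReal = (1 / 2) ^ k * (γ k / γ 0) := by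
  induction k with
  | zero =>
    have : (γ 0 : ℝ) ≠ 0 := by exact_mod_cast (hγ 0 le_rfl).ne'
    simp [this]
  | succ k ih =>
    have hk := hγ k (by omega)
    have h0 := hγ 0 (by omega)
    have hk1 : (1 : ℝ) ≤ γ k := by exact_mod_cast hk
    have h01 : (1 : ℝ) ≤ γ 0 := by exact_mod_cast h0
    have hc : (condStep (γ k) (γ (k + 1))).toReal = γ (k + 1) / (2 * γ k) := by
      unfold condStep
      rcases hstep k (by omega) with h | h <;> rw [h]
      · rw [if_pos rfl, ENNReal.toReal_ofReal (by positivity)]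
        push_cast; rfl
      · rw [if_neg (by omega), if_pos rfl,
          ENNReal.toReal_ofReal (div_nonneg (by linarith) (by linarith))]
        push_cast; rfl
    rw [prod_range_succ, ENNReal.toReal_mul, ih (fun s hs => hstep s (by omega))
      (fun s hs => hγ s (by omega)), hc, pow_succ]
    field_simp

lemma exists_step_one_zero {γ : ℕ → ℤ} {k : ℕ} (h0 : 0 < γ 0)
    (hstep : ∀ s < k, γ (s + 1) = γ s + 1 ∨ γ (s + 1) = γ s - 1) (h : ∃ s ≤ k, γ s ≤ 0) :
    ∃ s < k, γ s = 1 ∧ γ (s + 1) = 0 := by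
  classical
  obtain ⟨hle, hneg⟩ := Nat.find_spec h
  obtain ⟨s, hs⟩ : ∃ s, Nat.find h = s + 1 :=
    Nat.exists_eq_succ_of_ne_zero fun h' => by rw [h'] at hneg; omega
  rw [hs] at hle hneg
  have hpos : 0 < γ s := by
    by_contra! h'
    exact Nat.find_min h (m := s) (by omega) ⟨by omega, h'⟩
  have := hstep s (by omega)
  exact ⟨s, by omega, by omega, by omega⟩

lemma condStep_one_zero : condStep 1 0 = 0 := by simp [condStep]

lemma pathOf_zero (x : ℤ) {T : ℕ} (ε : Fin T → Bool) : pathOf x ε 0 = x := by simp [pathOf]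

lemma pathOf_succ (x : ℤ) {T : ℕ} (ε : Fin T → Bool) (i : Fin T) :
    pathOf x ε (i + 1) = pathOf x ε i + if ε i then 1 else -1 := by
  have : univ.filter (fun j : Fin T => (j : ℕ) < i + 1) =
      insert i (univ.filter fun j : Fin T => (j : ℕ) < i) := by
    ext j; simp [Fin.ext_iff]; omega
  unfold pathOf
  rw [this, sum_insert (by simp)]
  ring

lemma pathOf_step (x : ℤ) {T : ℕ} (ε : Fin T → Bool) {s : ℕ} (hs : s < T) :
    pathOf x ε (s + 1) = pathOf x ε s + 1 ∨ pathOf x ε (s + 1) = pathOf x ε s - 1 := by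
  have := pathOf_succ x ε ⟨s, hs⟩
  dsimp only at this
  rw [this]
  cases ε ⟨s, hs⟩ <;> simp [sub_eq_add_neg]

lemma eq_of_pathOf_eq {x : ℤ} {T : ℕ} {ε δ : Fin T → Bool}
    (h : ∀ s ≤ T, pathOf x ε s = pathOf x δ s) : ε = δ := by
  ext i
  have h1 := pathOf_succ x ε i
  rw [h _ i.2, h _ i.2.le, pathOf_succ] at h1
  cases hε : ε i <;> cases hδ : δ i <;> simp_all

lemma pathOf_le (x : ℤ) {T : ℕ} (ε : Fin T → Bool) {s : ℕ} (hs : s ≤ T) :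
    pathOf x ε s ≤ x + s := by
  induction s with
  | zero => simp [pathOf_zero]
  | succ s ih =>
    have := ih (by omega)
    have := pathOf_step x ε hs
    push_cast; omega

lemma even_pathOf_sub (x : ℤ) {T : ℕ} (ε : Fin T → Bool) {s : ℕ} (hs : s ≤ T) :
    Even (pathOf x ε s - (x + s)) := by
  induction s with
  | zero => simp [pathOf_zero]
  | succ s ih =>
    obtain ⟨a, ha⟩ := ih (by omega)
    rcases pathOf_step x ε hs with h | h
    · exact ⟨a, by push_cast; omega⟩
    · exact ⟨a - 1, by push_cast; omega⟩

lemma sum_measureReal_pathOf_le_one {Ω : Type*} [MeasurableSpace Ω] (μ : Measure Ω)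
    [IsProbabilityMeasure μ] {X : ℕ → Ω → ℤ} (hX : ∀ t, Measurable (X t)) (x : ℤ) (T : ℕ) :
    ∑ ε : Fin T → Bool, μ.real {ω | ∀ s ≤ T, X s ω = pathOf x ε s} ≤ 1 := by
  refine (sum_measureReal_le_measureReal_univ (fun ε _ => measurableSet_follow hX T _) ?_).trans
    (by simp)
  intro ε _ δ _ hne
  rw [Function.onFun, Set.disjoint_left]
  intro ω h1 h2
  exact hne (eq_of_pathOf_eq (x := x) fun s hs => (h1 s hs).symm.trans (h2 s hs))

lemma tendsto_floor_rpow_div_atTop {μ : ℝ} (hμ : μ < 1) :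
    Tendsto (fun n : ℕ => (⌊(n : ℝ) ^ μ⌋₊ : ℝ) / n) atTop (𝓝 0) := by
  have h := (tendsto_rpow_neg_atTop (y := 1 - μ) (by linarith)).comp
    (tendsto_natCast_atTop_atTop (R := ℝ))
  refine squeeze_zero' (Eventually.of_forall fun n => by positivity) ?_ h
  filter_upwards [eventually_ge_atTop 1] with n hn
  have hn0 : (0 : ℝ) < n := by exact_mod_cast hn
  rw [Function.comp_apply, neg_sub, Real.rpow_sub_one hn0.ne']
  gcongr
  exact Nat.floor_le (by positivity)

lemma abs_condWalk_sub_cond_srw_le {Ω Ω' : Type*} [MeasurableSpace Ω] [MeasurableSpace Ω']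
    {P : ℤ → Measure Ω} {S : ℕ → Ω → ℤ} (hS : IsSRW P S) {Pr : Measure Ω'} {X : ℕ → Ω' → ℤ}
    {x n T t : ℕ} {A : ℝ} (hX : IsCondWalk Pr X x) (hx : 1 ≤ x) (hn : 3 ≤ n) (hT : 1 ≤ T)
    (hTt : T ≤ t) (hxT : x + T < 2 * n)
    (hA : 4 * n * Real.exp (-4 / (n : ℝ) ^ 2) ^ (t - T) ≤ A / n ^ 2)
    (hε : (((x : ℝ) + 1) ^ 2 + A + 2) * T ^ 2 / n ^ 2 ≤ 1 / 2) (ε : Fin T → Bool) :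
    |Pr.real {ω | ∀ s ≤ T, X s ω = pathOf x ε s}
      - (cond (P x) {ω | ∀ s ≤ t, S s ω ∉ ({0, (2 * n : ℤ)} : Set ℤ)}).real
          {ω | ∀ s ≤ T, S s ω = pathOf x ε s}| ≤
      4 * ((((x : ℝ) + 1) ^ 2 + A + 2) * T ^ 2 / n ^ 2) *
        Pr.real {ω | ∀ s ≤ T, X s ω = pathOf x ε s} := by
  set γ := pathOf (x : ℤ) ε with hγ
  have h0 : γ 0 = x := pathOf_zero _ _
  have hstep : ∀ s < T, γ (s + 1) = γ s + 1 ∨ γ (s + 1) = γ s - 1 := fun s hs =>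
    pathOf_step _ _ hs
  have hPr : Pr.real {ω | ∀ s ≤ T, X s ω = γ s} =
      (∏ s ∈ range T, condStep (γ s) (γ (s + 1))).toReal := by
    rw [measureReal_def, hX.2.2 T γ h0]
  have hcond : (cond (P x) {ω | ∀ s ≤ t, S s ω ∉ ({0, (2 * n : ℤ)} : Set ℤ)}).real
      {ω | ∀ s ≤ T, S s ω = γ s} = (survivalSum n t x)⁻¹ *
        (P x).real ({ω | ∀ s ≤ t, S s ω ∉ ({0, (2 * n : ℤ)} : Set ℤ)} ∩
          {ω | ∀ s ≤ T, S s ω = γ s}) := by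
    rw [← hS.measureReal_survive t (by omega) (by omega), measureReal_def,
      cond_apply (measurableSet_survive hS.2.1 _ _), ENNReal.toReal_mul, ENNReal.toReal_inv]
    rfl
  rw [hPr, hcond]
  by_cases hpos : ∀ s ≤ T, 0 < γ s
  · have hin : ∀ s ≤ T, 0 < γ s ∧ γ s < 2 * n := fun s hs =>
      ⟨hpos s hs, by have : γ s ≤ x + s := pathOf_le (x : ℤ) ε hs; omega⟩
    have hmeas := hS.measureReal_survive_inter_follow (n := n) x (t - T) T γ h0 hstep hin
    rw [Nat.add_sub_cancel' hTt] at hmeas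
    rw [hmeas, condStep_prod_eq T hstep hpos, h0]
    obtain ⟨y, hy⟩ := Int.eq_ofNat_of_zero_le (hpos T le_rfl).le
    have hyT := pathOf_le (x : ℤ) ε le_rfl
    obtain ⟨a, ha⟩ := even_pathOf_sub (x : ℤ) ε le_rfl
    rw [← hγ, hy] at hyT ha
    have hpar : (-1 : ℝ) ^ (y + (t - T)) = (-1) ^ (x + ((t - T) + T)) := by
      rcases Nat.even_or_odd (y + (t - T)) with h | h
      · rw [h.neg_one_pow, Even.neg_one_pow]
        rw [Nat.even_iff] at h ⊢; omega
      · rw [h.neg_one_pow, Odd.neg_one_pow]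
        rw [Nat.odd_iff] at h ⊢; omega
    have hmain := abs_survivalSum_div_sub_le hn hx hT (by omega) hpar hA hε
    rw [Nat.sub_add_cancel hTt] at hmain
    rw [hy, Int.cast_natCast, Int.cast_natCast]
    calc _ = (1 / 2 : ℝ) ^ T * |survivalSum n (t - T) y / survivalSum n t x - y / x| := by
          rw [abs_sub_comm, ← abs_of_pos (a := (1 / 2 : ℝ) ^ T) (by positivity), ← abs_mul,
            abs_of_pos (a := (1 / 2 : ℝ) ^ T) (by positivity)]
          congr 1
          ring
      _ ≤ (1 / 2 : ℝ) ^ T * _ := mul_le_mul_of_nonneg_left hmain (by positivity)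
      _ = _ := by ring
  · push Not at hpos
    obtain ⟨s, hs, h1, h2⟩ := exists_step_one_zero (by omega) hstep hpos
    rw [survive_inter_follow_eq_empty (s := s + 1) (by omega) hs (by simp [h2]),
      prod_eq_zero (mem_range.2 hs) (by rw [h1, h2, condStep_one_zero])]
    simp

/-- fix `x ≥ 1`, `0 < μ < 1`, `T = ⌊n^μ⌋`, and let `t = t(n)` be
of order `n³` (i.e. `t/n³ → c > 0`).  The total variation distance between the
law of the first `T` steps of the conditioned walk on the positive integers
started at `x` and the law of the first `T` steps of the simple random walk
started at `x` conditioned on `τ_{{0,2n}} > t`, namely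
`(1/2) Σ_{γ ∈ Γ} |P̂_x[γ] − P_x[γ ∣ τ_{{0,2n}} > t]|` where `Γ` is the set of
nearest-neighbour paths of length `T` started at `x`, is `O(n⁻²T²)`;
in particular it is `O(n^{2μ-2})` and tends to `0`. -/
theorem coupling_total_variation_bound
    {Ω Ω' : Type*} [MeasurableSpace Ω] [MeasurableSpace Ω']
    (P : ℤ → Measure Ω) (S : ℕ → Ω → ℤ) (hS : IsSRW P S)
    (Pr : Measure Ω') (X : ℕ → Ω' → ℤ)
    (x : ℤ) (hx : 1 ≤ x) (hX : IsCondWalk Pr X x)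
    (μ : ℝ) (hμ0 : 0 < μ) (hμ1 : μ < 1)
    (t : ℕ → ℕ) (c : ℝ) (hc : 0 < c)
    (ht : Tendsto (fun n : ℕ => (t n : ℝ) / (n : ℝ) ^ 3) atTop (𝓝 c)) :
    ∃ C > (0 : ℝ), ∃ n₀ : ℕ, ∀ n ≥ n₀,
      (1 / 2 : ℝ) * ∑ ε : Fin ⌊(n : ℝ) ^ μ⌋₊ → Bool,
          |(Pr {ω | ∀ s ≤ ⌊(n : ℝ) ^ μ⌋₊, X s ω = pathOf x ε s}).toReal
            - (ProbabilityTheory.cond (P x)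
                {ω | ∀ s ≤ t n, S s ω ∉ ({0, (2 * n : ℤ)} : Set ℤ)}
                {ω | ∀ s ≤ ⌊(n : ℝ) ^ μ⌋₊, S s ω = pathOf x ε s}).toReal|
        ≤ C * (⌊(n : ℝ) ^ μ⌋₊ : ℝ) ^ 2 / (n : ℝ) ^ 2 := by

  lift x to ℕ using by omega
  have hx' : 1 ≤ x := by exact_mod_cast hx
  have := hX.1
  set A : ℝ := 3 / (8 * (c / 4) ^ 3) with hA
  have hA0 : 0 < A := by positivity
  set K : ℝ := ((x : ℝ) + 1) ^ 2 + A + 2 with hK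
  have hK0 : 0 < K := by positivity
  have hlim := tendsto_floor_rpow_div_atTop hμ1
  have hlim2 : Tendsto (fun n : ℕ => K * ((⌊(n : ℝ) ^ μ⌋₊ : ℝ) / n) ^ 2) atTop (𝓝 0) := by
    simpa using (hlim.pow 2).const_mul K
  obtain ⟨N, hN⟩ := eventually_atTop.1 <|
    (hlim.eventually_le_const (show (0 : ℝ) < 1 / 2 by norm_num)).and <|
    (hlim2.eventually_le_const (show (0 : ℝ) < 1 / 2 by norm_num)).and <|
    (ht.eventually_const_le (half_lt_self hc)).and <|
    (eventually_ge_atTop 3).and <| (eventually_ge_atTop (x + 1)).and <|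
    tendsto_natCast_atTop_atTop.eventually_ge_atTop (4 / c)
  refine ⟨2 * K, by positivity, N, fun n hn => ?_⟩
  obtain ⟨h1, h2, h3, hn3, hnx, hnc⟩ := hN n hn
  have hn3' : (3 : ℝ) ≤ n := by exact_mod_cast hn3
  have hT : 1 ≤ ⌊(n : ℝ) ^ μ⌋₊ :=
    Nat.one_le_floor_iff _ |>.2 (Real.one_le_rpow (by linarith) hμ0.le)
  set T := ⌊(n : ℝ) ^ μ⌋₊
  have hn0 : (0 : ℝ) < n := by linarith
  rw [div_le_iff₀ hn0] at h1
  rw [le_div_iff₀ (by positivity)] at h3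
  rw [div_le_iff₀ hc] at hnc
  have h4 : (T : ℝ) + c / 4 * n ^ 3 ≤ t n := by
    have : (n : ℝ) ≤ c / 4 * n ^ 3 := by
      have : 1 ≤ c / 4 * n ^ 2 := by nlinarith
      nlinarith
    linarith
  have hTt : T ≤ t n := by
    have : (T : ℝ) ≤ t n := by nlinarith [show 0 < c / 4 * (n : ℝ) ^ 3 by positivity]
    exact_mod_cast this
  have hxT : x + T < 2 * n := by
    have hnx' : (x : ℝ) + 1 ≤ n := by exact_mod_cast hnx
    have : (x : ℝ) + T < 2 * n := by linarith
    exact_mod_cast this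
  have hexp := exp_pow_le_of_cube_le (n := n) (r := t n - T) (d := c / 4) (by omega)
    (by positivity) (by rw [Nat.cast_sub hTt]; linarith)
  have hε : K * T ^ 2 / n ^ 2 ≤ 1 / 2 := by
    rw [div_pow] at h2; rwa [mul_div_assoc]
  have hsum : ∑ ε : Fin T → Bool, _ ≤ ∑ ε : Fin T → Bool, _ := sum_le_sum fun ε _ =>
    abs_condWalk_sub_cond_srw_le hS hX hx' hn3 hT hTt hxT hexp hε ε
  rw [← mul_sum] at hsum
  have hle := sum_measureReal_pathOf_le_one Pr hX.2.1 x T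
  calc _ ≤ (1 / 2 : ℝ) * (4 * (K * T ^ 2 / n ^ 2) * 1) := by
        refine mul_le_mul_of_nonneg_left (hsum.trans ?_) (by norm_num)
        exact mul_le_mul_of_nonneg_left hle (by positivity)
    _ = _ := by ring
end

section
/- Fix α > 0 and an integer x ≥ 1. For each n set t* = t*(n) = ⌊ 4αn³/π² ⌋ and let L_n(x) = #{ 0 ≤ s ≤ t* : S_s = x } denote the local time at x of the simple random walk on ℤ started at n under the conditional law P_n[ · | τ_{{0,2n}} > t* ] (the conditioned walk on the ring graph with 2n sites, run up to time t* and conditioned not to hit the origin). Then, as n → ∞, L_n(x) converges in distribution to ℓ(x) = Σ_{k=1}^{N} V_k, where N ~ Poisson(αx/2) and V_1, V_2, … are i.i.d. with P[V_k = j] = (1/(2x)) (1 − 1/(2x))^{j−1} for j ≥ 1, independent of N. Equivalently, for every t ∈ ℝ, E[ e^{i t L_n(x)} ] → exp( αx² (e^{it} − 1) / (2x − (2x−1)e^{it}) ). -/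
open MeasureTheory ProbabilityTheory Finset Filter
open scoped ENNReal Topology

theorem IsSRW.markov_step {Ω : Type*} [MeasurableSpace Ω] {P : ℤ → Measure Ω} {S : ℕ → Ω → ℤ}
    (hS : IsSRW P S) (a : ℤ) (t : ℕ) (v : ℤ) (φ : (Fin (t + 1) → ℤ) → ℂ)
    {C : ℝ} (hφ : ∀ γ, ‖φ γ‖ ≤ C) :
    ∫ ω in {ω | S (t + 1) ω = v}, φ (fun i => S i ω) ∂(P a) =
      ((∫ ω in {ω | S t ω = v - 1}, φ (fun i => S i ω) ∂(P a)) +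
        ∫ ω in {ω | S t ω = v + 1}, φ (fun i => S i ω) ∂(P a)) / 2 := by
  obtain ⟨hP, hm, hpath⟩ := hS
  have := hP a
  set X : Ω → (Fin (t + 1) → ℤ) := fun ω i => S i ω with hX
  have hXm : Measurable X := measurable_pi_lambda _ fun i => hm i
  have hset : ∀ s u, MeasurableSet {ω | S s ω = u} := fun s u => hm s (measurableSet_singleton u)
  have key : ((P a).restrict {ω | S (t + 1) ω = v}).map X =
      (2⁻¹ : ℝ≥0∞) • ((P a).restrict {ω | S t ω = v - 1}).map X +
        (2⁻¹ : ℝ≥0∞) • ((P a).restrict {ω | S t ω = v + 1}).map X := by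
    refine Measure.ext_of_singleton fun γ => ?_
    have hγ : MeasurableSet ({γ} : Set (Fin (t + 1) → ℤ)) := measurableSet_singleton γ
    simp only [Measure.add_apply, Measure.smul_apply, Measure.map_apply hXm hγ,
      Measure.restrict_apply (hXm hγ), smul_eq_mul]
    have hext : ∀ u : ℤ, X ⁻¹' {γ} ∩ {ω | S t ω = u} =
        if γ (Fin.last t) = u then X ⁻¹' {γ} else ∅ := by
      intro u
      split_ifs with h
      · ext ω
        simp only [Set.mem_inter_iff, Set.mem_preimage, Set.mem_singleton_iff, Set.mem_ofPred_eq,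
          and_iff_left_iff_imp]
        intro hω
        rw [← h, ← hω]
        simp [hX]
      · ext ω
        simp only [Set.mem_inter_iff, Set.mem_preimage, Set.mem_singleton_iff, Set.mem_ofPred_eq,
          Set.mem_empty_iff_false, iff_false, not_and]
        intro hω hu
        apply h
        rw [← hu, ← hω]
        simp [hX]
    by_cases h0 : γ 0 = a
    · let γ' : ℕ → ℤ := fun s => if h : s < t + 1 then γ ⟨s, h⟩ else v
      have h1 : X ⁻¹' {γ} = {ω | ∀ s ≤ t, S s ω = γ' s} := by
        ext ω
        simp only [Set.mem_preimage, Set.mem_singleton_iff, Set.mem_ofPred_eq, funext_iff, hX,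
          Fin.forall_iff, γ']
        refine forall_congr' fun s => ⟨fun h hs => ?_, fun h hs => ?_⟩
        · rw [dif_pos (by omega)]; exact h (by omega)
        · have := h (by omega); rwa [dif_pos hs] at this
      have h2 : X ⁻¹' {γ} ∩ {ω | S (t + 1) ω = v} = {ω | ∀ s ≤ t + 1, S s ω = γ' s} := by
        rw [h1]
        ext ω
        simp only [Set.mem_inter_iff, Set.mem_ofPred_eq]
        constructor
        · rintro ⟨h, h'⟩ s hs
          rcases Nat.lt_or_ge t s with h3 | h3
          · obtain rfl : s = t + 1 := by omega
            simp [γ', h']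
          · exact h s h3
        · intro h
          refine ⟨fun s hs => h s (by omega), ?_⟩
          rw [h (t + 1) le_rfl]; simp [γ']
      have h0' : γ' 0 = a := by simpa [γ'] using h0
      have hlast : γ' t = γ (Fin.last t) := by simp [γ', Fin.last]
      have hlast' : γ' (t + 1) = v := by simp [γ']
      rw [h2, hpath a (t + 1) γ' h0', Finset.prod_range_succ, ← hpath a t γ' h0', ← h1, hext, hext,
        hlast, hlast', srwStep]
      by_cases c1 : γ (Fin.last t) = v - 1
      · have c2 : ¬ (γ (Fin.last t) = v + 1) := by omega
        rw [if_pos c1, if_neg c2, if_pos (by omega)]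
        simp [mul_comm]
      · by_cases c2 : γ (Fin.last t) = v + 1
        · rw [if_neg c1, if_pos c2, if_pos (by omega)]
          simp [mul_comm]
        · rw [if_neg c1, if_neg c2, if_neg (by omega)]
          simp
    · have hz : P a (X ⁻¹' {γ}) = 0 := by
        have h1 : P a {ω | S 0 ω = a} = 1 := by
          have := hpath a 0 (fun _ => a) rfl
          simpa using this
        have h2 : P a {ω | S 0 ω = a}ᶜ = 0 := by
          rw [prob_compl_eq_zero_iff (hset 0 a)]; exact h1
        refine measure_mono_null (fun ω hω => ?_) h2
        simp only [Set.mem_compl_iff, Set.mem_ofPred_eq]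
        intro h
        apply h0
        rw [← h, ← (show X ω = γ from hω)]
        simp [hX]
      have hz' : ∀ B : Set Ω, P a (X ⁻¹' {γ} ∩ B) = 0 :=
        fun B => measure_mono_null Set.inter_subset_left hz
      simp [hz']
  have hint : ∀ μ : Measure Ω, IsFiniteMeasure μ → Integrable φ (μ.map X) := fun μ hμ =>
    Integrable.of_bound (measurable_of_countable φ).aestronglyMeasurable C
      (Filter.Eventually.of_forall hφ)
  have hmap : ∀ μ : Measure Ω, ∫ ω, φ (X ω) ∂μ = ∫ γ, φ γ ∂(μ.map X) := fun μ =>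
    (integral_map hXm.aemeasurable (measurable_of_countable φ).aestronglyMeasurable).symm
  have hfin : (2⁻¹ : ℝ≥0∞) ≠ ∞ := by simp
  change ∫ ω in _, φ (X ω) ∂(P a) = ((∫ ω in _, φ (X ω) ∂(P a)) + ∫ ω in _, φ (X ω) ∂(P a)) / 2
  rw [hmap, hmap, hmap, key, integral_add_measure ((hint _ inferInstance).smul_measure hfin)
    ((hint _ inferInstance).smul_measure hfin), integral_smul_measure, integral_smul_measure]
  simp
  ring

/-- The one-step kernel of the walk with multiplicative site weights `W`. -/
noncomputable def weightedStep (W : ℤ → ℂ) (f : ℤ → ℂ) (v : ℤ) : ℂ :=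
  W v * ((f (v - 1) + f (v + 1)) / 2)

theorem IsSRW.setIntegral_prod {Ω : Type*} [MeasurableSpace Ω] {P : ℤ → Measure Ω}
    {S : ℕ → Ω → ℤ} (hS : IsSRW P S) (a : ℤ) (W : ℤ → ℂ) (hW : ∀ v, ‖W v‖ ≤ 1) (t : ℕ) (v : ℤ) :
    ∫ ω in {ω | S t ω = v}, ∏ s ∈ range (t + 1), W (S s ω) ∂(P a) =
      (weightedStep W)^[t] (Pi.single a (W a)) v := by
  have hset : ∀ s u, MeasurableSet {ω | S s ω = u} :=
    fun s u => hS.2.1 s (measurableSet_singleton u)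
  induction t generalizing v with
  | zero =>
    have := hS.1 a
    have h1 : P a {ω | S 0 ω = a} = 1 := by
      have := hS.2.2 a 0 (fun _ => a) rfl
      simpa using this
    have h2 : ∫ ω in {ω | S 0 ω = v}, ∏ s ∈ range (0 + 1), W (S s ω) ∂(P a) =
        ∫ ω in {ω | S 0 ω = v}, W v ∂(P a) :=
      setIntegral_congr_fun (hset 0 v) fun ω hω => by
        have hω' : S 0 ω = v := hω
        simp [hω']
    rw [h2]
    by_cases h : v = a
    · subst h
      simp [Measure.real, h1]
    · have h3 : P a {ω | S 0 ω = v} = 0 := by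
        have h2 : P a {ω | S 0 ω = a}ᶜ = 0 := by
          rw [prob_compl_eq_zero_iff (hset 0 a)]; exact h1
        refine measure_mono_null (fun ω hω => ?_) h2
        have hω' : S 0 ω = v := hω
        simp [hω', h]
      simp [Measure.real, h3, h]
  | succ t ih =>
    have h2 : ∫ ω in {ω | S (t + 1) ω = v}, ∏ s ∈ range (t + 1 + 1), W (S s ω) ∂(P a) =
        ∫ ω in {ω | S (t + 1) ω = v}, W v * ∏ s ∈ range (t + 1), W (S s ω) ∂(P a) :=
      setIntegral_congr_fun (hset _ v) fun ω hω => by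
        have hω' : S (t + 1) ω = v := hω
        rw [prod_range_succ, hω', mul_comm]
    have h3 := hS.markov_step a t v (fun γ => ∏ i, W (γ i)) (C := 1) (fun γ => by
      rw [norm_prod]
      exact prod_le_one (fun _ _ => norm_nonneg _) fun i _ => hW _)
    have h4 : ∀ ω, ∏ i : Fin (t + 1), W (S i ω) = ∏ s ∈ range (t + 1), W (S s ω) := fun ω =>
      Fin.prod_univ_eq_prod_range (fun s => W (S s ω)) (t + 1)
    simp only [h4] at h3
    rw [h2, integral_const_mul, h3, ih, ih, Function.iterate_succ_apply', weightedStep]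

theorem IsSRW.hasSum_integral_prod {Ω : Type*} [MeasurableSpace Ω] {P : ℤ → Measure Ω}
    {S : ℕ → Ω → ℤ} (hS : IsSRW P S) (a : ℤ) (W : ℤ → ℂ) (hW : ∀ v, ‖W v‖ ≤ 1) (t : ℕ) :
    HasSum (fun v => (weightedStep W)^[t] (Pi.single a (W a)) v)
      (∫ ω, ∏ s ∈ range (t + 1), W (S s ω) ∂(P a)) := by
  have := hS.1 a
  have hmeas : Measurable fun ω => ∏ s ∈ range (t + 1), W (S s ω) :=
    Finset.measurable_fun_prod _ fun s _ => (measurable_of_countable W).comp (hS.2.1 s)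
  have h := hasSum_integral_iUnion (μ := P a) (s := fun v : ℤ => {ω | S t ω = v})
    (f := fun ω => ∏ s ∈ range (t + 1), W (S s ω))
    (fun v => hS.2.1 t (measurableSet_singleton v))
    (fun u v huv => Set.disjoint_left.2 fun ω hu hv => huv (hu.symm.trans hv))
    (Integrable.integrableOn (Integrable.of_bound hmeas.aestronglyMeasurable 1
      (Filter.Eventually.of_forall fun ω => by
        rw [norm_prod]
        exact prod_le_one (fun _ _ => norm_nonneg _) fun i _ => hW _)))
  have hU : (⋃ v : ℤ, {ω | S t ω = v}) = Set.univ := by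
    ext ω; simp
  rw [hU, setIntegral_univ] at h
  simpa only [hS.setIntegral_prod a W hW t] using h

/-- The one-step kernel of the walk killed outside of `(0, 2n)`. -/
noncomputable def killedStep {𝕜 : Type*} [Field 𝕜] (n : ℕ) (f : ℤ → 𝕜) (v : ℤ) : 𝕜 :=
  if v ∈ Ioo (0 : ℤ) (2 * n) then (f (v - 1) + f (v + 1)) / 2 else 0

/-- The killed kernel with an additional weight `z` for each visit to `x`. -/
noncomputable def tiltedStep (n : ℕ) (x : ℤ) (z : ℂ) (f : ℤ → ℂ) (v : ℤ) : ℂ :=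
  if v = x then z * killedStep n f v else killedStep n f v

/-- `f` vanishes outside of `(0, 2n)`. -/
def SupportedIn {𝕜 : Type*} [Zero 𝕜] (n : ℕ) (f : ℤ → 𝕜) : Prop :=
  ∀ v ∉ Ioo (0 : ℤ) (2 * n), f v = 0

theorem supportedIn_killedStep {𝕜 : Type*} [Field 𝕜] (n : ℕ) (f : ℤ → 𝕜) :
    SupportedIn n (killedStep n f) := fun v hv => by rw [killedStep, if_neg hv]

theorem SupportedIn.killedStep_iterate {𝕜 : Type*} [Field 𝕜] {n : ℕ} {f : ℤ → 𝕜}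
    (hf : SupportedIn n f) (t : ℕ) : SupportedIn n ((killedStep n)^[t] f) := by
  cases t with
  | zero => exact hf
  | succ t => rw [Function.iterate_succ_apply']; exact supportedIn_killedStep n _

theorem SupportedIn.tiltedStep_iterate {n : ℕ} {f : ℤ → ℂ}
    (hf : SupportedIn n f) (x : ℤ) (z : ℂ) (t : ℕ) :
    SupportedIn n ((tiltedStep n x z)^[t] f) := by
  cases t with
  | zero => exact hf
  | succ t =>
    rw [Function.iterate_succ_apply']
    intro v hv
    simp [tiltedStep, supportedIn_killedStep n _ v hv]

theorem supportedIn_single {𝕜 : Type*} [Field 𝕜] {n : ℕ} {u : ℤ}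
    (hu : u ∈ Ioo (0 : ℤ) (2 * n)) : SupportedIn n (Pi.single u (1 : 𝕜)) := fun v hv => by
  rw [Pi.single_apply, if_neg]
  rintro rfl
  exact hv hu

theorem ofReal_killedStep_iterate (n : ℕ) (f : ℤ → ℝ) (t : ℕ) (v : ℤ) :
    (((killedStep n)^[t] f v : ℝ) : ℂ) = (killedStep n)^[t] (fun u => (f u : ℂ)) v := by
  induction t generalizing v with
  | zero => rfl
  | succ t ih =>
    simp only [Function.iterate_succ_apply', killedStep]
    split_ifs
    · push_cast
      rw [ih, ih]
    · simp

theorem tiltedStep_one (n : ℕ) (x : ℤ) : tiltedStep n x 1 = killedStep n := by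
  funext f v
  simp [tiltedStep]

theorem weightedStep_iterate {n : ℕ} (hn : 0 < n) (x : ℤ) (z : ℂ) (hx : x ≠ n) (t : ℕ) :
    (weightedStep fun v => if v = 0 ∨ v = 2 * (n : ℤ) then 0 else if v = x then z else 1)^[t]
      (Pi.single (n : ℤ) (if (n : ℤ) = 0 ∨ (n : ℤ) = 2 * (n : ℤ) then 0
        else if (n : ℤ) = x then z else 1)) =
      (tiltedStep n x z)^[t] (Pi.single (n : ℤ) 1) := by
  have hsupp : SupportedIn n (Pi.single (n : ℤ) (1 : ℂ)) :=
    supportedIn_single (by rw [Finset.mem_Ioo]; omega)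
  induction t with
  | zero =>
    rw [if_neg (by omega), if_neg (Ne.symm hx)]
    rfl
  | succ t ih =>
    rw [Function.iterate_succ_apply', Function.iterate_succ_apply', ih]
    funext v
    have hs := hsupp.tiltedStep_iterate x z t
    set f := (tiltedStep n x z)^[t] (Pi.single (n : ℤ) 1)
    rw [weightedStep, tiltedStep, killedStep]
    by_cases hv : v ∈ Ioo (0 : ℤ) (2 * n)
    · rw [if_pos hv]
      rw [Finset.mem_Ioo] at hv
      rw [if_neg (by omega)]
      split_ifs <;> simp
    · rw [if_neg hv]
      by_cases hb : v = 0 ∨ v = 2 * (n : ℤ)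
      · rw [if_pos hb]; simp
      · rw [Finset.mem_Ioo] at hv
        rw [hs (v - 1) (by rw [Finset.mem_Ioo]; omega), hs (v + 1) (by rw [Finset.mem_Ioo]; omega)]
        simp

theorem IsSRW.integral_cond {Ω : Type*} [MeasurableSpace Ω] {P : ℤ → Measure Ω}
    {S : ℕ → Ω → ℤ} (hS : IsSRW P S) {n : ℕ} (hn : 0 < n) (x : ℤ) (hx : x ≠ n) (z : ℂ)
    (hz : ‖z‖ = 1) (t : ℕ) :
    ∫ ω, z ^ #{s ∈ range (t + 1) | S s ω = x}
        ∂(ProbabilityTheory.cond (P (n : ℤ))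
          {ω | ∀ s ≤ t, S s ω ∉ ({0, (2 * n : ℤ)} : Set ℤ)}) =
      (∑ v ∈ Ioo (0 : ℤ) (2 * n), (tiltedStep n x z)^[t] (Pi.single (n : ℤ) 1) v) /
        ((∑ v ∈ Ioo (0 : ℤ) (2 * n), (killedStep n)^[t] (Pi.single (n : ℤ) 1) v : ℝ) : ℂ) := by
  have := hS.1 n
  set A : Set Ω := {ω | ∀ s ≤ t, S s ω ∉ ({0, (2 * n : ℤ)} : Set ℤ)} with hA
  have hAm : MeasurableSet A := by
    have : A = ⋂ s, ⋂ (_ : s ≤ t), (S s ⁻¹' ({0, (2 * n : ℤ)} : Set ℤ))ᶜ := by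
      ext ω; simp [hA]
    rw [this]
    exact MeasurableSet.iInter fun s => MeasurableSet.iInter fun _ =>
      (hS.2.1 s (MeasurableSet.of_discrete)).compl
  have main : ∀ y : ℂ, ‖y‖ = 1 → ∫ ω in A, y ^ #{s ∈ range (t + 1) | S s ω = x} ∂(P n) =
      ∑ v ∈ Ioo (0 : ℤ) (2 * n), (tiltedStep n x y)^[t] (Pi.single (n : ℤ) 1) v := by
    intro y hy
    set W : ℤ → ℂ := fun v => if v = 0 ∨ v = 2 * (n : ℤ) then 0 else if v = x then y else 1
      with hWdef
    have hW : ∀ v, ‖W v‖ ≤ 1 := fun v => by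
      simp only [hWdef]
      split_ifs <;> simp [hy]
    have hsum := hS.hasSum_integral_prod n W hW t
    rw [weightedStep_iterate hn x y hx t] at hsum
    have hsupp : SupportedIn n ((tiltedStep n x y)^[t] (Pi.single (n : ℤ) 1)) :=
      (supportedIn_single (by rw [Finset.mem_Ioo]; omega)).tiltedStep_iterate x y t
    have h2 : HasSum ((tiltedStep n x y)^[t] (Pi.single (n : ℤ) 1))
        (∑ v ∈ Ioo (0 : ℤ) (2 * n), (tiltedStep n x y)^[t] (Pi.single (n : ℤ) 1) v) :=
      hasSum_sum_of_ne_finset_zero fun v hv => hsupp v hv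
    rw [← hsum.unique h2, ← integral_indicator hAm]
    congr 1
    funext ω
    by_cases hω : ω ∈ A
    · rw [Set.indicator_of_mem hω, ← prod_const, prod_filter]
      refine prod_congr rfl fun s hs => ?_
      have h3 := hω s (by rw [Finset.mem_range] at hs; omega)
      simp only [Set.mem_insert_iff, Set.mem_singleton_iff] at h3
      simp only [hWdef]
      rw [if_neg h3]
    · rw [Set.indicator_of_notMem hω]
      simp only [hA, Set.mem_ofPred_eq, not_forall, not_not] at hω
      obtain ⟨s, hs, hs'⟩ := hω
      simp only [Set.mem_insert_iff, Set.mem_singleton_iff] at hs'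
      refine (prod_eq_zero (i := s) (by rw [Finset.mem_range]; omega) ?_).symm
      simp only [hWdef]
      rw [if_pos hs']
  have h1 := main 1 (by simp)
  rw [tiltedStep_one] at h1
  simp only [one_pow, integral_const] at h1
  rw [ProbabilityTheory.cond, integral_smul_measure, main z hz]
  have h2 : ((∑ v ∈ Ioo (0 : ℤ) (2 * n), (killedStep n)^[t] (Pi.single (n : ℤ) 1) v : ℝ) : ℂ) =
      ((P n).real A : ℂ) := by
    push_cast
    rw [show ((P n).real A : ℂ) = ∑ v ∈ Ioo (0 : ℤ) (2 * n),
      (killedStep n)^[t] (Pi.single (n : ℤ) (1 : ℂ)) v by rw [← h1]; simp [Measure.real]]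
    refine sum_congr rfl fun v _ => ?_
    have hsingle : (fun u => ((Pi.single (n : ℤ) (1 : ℝ) : ℤ → ℝ) u : ℂ)) =
        Pi.single (n : ℤ) (1 : ℂ) := by
      funext u
      rw [Pi.single_apply, Pi.single_apply]
      split_ifs <;> simp
    rw [ofReal_killedStep_iterate, hsingle]
  rw [h2, ENNReal.toReal_inv, Measure.real]
  rw [Complex.real_smul, div_eq_inv_mul]
  push_cast
  rfl

theorem sum_killedStep_mul {𝕜 : Type*} [Field 𝕜] {n : ℕ} {f g : ℤ → 𝕜}
    (hf : SupportedIn n f) (hg : SupportedIn n g) :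
    ∑ v ∈ Ioo (0 : ℤ) (2 * n), killedStep n f v * g v =
      ∑ v ∈ Ioo (0 : ℤ) (2 * n), f v * killedStep n g v := by
  have shift : ∀ {f g : ℤ → 𝕜}, SupportedIn n f → SupportedIn n g →
      ∑ v ∈ Ioo (0 : ℤ) (2 * n), f (v - 1) * g v =
        ∑ v ∈ Ioo (0 : ℤ) (2 * n), f v * g (v + 1) := by
    intro f g hf hg
    have h1 : ∑ v ∈ Ioo (0 : ℤ) (2 * n), f (v - 1) * g v =
        ∑ v ∈ Ioc (0 : ℤ) (2 * n), f (v - 1) * g v := by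
      refine sum_subset Ioo_subset_Ioc_self fun v _ hv => ?_
      rw [hg v hv, mul_zero]
    have h2 : ∑ v ∈ Ioo (0 : ℤ) (2 * n), f v * g (v + 1) =
        ∑ v ∈ Ico (0 : ℤ) (2 * n), f v * g (v + 1) := by
      refine sum_subset Ioo_subset_Ico_self fun v _ hv => ?_
      rw [hf v hv, zero_mul]
    rw [h1, h2]
    refine sum_nbij' (fun v => v - 1) (fun v => v + 1) ?_ ?_ ?_ ?_ ?_ <;> intro v hv <;>
      simp only [Finset.mem_Ioc, Finset.mem_Ico] at hv ⊢ <;> first | omega | skip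
    rw [sub_add_cancel]
  have e1 : ∀ v ∈ Ioo (0 : ℤ) (2 * n), killedStep n f v * g v =
      (f (v - 1) * g v + g v * f (v + 1)) / 2 := fun v hv => by
    rw [killedStep, if_pos hv]; ring
  have e2 : ∀ v ∈ Ioo (0 : ℤ) (2 * n), f v * killedStep n g v =
      (f v * g (v + 1) + g (v - 1) * f v) / 2 := fun v hv => by
    rw [killedStep, if_pos hv]; ring
  rw [sum_congr rfl e1, sum_congr rfl e2, ← sum_div, ← sum_div, sum_add_distrib, sum_add_distrib,
    shift hf hg, shift hg hf]

theorem sum_killedStep_iterate_mul {𝕜 : Type*} [Field 𝕜] {n : ℕ} {f g : ℤ → 𝕜}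
    (hf : SupportedIn n f) (hg : SupportedIn n g) (t : ℕ) :
    ∑ v ∈ Ioo (0 : ℤ) (2 * n), (killedStep n)^[t] f v * g v =
      ∑ v ∈ Ioo (0 : ℤ) (2 * n), f v * (killedStep n)^[t] g v := by
  induction t generalizing g with
  | zero => rfl
  | succ t ih =>
    rw [Function.iterate_succ_apply', Function.iterate_succ_apply,
      sum_killedStep_mul (hf.killedStep_iterate t) hg, ih (supportedIn_killedStep n g)]

theorem killedStep_iterate_single_comm {n : ℕ} {u v : ℤ} (hu : u ∈ Ioo (0 : ℤ) (2 * n))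
    (hv : v ∈ Ioo (0 : ℤ) (2 * n)) (t : ℕ) :
    (killedStep n)^[t] (Pi.single u (1 : ℝ)) v = (killedStep n)^[t] (Pi.single v (1 : ℝ)) u := by
  have h := sum_killedStep_iterate_mul (supportedIn_single (𝕜 := ℝ) hu)
    (supportedIn_single (𝕜 := ℝ) hv) t
  simpa [Pi.single_apply, hu, hv] using h

theorem killedStep_iterate_nonneg {n : ℕ} {f : ℤ → ℝ} (hf : ∀ v, 0 ≤ f v) (t : ℕ) (v : ℤ) :
    0 ≤ (killedStep n)^[t] f v := by
  induction t generalizing v with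
  | zero => exact hf v
  | succ t ih =>
    rw [Function.iterate_succ_apply', killedStep]
    split_ifs
    · linarith [ih (v - 1), ih (v + 1)]
    · exact le_rfl

theorem norm_killedStep_le {n : ℕ} {f : ℤ → ℂ} {g : ℤ → ℝ} (h : ∀ v, ‖f v‖ ≤ g v) (v : ℤ) :
    ‖killedStep n f v‖ ≤ killedStep n g v := by
  rw [killedStep, killedStep]
  split_ifs
  · rw [norm_div, Complex.norm_two]
    have := norm_add_le (f (v - 1)) (f (v + 1))
    linarith [h (v - 1), h (v + 1)]
  · simp

theorem norm_tiltedStep_iterate_le {n : ℕ} {x : ℤ} {z : ℂ} (hz : ‖z‖ = 1) {f : ℤ → ℂ} {g : ℤ → ℝ}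
    (h : ∀ v, ‖f v‖ ≤ g v) (t : ℕ) (v : ℤ) :
    ‖(tiltedStep n x z)^[t] f v‖ ≤ (killedStep n)^[t] g v := by
  induction t generalizing v with
  | zero => exact h v
  | succ t ih =>
    rw [Function.iterate_succ_apply', Function.iterate_succ_apply', tiltedStep]
    split_ifs
    · rw [norm_mul, hz, one_mul]; exact norm_killedStep_le ih v
    · exact norm_killedStep_le ih v

/-- The indicator function of `(0, 2n)`. -/
noncomputable def interiorInd (n : ℕ) (v : ℤ) : ℝ := if v ∈ Ioo (0 : ℤ) (2 * n) then 1 else 0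

theorem supportedIn_interiorInd (n : ℕ) : SupportedIn n (interiorInd n) := fun v hv => by
  rw [interiorInd, if_neg hv]

theorem interiorInd_nonneg (n : ℕ) (v : ℤ) : 0 ≤ interiorInd n v := by
  rw [interiorInd]; split_ifs <;> norm_num

theorem sum_killedStep_iterate_single {n : ℕ} {u : ℤ} (hu : u ∈ Ioo (0 : ℤ) (2 * n)) (t : ℕ) :
    ∑ v ∈ Ioo (0 : ℤ) (2 * n), (killedStep n)^[t] (Pi.single u (1 : ℝ)) v =
      (killedStep n)^[t] (interiorInd n) u := by
  have h := sum_killedStep_iterate_mul (supportedIn_single (𝕜 := ℝ) hu)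
    (supportedIn_interiorInd n) t
  rw [sum_congr rfl (g := fun v => (killedStep n)^[t] (Pi.single u (1 : ℝ)) v) fun v hv => by
    rw [interiorInd, if_pos hv, mul_one]] at h
  rw [h, sum_eq_single u (fun v _ hv => by simp [hv]) (fun h => absurd hu h)]
  simp

/-- A supersolution bounds the discounted Green function. -/
theorem sum_killedStep_iterate_le {n : ℕ} {f φ : ℤ → ℝ} {c ε : ℝ} (hc : 0 < c)
    (hf : ∀ v, 0 ≤ f v) (hφ : SupportedIn n φ)
    (hle : ∀ v ∈ Ioo (0 : ℤ) (2 * n), killedStep n f v ≤ c * f v - ε * φ v)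
    (t : ℕ) (v : ℤ) :
    ε * ∑ j ∈ range t, (killedStep n)^[j] φ v / c ^ (j + 1) ≤ f v := by
  induction t generalizing v with
  | zero => simpa using hf v
  | succ t ih =>
    by_cases hv : v ∈ Ioo (0 : ℤ) (2 * n)
    · have h1 : ∑ j ∈ range (t + 1), (killedStep n)^[j] φ v / c ^ (j + 1) =
          (φ v + (∑ j ∈ range t, (killedStep n)^[j] φ (v - 1) / c ^ (j + 1) +
            ∑ j ∈ range t, (killedStep n)^[j] φ (v + 1) / c ^ (j + 1)) / 2) / c := by
        rw [sum_range_succ', ← sum_add_distrib, sum_div, add_comm, add_div, sum_div]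
        congr 1
        · simp
        · refine sum_congr rfl fun j _ => ?_
          rw [Function.iterate_succ_apply', killedStep, if_pos hv, pow_succ c (j + 1)]
          field_simp
      rw [h1, mul_div_assoc', div_le_iff₀ hc]
      have h2 := hle v hv
      rw [killedStep, if_pos hv] at h2
      nlinarith [ih (v - 1), ih (v + 1)]
    · rw [sum_eq_zero, mul_zero]
      · exact hf v
      · intro j _
        rw [hφ.killedStep_iterate j v hv, zero_div]

theorem tiltedStep_eq {n : ℕ} {x : ℤ} (z : ℂ) (f : ℤ → ℂ) (v : ℤ) :
    tiltedStep n x z f v =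
      killedStep n f v + if v = x then (z - 1) * killedStep n f x else 0 := by
  rw [tiltedStep]
  split_ifs with h
  · subst h; ring
  · ring

/-- Replacing the last `m` tilted steps by free ones costs at most the expected number of visits to
`x` during these steps. -/
theorem norm_sum_tiltedStep_sub_le {n : ℕ} {x u : ℤ} {z : ℂ} (hz : ‖z‖ = 1)
    (hu : u ∈ Ioo (0 : ℤ) (2 * n)) (hx : x ∈ Ioo (0 : ℤ) (2 * n)) (s m : ℕ) :
    ‖∑ v ∈ Ioo (0 : ℤ) (2 * n), (tiltedStep n x z)^[s + m] (Pi.single u 1) v -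
      ∑ v ∈ Ioo (0 : ℤ) (2 * n), (tiltedStep n x z)^[s] (Pi.single u 1) v *
        ((killedStep n)^[m] (interiorInd n) v : ℝ)‖ ≤
      ∑ r ∈ range m, 2 * (killedStep n)^[s + m - r] (Pi.single u (1 : ℝ)) x *
        (killedStep n)^[r] (interiorInd n) x := by
  have hdom : ∀ s v, ‖(tiltedStep n x z)^[s] (Pi.single u 1) v‖ ≤
      (killedStep n)^[s] (Pi.single u (1 : ℝ)) v := fun s v =>
    norm_tiltedStep_iterate_le hz (fun w => by
      rw [Pi.single_apply, Pi.single_apply]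
      split_ifs <;> simp) s v
  induction m generalizing s with
  | zero =>
    simp only [add_zero, Function.iterate_zero, id, range_zero, sum_empty]
    rw [sub_eq_zero.2, norm_zero]
    refine sum_congr rfl fun v hv => ?_
    rw [interiorInd, if_pos hv]
    simp
  | succ m ih =>
    set μ := fun s => (tiltedStep n x z)^[s] (Pi.single u 1) with hμ
    set q : ℕ → ℤ → ℂ := fun r v => ((killedStep n)^[r] (interiorInd n) v : ℝ) with hq
    have hμs : SupportedIn n (μ s) := (supportedIn_single hu).tiltedStep_iterate x z s
    have hqs : SupportedIn n (q m) := fun v hv => by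
      simp only [hq]
      rw [(supportedIn_interiorInd n).killedStep_iterate m v hv, Complex.ofReal_zero]
    have hqsucc : q (m + 1) = killedStep n (q m) := by
      funext v
      simp only [hq]
      rw [ofReal_killedStep_iterate, Function.iterate_succ_apply']
      congr 1
      funext w
      rw [ofReal_killedStep_iterate]
    have hstep : ∑ v ∈ Ioo (0 : ℤ) (2 * n), μ (s + 1) v * q m v -
        ∑ v ∈ Ioo (0 : ℤ) (2 * n), μ s v * q (m + 1) v =
          (z - 1) * killedStep n (μ s) x * q m x := by
      rw [hqsucc, ← sum_killedStep_mul hμs hqs, ← sum_sub_distrib, sum_eq_single x]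
      · simp only [hμ]
        rw [Function.iterate_succ_apply', tiltedStep_eq, if_pos rfl]
        ring
      · intro v _ hv
        simp only [hμ]
        rw [Function.iterate_succ_apply', tiltedStep_eq, if_neg hv]
        ring
      · exact fun h => absurd hx h
    have hbound : ‖(z - 1) * killedStep n (μ s) x * q m x‖ ≤
        2 * (killedStep n)^[s + 1] (Pi.single u (1 : ℝ)) x *
          (killedStep n)^[m] (interiorInd n) x := by
      rw [norm_mul, norm_mul]
      have h1 : ‖z - 1‖ ≤ 2 := (norm_sub_le _ _).trans (by rw [hz, norm_one]; norm_num)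
      have h2 : ‖killedStep n (μ s) x‖ ≤ (killedStep n)^[s + 1] (Pi.single u (1 : ℝ)) x := by
        rw [Function.iterate_succ_apply']
        exact norm_killedStep_le (hdom s) x
      have h3 : ‖q m x‖ = (killedStep n)^[m] (interiorInd n) x := by
        simp only [hq]
        rw [Complex.norm_real, Real.norm_eq_abs,
          abs_of_nonneg (killedStep_iterate_nonneg (interiorInd_nonneg n) m x)]
      rw [h3]
      have := killedStep_iterate_nonneg (n := n) (interiorInd_nonneg n) m x
      gcongr
    rw [sum_range_succ, show s + (m + 1) - m = s + 1 by omega,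
      show s + (m + 1) = s + 1 + m by omega]
    calc _ = ‖(∑ v ∈ Ioo (0 : ℤ) (2 * n), μ (s + 1 + m) v -
            ∑ v ∈ Ioo (0 : ℤ) (2 * n), μ (s + 1) v * q m v) +
          (∑ v ∈ Ioo (0 : ℤ) (2 * n), μ (s + 1) v * q m v -
            ∑ v ∈ Ioo (0 : ℤ) (2 * n), μ s v * q (m + 1) v)‖ := by
          congr 1; ring
      _ ≤ _ := (norm_add_le _ _).trans (add_le_add (ih (s + 1)) (by rw [hstep]; exact hbound))

/-- Evolution of the pairing with an approximate eigenfunction whose defect sits at `x`. -/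
theorem norm_sum_tiltedStep_mul_sub_le {n : ℕ} {x u : ℤ} {z : ℂ} (hz : ‖z‖ = 1)
    (hu : u ∈ Ioo (0 : ℤ) (2 * n)) (hx : x ∈ Ioo (0 : ℤ) (2 * n)) (hxu : x ≠ u) {g : ℤ → ℂ}
    {c d : ℂ} (hg0 : SupportedIn n g)
    (hg : ∀ v ∈ Ioo (0 : ℤ) (2 * n), killedStep n g v =
      c * (if v = x then g v / z else g v) + if v = x then d else 0) (s : ℕ) :
    ‖∑ v ∈ Ioo (0 : ℤ) (2 * n), (tiltedStep n x z)^[s] (Pi.single u 1) v *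
        (if v = x then g v / z else g v) - c ^ s * g u‖ ≤
      ‖d‖ * ∑ j ∈ range s, ‖c‖ ^ (s - 1 - j) * (killedStep n)^[j] (Pi.single u (1 : ℝ)) x := by
  have hz0 : z ≠ 0 := fun h => by simp [h] at hz
  set μ := fun s => (tiltedStep n x z)^[s] (Pi.single u 1) with hμ
  have hdom : ∀ s v, ‖μ s v‖ ≤ (killedStep n)^[s] (Pi.single u (1 : ℝ)) v := fun s v =>
    norm_tiltedStep_iterate_le hz (fun w => by
      rw [Pi.single_apply, Pi.single_apply]
      split_ifs <;> simp) s v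
  have hrec : ∀ s, ∑ v ∈ Ioo (0 : ℤ) (2 * n), μ (s + 1) v * (if v = x then g v / z else g v) =
      c * (∑ v ∈ Ioo (0 : ℤ) (2 * n), μ s v * (if v = x then g v / z else g v)) + d * μ s x := by
    intro s
    have h1 : ∀ v ∈ Ioo (0 : ℤ) (2 * n), μ (s + 1) v * (if v = x then g v / z else g v) =
        killedStep n (μ s) v * g v := fun v _ => by
      simp only [hμ]
      rw [Function.iterate_succ_apply', tiltedStep]
      split_ifs
      · field_simp
      · rfl
    have h2 : ∀ v ∈ Ioo (0 : ℤ) (2 * n), μ s v * killedStep n g v =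
        c * (μ s v * (if v = x then g v / z else g v)) + if v = x then d * μ s x else 0 :=
      fun v hv => by
        rw [hg v hv]
        split_ifs with h
        · rw [h]; ring
        · ring
    rw [sum_congr rfl h1, sum_killedStep_mul ((supportedIn_single hu).tiltedStep_iterate x z s) hg0,
      sum_congr rfl h2, sum_add_distrib, ← mul_sum, sum_ite_eq' _ x, if_pos hx]
  induction s with
  | zero =>
    simp only [Function.iterate_zero, id, range_zero, sum_empty, pow_zero, mul_zero]
    rw [sum_eq_single u (fun v _ hv => by simp [hv]) (fun h => absurd hu h), if_neg hxu.symm]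
    simp
  | succ s ih =>
    change ‖∑ v ∈ Ioo (0 : ℤ) (2 * n), μ (s + 1) v * (if v = x then g v / z else g v) - _‖ ≤ _
    change ‖∑ v ∈ Ioo (0 : ℤ) (2 * n), μ s v * (if v = x then g v / z else g v) - _‖ ≤ _ at ih
    rw [hrec, sum_range_succ]
    have h1 : ∑ j ∈ range s, ‖c‖ ^ (s + 1 - 1 - j) * (killedStep n)^[j] (Pi.single u (1 : ℝ)) x =
        ‖c‖ * ∑ j ∈ range s, ‖c‖ ^ (s - 1 - j) * (killedStep n)^[j] (Pi.single u (1 : ℝ)) x := by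
      rw [mul_sum]
      refine sum_congr rfl fun j hj => ?_
      rw [Finset.mem_range] at hj
      rw [← mul_assoc, ← pow_succ']
      congr 2
      omega
    rw [h1]
    calc _ = ‖c * (∑ v ∈ Ioo (0 : ℤ) (2 * n), μ s v * (if v = x then g v / z else g v) -
            c ^ s * g u) + d * μ s x‖ := by congr 1; ring
      _ ≤ ‖c‖ * (‖d‖ * ∑ j ∈ range s, ‖c‖ ^ (s - 1 - j) *
            (killedStep n)^[j] (Pi.single u (1 : ℝ)) x) +
          ‖d‖ * (killedStep n)^[s] (Pi.single u (1 : ℝ)) x := by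
        refine (norm_add_le _ _).trans ?_
        rw [norm_mul, norm_mul]
        gcongr
        exact hdom s x
      _ = _ := by simp; ring

/-- Truncation of a function to `(0, 2n)`. -/
noncomputable def truncate {𝕜 : Type*} [Zero 𝕜] (n : ℕ) (F : ℤ → 𝕜) (v : ℤ) : 𝕜 :=
  if v ∈ Ioo (0 : ℤ) (2 * n) then F v else 0

theorem supportedIn_truncate {𝕜 : Type*} [Zero 𝕜] (n : ℕ) (F : ℤ → 𝕜) :
    SupportedIn n (truncate n F) := fun v hv => by rw [truncate, if_neg hv]

theorem truncate_of_mem_Icc {𝕜 : Type*} [Zero 𝕜] {n : ℕ} {F : ℤ → 𝕜} (h0 : F 0 = 0)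
    (h1 : F (2 * n) = 0) {v : ℤ} (hv0 : 0 ≤ v) (hv1 : v ≤ 2 * n) : truncate n F v = F v := by
  rw [truncate]
  split_ifs with h
  · rfl
  · rw [Finset.mem_Ioo] at h
    rcases (show v = 0 ∨ v = 2 * n by omega) with rfl | rfl
    · exact h0.symm
    · exact h1.symm

theorem killedStep_truncate {𝕜 : Type*} [Field 𝕜] {n : ℕ} {F : ℤ → 𝕜} (h0 : F 0 = 0)
    (h1 : F (2 * n) = 0) {v : ℤ} (hv : v ∈ Ioo (0 : ℤ) (2 * n)) :
    killedStep n (truncate n F) v = (F (v - 1) + F (v + 1)) / 2 := by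
  rw [killedStep, if_pos hv]
  rw [Finset.mem_Ioo] at hv
  rw [truncate_of_mem_Icc h0 h1 (by omega) (by omega),
    truncate_of_mem_Icc h0 h1 (by omega) (by omega)]

theorem two_mul_sin_mul_sum_cos (a : ℝ) (M : ℕ) :
    2 * Real.sin (a / 2) * ∑ k ∈ range M, Real.cos (k * a) =
      Real.sin ((M - 1 / 2) * a) + Real.sin (a / 2) := by
  induction M with
  | zero =>
    rw [show ((0 : ℕ) - 1 / 2 : ℝ) * a = -(a / 2) by push_cast; ring, Real.sin_neg]
    simp
  | succ M ih =>
    rw [sum_range_succ, mul_add, ih,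
      show (((M + 1 : ℕ) : ℝ) - 1 / 2) * a = M * a + a / 2 by push_cast; ring,
      show ((M : ℝ) - 1 / 2) * a = M * a - a / 2 by ring, Real.sin_add, Real.sin_sub]
    ring

/-- The frequency `π / (2n)` of the principal eigenfunction. -/
noncomputable def freq (n : ℕ) : ℝ := Real.pi / (2 * n)

theorem freq_pos {n : ℕ} (hn : 0 < n) : 0 < freq n := by
  have := Real.pi_pos
  rw [freq]; positivity

theorem two_mul_freq {n : ℕ} (hn : 0 < n) : 2 * n * freq n = Real.pi := by
  rw [freq]; field_simp

theorem sum_cos_freq {n : ℕ} (hn : 0 < n) {d : ℤ} (hd : d ≠ 0) (hd' : |d| < 4 * n) :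
    ∑ k ∈ range (2 * n), Real.cos (k * (freq n * d)) = (1 - Real.cos (Real.pi * d)) / 2 := by
  have hθ := freq_pos hn
  have hπ := two_mul_freq hn
  have hs : Real.sin (freq n * d / 2) ≠ 0 := by
    have hd1 : |(d : ℝ)| < 4 * n := by exact_mod_cast hd'
    have hd2 : (d : ℝ) ≠ 0 := by exact_mod_cast hd
    rw [abs_lt] at hd1
    intro h
    rw [Real.sin_eq_zero_iff_of_lt_of_lt (by nlinarith) (by nlinarith)] at h
    have : freq n * d = 0 := by linarith
    rcases mul_eq_zero.1 this with h | h
    · exact hθ.ne' h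
    · exact hd2 h
  have h := two_mul_sin_mul_sum_cos (freq n * d) (2 * n)
  rw [show ((2 * n : ℕ) - 1 / 2 : ℝ) * (freq n * d) = d * Real.pi - freq n * d / 2 by
    rw [← hπ]; push_cast; ring, Real.sin_sub, Real.sin_int_mul_pi] at h
  rw [mul_comm Real.pi]
  apply mul_left_cancel₀ (mul_ne_zero two_ne_zero hs)
  rw [h]
  ring

theorem sum_sin_mul_sin {n : ℕ} {u v : ℤ} (hu : u ∈ Ioo (0 : ℤ) (2 * n))
    (hv : v ∈ Ioo (0 : ℤ) (2 * n)) :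
    ∑ k ∈ range (2 * n), Real.sin (k * freq n * u) * Real.sin (k * freq n * v) =
      if u = v then (n : ℝ) else 0 := by
  rw [Finset.mem_Ioo] at hu hv
  have hn : 0 < n := by omega
  have h1 : ∀ k ∈ range (2 * n), Real.sin (k * freq n * u) * Real.sin (k * freq n * v) =
      (Real.cos (k * (freq n * (u - v : ℤ))) - Real.cos (k * (freq n * (u + v : ℤ)))) / 2 := by
    intro k _
    push_cast
    rw [show (k : ℝ) * (freq n * (u - v)) = k * freq n * u - k * freq n * v by ring,
      show (k : ℝ) * (freq n * (u + v)) = k * freq n * u + k * freq n * v by ring,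
      Real.cos_sub, Real.cos_add]
    ring
  rw [sum_congr rfl h1, ← sum_div, sum_sub_distrib,
    sum_cos_freq hn (d := u + v) (by omega) (by rw [abs_lt]; omega)]
  have hcos : Real.cos (Real.pi * (u + v : ℤ)) = Real.cos (Real.pi * (u - v : ℤ)) := by
    rw [← Real.cos_add_int_mul_two_pi (Real.pi * (u - v : ℤ)) v]
    congr 1
    push_cast; ring
  rw [hcos]
  split_ifs with h
  · subst h
    simp
  · rw [sum_cos_freq hn (d := u - v) (by omega) (by rw [abs_lt]; omega)]
    ring

/-- Coefficients of a function on `(0, 2n)` in the sine basis. -/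
noncomputable def sineCoeff (n : ℕ) (f : ℤ → ℝ) (k : ℕ) : ℝ :=
  (∑ v ∈ Ioo (0 : ℤ) (2 * n), f v * Real.sin (k * freq n * v)) / n

theorem sin_freq_two_mul {n : ℕ} (hn : 0 < n) (k : ℕ) :
    Real.sin (k * freq n * ((2 * n : ℤ) : ℝ)) = 0 := by
  rw [show (k : ℝ) * freq n * ((2 * n : ℤ) : ℝ) = k * Real.pi by
    rw [← two_mul_freq hn]; push_cast; ring, Real.sin_nat_mul_pi]

theorem killedStep_iterate_eq_sum {n : ℕ} (hn : 0 < n) {f : ℤ → ℝ} (hf : SupportedIn n f) (m : ℕ)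
    {u : ℤ} (hu0 : 0 ≤ u) (hu1 : u ≤ 2 * n) :
    (killedStep n)^[m] f u =
      ∑ k ∈ range (2 * n), sineCoeff n f k * Real.cos (k * freq n) ^ m *
        Real.sin (k * freq n * u) := by
  have hend : ∀ u : ℤ, 0 ≤ u → u ≤ 2 * n → u ∉ Ioo (0 : ℤ) (2 * n) → ∀ k : ℕ,
      Real.sin (k * freq n * u) = 0 := by
    intro u h0 h1 h k
    rw [Finset.mem_Ioo] at h
    rcases (show u = 0 ∨ u = 2 * n by omega) with rfl | rfl
    · simp
    · exact sin_freq_two_mul hn k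
  induction m generalizing u with
  | zero =>
    simp only [Function.iterate_zero, id, pow_zero, mul_one]
    by_cases hu : u ∈ Ioo (0 : ℤ) (2 * n)
    · have h1 : ∀ k ∈ range (2 * n), sineCoeff n f k * Real.sin (k * freq n * u) =
          (∑ v ∈ Ioo (0 : ℤ) (2 * n),
            f v * (Real.sin (k * freq n * v) * Real.sin (k * freq n * u))) / n := fun k _ => by
        rw [sineCoeff, div_mul_eq_mul_div, sum_mul]
        simp only [mul_assoc]
      rw [sum_congr rfl h1, ← sum_div, sum_comm]
      simp_rw [← mul_sum]
      rw [sum_congr rfl fun v hv => by rw [sum_sin_mul_sin hv hu]]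
      simp only [mul_ite, mul_zero, sum_ite_eq', if_pos hu]
      field_simp
    · rw [hf u hu, sum_eq_zero]
      intro k _
      rw [hend u hu0 hu1 hu k, mul_zero]
  | succ m ih =>
    rw [Function.iterate_succ_apply', killedStep]
    split_ifs with hu
    · rw [Finset.mem_Ioo] at hu
      rw [ih (by omega) (by omega), ih (by omega) (by omega), ← sum_add_distrib, sum_div]
      refine sum_congr rfl fun k _ => ?_
      push_cast
      rw [show (k : ℝ) * freq n * (u - 1) = k * freq n * u - k * freq n by ring,
        show (k : ℝ) * freq n * (u + 1) = k * freq n * u + k * freq n by ring,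
        Real.sin_sub, Real.sin_add]
      ring
    · rw [sum_eq_zero]
      intro k _
      rw [hend u hu0 hu1 hu k, mul_zero]

theorem abs_sin_nat_mul_le (k : ℕ) (a : ℝ) : |Real.sin (k * a)| ≤ k * |Real.sin a| := by
  induction k with
  | zero => simp
  | succ k ih =>
    push_cast
    rw [add_mul, one_mul, Real.sin_add]
    calc _ ≤ |Real.sin (k * a)| * |Real.cos a| + |Real.cos (k * a)| * |Real.sin a| := by
          rw [← abs_mul, ← abs_mul]; exact abs_add_le _ _
      _ ≤ k * |Real.sin a| * 1 + 1 * |Real.sin a| := by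
          gcongr
          · exact Real.abs_cos_le_one a
          · exact Real.abs_cos_le_one _
      _ = _ := by ring

theorem sin_freq_nonneg {n : ℕ} {u : ℤ} (hu : u ∈ Ioo (0 : ℤ) (2 * n)) :
    0 ≤ Real.sin (freq n * u) := by
  rw [Finset.mem_Ioo] at hu
  have hn : 0 < n := by omega
  have h0 : (0 : ℝ) ≤ u := by exact_mod_cast hu.1.le
  have h1 : (u : ℝ) ≤ 2 * n := by exact_mod_cast hu.2.le
  have := freq_pos hn
  apply Real.sin_nonneg_of_nonneg_of_le_pi (by positivity)
  rw [← two_mul_freq hn]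
  nlinarith

theorem cos_two_freq_nonneg {n : ℕ} (hn : 2 ≤ n) : 0 ≤ Real.cos (2 * freq n) := by
  have h1 := freq_pos (n := n) (by omega)
  have h2 := two_mul_freq (n := n) (by omega)
  have h3 : (2 : ℝ) ≤ n := by exact_mod_cast hn
  apply Real.cos_nonneg_of_neg_pi_div_two_le_of_le <;> nlinarith

theorem cos_freq_pos {n : ℕ} (hn : 2 ≤ n) : 0 < Real.cos (freq n) := by
  have h1 := freq_pos (n := n) (by omega)
  have h2 := two_mul_freq (n := n) (by omega)
  have h3 : (2 : ℝ) ≤ n := by exact_mod_cast hn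
  apply Real.cos_pos_of_mem_Ioo
  constructor <;> nlinarith

theorem abs_cos_mul_freq_le {n k : ℕ} (h2 : 2 ≤ k) (hk : k + 2 ≤ 2 * n) :
    |Real.cos (k * freq n)| ≤ Real.cos (2 * freq n) := by
  have h1 := freq_pos (n := n) (by omega)
  have hπ := two_mul_freq (n := n) (by omega)
  have hk2 : (2 : ℝ) ≤ k := by exact_mod_cast h2
  have hk' : (k : ℝ) + 2 ≤ 2 * n := by exact_mod_cast hk
  rw [abs_le]
  constructor
  · rw [neg_le, ← Real.cos_pi_sub]
    apply Real.cos_le_cos_of_nonneg_of_le_pi <;> nlinarith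
  · apply Real.cos_le_cos_of_nonneg_of_le_pi <;> nlinarith

theorem cos_two_freq_le {n : ℕ} (hn : 2 ≤ n) :
    Real.cos (2 * freq n) ≤ Real.cos (freq n) * Real.exp (-1 / (2 * n ^ 2)) := by
  have h1 := freq_pos (n := n) (by omega)
  have hn0 : (0 : ℝ) < n := by exact_mod_cast (show 0 < n by omega)
  have hc := cos_freq_pos hn
  have hc1 := Real.cos_le_one (freq n)
  have hq : Real.cos (freq n) ≤ 1 - 1 / (2 * n ^ 2) := by
    have hπ := Real.pi_pos
    have hn2 : (2 : ℝ) ≤ n := by exact_mod_cast hn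
    have hle : freq n ≤ Real.pi := by rw [← two_mul_freq (n := n) (by omega)]; nlinarith
    have h3 := Real.cos_le_one_sub_mul_cos_sq (x := freq n) (by rwa [abs_of_pos h1])
    have h6 : 2 / Real.pi ^ 2 * freq n ^ 2 = 1 / (2 * n ^ 2) := by
      rw [freq]; field_simp
    linarith
  have h4 := Real.add_one_le_exp (-1 / (2 * (n : ℝ) ^ 2))
  rw [Real.cos_two_mul]
  have h5 : (-1 : ℝ) / (2 * n ^ 2) = - (1 / (2 * n ^ 2)) := by ring
  nlinarith

theorem abs_sineCoeff_le {n : ℕ} (hn : 0 < n) {f : ℤ → ℝ} (hf : ∀ v, |f v| ≤ 1) (k : ℕ) :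
    |sineCoeff n f k| ≤ 2 := by
  rw [sineCoeff, abs_div, Nat.abs_cast, div_le_iff₀ (by exact_mod_cast hn)]
  calc _ ≤ ∑ v ∈ Ioo (0 : ℤ) (2 * n), |f v * Real.sin (k * freq n * v)| := abs_sum_le_sum_abs _ _
    _ ≤ ∑ v ∈ Ioo (0 : ℤ) (2 * n), (1 : ℝ) := sum_le_sum fun v _ => by
        rw [abs_mul]
        exact mul_le_one₀ (hf v) (abs_nonneg _) (Real.abs_sin_le_one _)
    _ ≤ 2 * n := by
        rw [sum_const, Int.card_Ioo, nsmul_eq_mul, mul_one]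
        have : (2 * (n : ℤ) - 0 - 1).toNat ≤ 2 * n := by omega
        exact_mod_cast this

/-- Convergence of the free evolution to the principal mode. -/
theorem abs_killedStep_iterate_sub_le {n : ℕ} (hn : 2 ≤ n) {f : ℤ → ℝ} (hf : SupportedIn n f)
    (hf1 : ∀ v, |f v| ≤ 1) (m : ℕ) {u : ℤ} (hu : u ∈ Ioo (0 : ℤ) (2 * n)) :
    |(killedStep n)^[m] f u - sineCoeff n f 1 * Real.cos (freq n) ^ m * Real.sin (freq n * u)| ≤
      Real.cos (freq n) ^ m * Real.sin (freq n * u) *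
        (|sineCoeff n f (2 * n - 1)| + 8 * n ^ 2 * Real.exp (-m / (2 * n ^ 2))) := by
  have hn0 : 0 < n := by omega
  have hh := sin_freq_nonneg hu
  have hc := cos_freq_pos hn
  have hu' := hu
  rw [Finset.mem_Ioo] at hu'
  set h := Real.sin (freq n * u) with hhdef
  set L := Real.cos (freq n) with hL
  set E := Real.exp (-m / (2 * (n : ℝ) ^ 2)) with hE
  have hpow : Real.cos (2 * freq n) ^ m ≤ L ^ m * E := by
    refine (pow_le_pow_left₀ (cos_two_freq_nonneg hn) (cos_two_freq_le hn) m).trans_eq ?_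
    rw [mul_pow, ← Real.exp_nat_mul, hE]
    congr 2
    ring
  rw [killedStep_iterate_eq_sum hn0 hf m hu'.1.le hu'.2.le,
    ← add_sum_erase (range (2 * n)) _ (show 1 ∈ range (2 * n) by rw [Finset.mem_range]; omega),
    Nat.cast_one, one_mul, ← hL, ← hhdef, add_sub_cancel_left]
  calc _ ≤ ∑ k ∈ (range (2 * n)).erase 1,
          |sineCoeff n f k * Real.cos (k * freq n) ^ m * Real.sin (k * freq n * u)| :=
        abs_sum_le_sum_abs _ _
    _ ≤ ∑ k ∈ (range (2 * n)).erase 1,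
          ((if k = 2 * n - 1 then |sineCoeff n f (2 * n - 1)| * (L ^ m * h) else 0) +
            4 * n * h * (L ^ m * E)) := by
        refine sum_le_sum fun k hk => ?_
        simp only [mem_erase, Finset.mem_range] at hk
        have hpos : 0 ≤ 4 * n * h * (L ^ m * E) := by positivity
        rw [abs_mul, abs_mul, abs_pow]
        split_ifs with hk1
        · refine le_add_of_le_of_nonneg (le_of_eq ?_) hpos
          have hkc : (k : ℝ) = 2 * n - 1 := by
            rw [hk1, Nat.cast_sub (by omega)]; push_cast; ring
          have h1 : Real.cos (k * freq n) = -L := by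
            rw [hkc, show (2 * (n : ℝ) - 1) * freq n = Real.pi - freq n by
              rw [← two_mul_freq hn0]; ring, Real.cos_pi_sub]
          have h2 : |Real.sin (k * freq n * u)| = h := by
            rw [hkc, show (2 * (n : ℝ) - 1) * freq n * u = u * Real.pi - freq n * u by
              rw [← two_mul_freq hn0]; ring, Real.sin_sub, Real.sin_int_mul_pi, zero_mul, zero_sub,
              abs_neg, abs_mul, Real.abs_cos_int_mul_pi, one_mul, ← hhdef, abs_of_nonneg hh]
          rw [h1, h2, hk1, abs_neg, abs_of_pos hc]
          ring
        · rw [zero_add]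
          rcases Nat.eq_zero_or_pos k with rfl | hk0
          · simpa using hpos
          have h1 : |Real.cos (k * freq n)| ^ m ≤ L ^ m * E :=
            (pow_le_pow_left₀ (abs_nonneg _) (abs_cos_mul_freq_le (by omega) (by omega)) m).trans
              hpow
          have h2 : |Real.sin (k * freq n * u)| ≤ 2 * n * h := by
            have h3 := abs_sin_nat_mul_le k (freq n * u)
            rw [← mul_assoc, ← hhdef, abs_of_nonneg hh] at h3
            refine h3.trans ?_
            gcongr
            exact_mod_cast hk.2.le
          calc _ ≤ 2 * (L ^ m * E) * (2 * n * h) := by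
                gcongr
                exact abs_sineCoeff_le hn0 hf1 k
            _ = _ := by ring
    _ ≤ ∑ k ∈ range (2 * n),
          ((if k = 2 * n - 1 then |sineCoeff n f (2 * n - 1)| * (L ^ m * h) else 0) +
            4 * n * h * (L ^ m * E)) := by
        refine sum_le_sum_of_subset_of_nonneg (erase_subset _ _) fun k _ _ => ?_
        split_ifs <;> positivity
    _ = _ := by
        rw [sum_add_distrib, sum_ite_eq', if_pos (by rw [Finset.mem_range]; omega), sum_const,
          card_range]
        simp only [nsmul_eq_mul]
        push_cast
        ring

theorem sineCoeff_single_abs_le {n : ℕ} {u : ℤ} (hu : u ∈ Ioo (0 : ℤ) (2 * n)) (k : ℕ) :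
    |sineCoeff n (Pi.single u 1) k| ≤ 1 / n := by
  have h : ∑ v ∈ Ioo (0 : ℤ) (2 * n), (Pi.single u (1 : ℝ) : ℤ → ℝ) v *
      Real.sin (k * freq n * v) = Real.sin (k * freq n * u) := by
    rw [sum_eq_single u (fun v _ hv => by simp [hv]) (fun h => absurd hu h)]
    simp
  rw [sineCoeff, h, abs_div, Nat.abs_cast]
  gcongr
  exact Real.abs_sin_le_one _

theorem killedStep_iterate_single_le {n : ℕ} (hn : 2 ≤ n) {u v : ℤ}
    (hu : u ∈ Ioo (0 : ℤ) (2 * n)) (hv : v ∈ Ioo (0 : ℤ) (2 * n)) (m : ℕ) :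
    (killedStep n)^[m] (Pi.single u (1 : ℝ)) v ≤ Real.cos (freq n) ^ m *
      (Real.sin (freq n * v) * (2 / n + 8 * n ^ 2 * Real.exp (-m / (2 * n ^ 2)))) := by
  have h1 := abs_killedStep_iterate_sub_le hn (supportedIn_single (𝕜 := ℝ) hu) (fun w => by
    rw [Pi.single_apply]
    split_ifs <;> simp) m hv
  have h2 := (abs_le.1 h1).2
  have h3 := sineCoeff_single_abs_le hu 1
  have h4 := sineCoeff_single_abs_le hu (2 * n - 1)
  have hc := (cos_freq_pos hn).le
  have hh := sin_freq_nonneg hv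
  calc _ ≤ sineCoeff n (Pi.single u 1) 1 * Real.cos (freq n) ^ m * Real.sin (freq n * v) +
        Real.cos (freq n) ^ m * Real.sin (freq n * v) *
          (|sineCoeff n (Pi.single u 1) (2 * n - 1)| +
            8 * n ^ 2 * Real.exp (-m / (2 * n ^ 2))) := by linarith
    _ ≤ 1 / n * Real.cos (freq n) ^ m * Real.sin (freq n * v) +
        Real.cos (freq n) ^ m * Real.sin (freq n * v) *
          (1 / n + 8 * n ^ 2 * Real.exp (-m / (2 * n ^ 2))) := by
        gcongr
        exact (le_abs_self _).trans h3
    _ = _ := by ring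

theorem sum_sin_freq {n : ℕ} (hn : 0 < n) (k : ℕ) :
    (1 - Real.cos (k * freq n)) * ∑ v ∈ Ioo (0 : ℤ) (2 * n), Real.sin (k * freq n * v) =
      (Real.sin (k * freq n) + Real.sin (k * freq n * (2 * n - 1))) / 2 := by
  have hsum : ∀ M : ℕ, 2 * (1 - Real.cos (k * freq n)) *
      ∑ v ∈ Ioo (0 : ℤ) (M + 1), Real.sin (k * freq n * v) =
      Real.sin (k * freq n) + Real.sin (k * freq n * M) - Real.sin (k * freq n * (M + 1)) := by
    intro M
    induction M with
    | zero =>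
      have : Ioo (0 : ℤ) 1 = ∅ := rfl
      simp [this]
    | succ M ih =>
      have : Ioo (0 : ℤ) ((M + 1 : ℕ) + 1) = insert ((M : ℤ) + 1) (Ioo (0 : ℤ) (M + 1)) := by
        ext v
        simp only [Finset.mem_Ioo, Finset.mem_insert]
        omega
      rw [this, sum_insert (by simp), mul_add, ih]
      push_cast
      rw [show (k : ℝ) * freq n * M = k * freq n * (M + 1) - k * freq n by ring,
        show (k : ℝ) * freq n * (M + 1 + 1) = k * freq n * (M + 1) + k * freq n by ring,
        Real.sin_add, Real.sin_sub]
      ring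
  have h := hsum (2 * n - 1)
  have h1 : (((2 * n - 1 : ℕ) : ℤ) + 1) = 2 * n := by omega
  have h2 : ((2 * n - 1 : ℕ) : ℝ) = 2 * n - 1 := by
    rw [Nat.cast_sub (by omega)]; push_cast; ring
  have h3 := sin_freq_two_mul hn k
  push_cast at h3
  rw [h1, h2, sub_add_cancel, h3] at h
  linarith

theorem sineCoeff_interiorInd {n : ℕ} (k : ℕ) : sineCoeff n (interiorInd n) k =
    (∑ v ∈ Ioo (0 : ℤ) (2 * n), Real.sin (k * freq n * v)) / n := by
  rw [sineCoeff]
  congr 1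
  exact sum_congr rfl fun v hv => by rw [interiorInd, if_pos hv, one_mul]

theorem interiorInd_abs_le (n : ℕ) (v : ℤ) : |interiorInd n v| ≤ 1 := by
  rw [interiorInd]; split_ifs <;> simp

theorem half_le_sineCoeff_interiorInd {n : ℕ} (hn : 2 ≤ n) :
    1 / 2 ≤ sineCoeff n (interiorInd n) 1 := by
  have hn0 : (0 : ℝ) < n := by exact_mod_cast (show 0 < n by omega)
  have hn2 : (2 : ℝ) ≤ n := by exact_mod_cast hn
  have hθ := freq_pos (n := n) (by omega)
  have hπ := two_mul_freq (n := n) (by omega)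
  have h := sum_sin_freq (n := n) (by omega) 1
  rw [sineCoeff_interiorInd, le_div_iff₀ hn0]
  simp only [Nat.cast_one, one_mul] at h ⊢
  rw [show freq n * (2 * n - 1) = Real.pi - freq n by rw [← hπ]; ring, Real.sin_pi_sub] at h
  set H := ∑ v ∈ Ioo (0 : ℤ) (2 * n), Real.sin (freq n * v)
  have h1 : 1 - Real.cos (freq n) ≤ freq n ^ 2 / 2 := by
    linarith [Real.one_sub_sq_div_two_le_cos (x := freq n)]
  have h2 : 2 / Real.pi * freq n ≤ Real.sin (freq n) :=
    Real.mul_le_sin hθ.le (by nlinarith)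
  have hpos : 0 ≤ H := sum_nonneg fun v hv => sin_freq_nonneg hv
  have h3 : 2 / Real.pi * freq n ≤ freq n ^ 2 / 2 * H := by nlinarith
  have h4 : 2 / Real.pi ≤ freq n / 2 * H := by nlinarith
  have hp := Real.pi_pos
  rw [div_le_iff₀ hp] at h4
  have h5 : freq n * n = Real.pi / 2 := by linarith
  have h6 : 2 * n ≤ freq n * n / 2 * H * Real.pi := by nlinarith
  rw [h5] at h6
  have h7 : Real.pi < 3.15 := Real.pi_lt_d2
  have h8 : Real.pi * Real.pi ≤ 16 := by nlinarith
  nlinarith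

theorem abs_survival_sub_le {n : ℕ} (hn : 2 ≤ n) (m : ℕ) {u : ℤ}
    (hu : u ∈ Ioo (0 : ℤ) (2 * n)) :
    |(killedStep n)^[m] (interiorInd n) u -
        sineCoeff n (interiorInd n) 1 * Real.cos (freq n) ^ m * Real.sin (freq n * u)| ≤
      Real.cos (freq n) ^ m * (1 / n + 8 * n ^ 2 * Real.exp (-m / (2 * n ^ 2))) := by
  refine (abs_killedStep_iterate_sub_le hn (supportedIn_interiorInd n)
    (interiorInd_abs_le n) m hu).trans ?_
  have hn0 : (0 : ℝ) < n := by exact_mod_cast (show 0 < n by omega)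
  have hc := cos_freq_pos hn
  have hk : |sineCoeff n (interiorInd n) (2 * n - 1)| ≤ 1 / n := by
    have h := sum_sin_freq (n := n) (by omega) (2 * n - 1)
    rw [sineCoeff_interiorInd, abs_div, Nat.abs_cast]
    gcongr
    have hc1 : Real.cos ((2 * n - 1 : ℕ) * freq n) = - Real.cos (freq n) := by
      rw [Nat.cast_sub (by omega), ← Real.cos_pi_sub, ← two_mul_freq (n := n) (by omega)]
      congr 1
      push_cast; ring
    rw [hc1] at h
    set B := ∑ v ∈ Ioo (0 : ℤ) (2 * n), Real.sin ((2 * n - 1 : ℕ) * freq n * v)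
    have h1 := Real.abs_sin_le_one ((2 * n - 1 : ℕ) * freq n)
    have h2 := Real.abs_sin_le_one ((2 * n - 1 : ℕ) * freq n * (2 * n - 1))
    rw [abs_le] at h1 h2 ⊢
    constructor <;> nlinarith
  calc _ ≤ Real.cos (freq n) ^ m * 1 *
        (1 / n + 8 * n ^ 2 * Real.exp (-m / (2 * n ^ 2))) := by
        gcongr
        exact Real.sin_le_one _
    _ = _ := by ring

/-- Gluing two solutions of the three-term recurrence produces a defect at the gluing site. -/
theorem glue_recurrence {𝕜 : Type*} [Field 𝕜] [CharZero 𝕜] {L R : ℤ → 𝕜} {c : 𝕜} {x : ℤ}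
    (hL : ∀ v, (L (v - 1) + L (v + 1)) / 2 = c * L v)
    (hR : ∀ v, (R (v - 1) + R (v + 1)) / 2 = c * R v) (hx : L x = R x) (v : ℤ) :
    ((if v - 1 ≤ x then L (v - 1) else R (v - 1)) +
      (if v + 1 ≤ x then L (v + 1) else R (v + 1))) / 2 =
      c * (if v ≤ x then L v else R v) + if v = x then (R (x + 1) - L (x + 1)) / 2 else 0 := by
  rcases lt_trichotomy v x with h | h | h
  · rw [if_pos (by omega), if_pos (by omega), if_pos h.le, if_neg h.ne, hL, add_zero]
  · subst h
    rw [if_pos (by omega), if_neg (by omega), if_pos le_rfl, if_pos rfl, ← hL]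
    ring
  · rw [if_neg (show ¬v + 1 ≤ x by omega), if_neg (not_le.2 h), if_neg h.ne', add_zero, ← hR]
    by_cases h1 : v - 1 ≤ x
    · rw [if_pos h1, show v - 1 = x by omega, hx]
    · rw [if_neg h1]

theorem sum_div_pow_le {a : ℕ → ℝ} (ha : ∀ j, 0 ≤ a j) {b c : ℝ} (hb : 0 < b) (hbc : b ≤ c)
    (t : ℕ) :
    ∑ j ∈ range t, a j / b ^ (j + 1) ≤ (c / b) ^ t * ∑ j ∈ range t, a j / c ^ (j + 1) := by
  have hc : 0 < c := hb.trans_le hbc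
  rw [mul_sum]
  refine sum_le_sum fun j hj => ?_
  rw [Finset.mem_range] at hj
  have h1 : (1 : ℝ) ≤ c / b := (one_le_div hb).2 hbc
  calc a j / b ^ (j + 1) = (c / b) ^ (j + 1) * (a j / c ^ (j + 1)) := by
        rw [div_pow]; field_simp
    _ ≤ _ := by
        have := ha j
        gcongr
        exact hj

theorem freq_le {n : ℕ} (hn : 2 ≤ n) : freq n ≤ Real.pi / 4 := by
  have hn2 : (2 : ℝ) ≤ n := by exact_mod_cast hn
  have h1 := freq_pos (n := n) (by omega)
  rw [← two_mul_freq (n := n) (by omega)]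
  nlinarith

theorem half_le_cos_freq {n : ℕ} (hn : 2 ≤ n) : 1 / 2 ≤ Real.cos (freq n) := by
  have h1 := Real.one_sub_sq_div_two_le_cos (x := freq n)
  have h2 := freq_le hn
  have h3 := freq_pos (n := n) (by omega)
  have h4 := Real.pi_lt_d2
  nlinarith

theorem cos_shrunk_freq_div_pow_le {n : ℕ} (hn : 2 ≤ n) {δ : ℝ} (h0 : 0 < δ) (h1 : δ ≤ 1 / 2)
    (t : ℕ) : (Real.cos (freq n * (1 - δ)) / Real.cos (freq n)) ^ t ≤
      Real.exp (5 * δ * t / n ^ 2) := by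
  have hc := half_le_cos_freq hn
  have hθ := freq_pos (n := n) (by omega)
  have hn0 : (0 : ℝ) < n := by exact_mod_cast (show 0 < n by omega)
  have hdiff : Real.cos (freq n * (1 - δ)) - Real.cos (freq n) ≤ δ * freq n ^ 2 := by
    rw [Real.cos_sub_cos]
    have e1 : (freq n * (1 - δ) - freq n) / 2 = -(δ * freq n / 2) := by ring
    have e2 : Real.sin ((freq n * (1 - δ) + freq n) / 2) ≤ freq n :=
      (Real.sin_le (by nlinarith)).trans (by nlinarith)
    have e3 : Real.sin (δ * freq n / 2) ≤ δ * freq n / 2 := Real.sin_le (by positivity)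
    have e4 : 0 ≤ Real.sin (δ * freq n / 2) :=
      Real.sin_nonneg_of_nonneg_of_le_pi (by positivity)
        (by have := freq_le hn; have := Real.pi_pos; nlinarith)
    rw [e1, Real.sin_neg]
    nlinarith
  have hsq : freq n ^ 2 ≤ 5 / 2 / n ^ 2 := by
    have := Real.pi_lt_d2
    have := Real.pi_pos
    rw [freq, div_pow, mul_pow, div_div, div_le_div_iff₀ (by positivity) (by positivity)]
    have h10 : Real.pi ^ 2 ≤ 10 := by nlinarith
    have : 0 < (n : ℝ) ^ 2 := by positivity
    nlinarith
  have hle : Real.cos (freq n * (1 - δ)) / Real.cos (freq n) ≤ Real.exp (5 * δ / n ^ 2) := by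
    refine le_trans ?_ (Real.add_one_le_exp _)
    rw [div_le_iff₀ (by linarith)]
    have h2 : δ * freq n ^ 2 ≤ 5 * δ / n ^ 2 * (1 / 2) := by
      calc δ * freq n ^ 2 ≤ δ * (5 / 2 / n ^ 2) := by gcongr
        _ = _ := by ring
    have h3 : 0 ≤ 5 * δ / (n : ℝ) ^ 2 := by positivity
    nlinarith
  have hpos : 0 ≤ Real.cos (freq n * (1 - δ)) := by
    apply Real.cos_nonneg_of_neg_pi_div_two_le_of_le
    · have := Real.pi_pos; nlinarith
    · have := freq_le hn; nlinarith
  calc _ ≤ Real.exp (5 * δ / n ^ 2) ^ t := pow_le_pow_left₀ (by positivity) hle t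
    _ = _ := by rw [← Real.exp_nat_mul]; congr 1; ring

theorem cos_freq_le_shrunk {n : ℕ} (hn : 2 ≤ n) {δ : ℝ} (h0 : 0 < δ) (h1 : δ ≤ 1 / 2) :
    Real.cos (freq n) ≤ Real.cos (freq n * (1 - δ)) := by
  have hθ := freq_pos (n := n) (by omega)
  have := freq_le hn
  have := Real.pi_pos
  apply Real.cos_le_cos_of_nonneg_of_le_pi <;> nlinarith

/-- Discounted number of visits to `x`. -/
theorem sum_killedStep_single_div_le {n x : ℕ} (hx : 1 ≤ x) (hxn : x < n) {δ : ℝ}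
    (h0 : 0 < δ) (h1 : δ ≤ 1 / 2) (t : ℕ) :
    ∑ j ∈ range t, (killedStep n)^[j] (Pi.single (n : ℤ) (1 : ℝ)) x /
      Real.cos (freq n) ^ (j + 1) ≤
        Real.exp (5 * δ * t / n ^ 2) * (Real.pi * x / (2 * δ)) := by
  have hn : 2 ≤ n := by omega
  have hθ := freq_pos (n := n) (by omega)
  have hπ := two_mul_freq (n := n) (by omega)
  have hpi := Real.pi_pos
  have hc := cos_freq_pos hn
  have hcc := cos_freq_le_shrunk hn h0 h1
  have hxI : (x : ℤ) ∈ Ioo (0 : ℤ) (2 * n) := by rw [Finset.mem_Ioo]; omega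
  have hnI : (n : ℤ) ∈ Ioo (0 : ℤ) (2 * n) := by rw [Finset.mem_Ioo]; omega
  set ϑ := freq n * (1 - δ) with hϑ
  have hϑ0 : 0 < ϑ := mul_pos hθ (by linarith)
  have hϑn : 2 * n * ϑ = Real.pi - Real.pi * δ := by rw [hϑ, ← hπ]; ring
  have hsin : ∀ v : ℤ, v ∈ Ioo (0 : ℤ) (2 * n) → 0 < Real.sin (ϑ * v) := by
    intro v hv
    rw [Finset.mem_Ioo] at hv
    have hv0 : (0 : ℝ) < v := by exact_mod_cast hv.1
    have hv1 : (v : ℝ) < 2 * n := by exact_mod_cast hv.2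
    apply Real.sin_pos_of_pos_of_lt_pi (by positivity)
    nlinarith
  have hsin' : ∀ v : ℤ, v ∈ Ioo (0 : ℤ) (2 * n) → 0 < Real.sin (ϑ * (2 * n - v)) := by
    intro v hv
    have := hsin (2 * n - v) (by rw [Finset.mem_Ioo] at hv ⊢; omega)
    push_cast at this
    exact this
  have hsx := hsin x hxI
  set L : ℤ → ℝ := fun v => Real.sin (ϑ * (2 * n - x)) / Real.sin (ϑ * x) * Real.sin (ϑ * v) with hL
  set R : ℤ → ℝ := fun v => Real.sin (ϑ * (2 * n - v)) with hR
  set F : ℤ → ℝ := fun v => if v ≤ (x : ℤ) then L v else R v with hF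
  set ε := Real.sin ϑ * Real.sin (2 * n * ϑ) / Real.sin (ϑ * x) / 2 with hε
  have hLrec : ∀ v, (L (v - 1) + L (v + 1)) / 2 = Real.cos ϑ * L v := fun v => by
    simp only [hL]
    push_cast
    rw [show ϑ * ((v : ℝ) - 1) = ϑ * v - ϑ by ring, show ϑ * ((v : ℝ) + 1) = ϑ * v + ϑ by ring,
      Real.sin_sub, Real.sin_add]
    ring
  have hRrec : ∀ v, (R (v - 1) + R (v + 1)) / 2 = Real.cos ϑ * R v := fun v => by
    simp only [hR]
    push_cast
    rw [show ϑ * (2 * n - ((v : ℝ) - 1)) = ϑ * (2 * n - v) + ϑ by ring,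
      show ϑ * (2 * n - ((v : ℝ) + 1)) = ϑ * (2 * n - v) - ϑ by ring, Real.sin_sub, Real.sin_add]
    ring
  have hLR : L x = R x := by
    simp only [hL, hR]
    push_cast at hsx ⊢
    exact div_mul_cancel₀ _ hsx.ne'
  have hkink : (R (x + 1) - L (x + 1)) / 2 = -ε := by
    simp only [hL, hR, hε]
    push_cast
    rw [show ϑ * (2 * n - ((x : ℝ) + 1)) = ϑ * (2 * n - x) - ϑ by ring,
      show ϑ * ((x : ℝ) + 1) = ϑ * x + ϑ by ring,
      show 2 * n * ϑ = ϑ * (2 * n - x) + ϑ * x by ring, Real.sin_sub, Real.sin_add, Real.sin_add]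
    push_cast at hsx
    field_simp
    ring
  have hF0 : F 0 = 0 := by
    simp only [hF]
    rw [if_pos (by omega)]
    simp [hL]
  have hF1 : F (2 * n) = 0 := by
    simp only [hF]
    rw [if_neg (by omega)]
    simp [hR]
  have hFnonneg : ∀ v, 0 ≤ truncate n F v := by
    intro v
    rw [truncate]
    split_ifs with hv
    · simp only [hF]
      split_ifs
      · have h3 := hsin' x hxI
        have h4 := hsin v hv
        push_cast at h3 hsx
        simp only [hL]
        positivity
      · exact (hsin' v hv).le
    · exact le_rfl
  have hgreen := sum_killedStep_iterate_le (c := Real.cos ϑ) (ε := ε) (hc.trans_le hcc) hFnonneg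
    (supportedIn_single (𝕜 := ℝ) hxI) (fun v hv => by
      rw [killedStep_truncate hF0 hF1 hv, truncate, if_pos hv]
      simp only [hF]
      rw [glue_recurrence hLrec hRrec hLR, hkink, Pi.single_apply]
      split_ifs <;> simp) t n
  have hFn : truncate n F n ≤ 1 := by
    rw [truncate, if_pos hnI]
    simp only [hF]
    rw [if_neg (by omega)]
    exact Real.sin_le_one _
  have hεlow : 2 * δ / (Real.pi * x) ≤ ε := by
    have hx0 : (0 : ℝ) < x := by exact_mod_cast hx
    have s1 : 2 / Real.pi * ϑ ≤ Real.sin ϑ := by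
      apply Real.mul_le_sin hϑ0.le
      have := freq_le hn
      nlinarith
    have s2 : 2 * δ ≤ Real.sin (2 * n * ϑ) := by
      rw [hϑn, Real.sin_pi_sub]
      calc 2 * δ = 2 / Real.pi * (Real.pi * δ) := by field_simp
        _ ≤ _ := Real.mul_le_sin (by positivity) (by nlinarith)
    have s3 : Real.sin (ϑ * x) ≤ ϑ * x := Real.sin_le (by positivity)
    push_cast at hsx
    calc 2 * δ / (Real.pi * x) = (2 / Real.pi * ϑ) * (2 * δ) / (ϑ * x) / 2 := by field_simp
      _ ≤ ε := by
        have s4 : 2 / Real.pi * ϑ * (2 * δ) ≤ Real.sin ϑ * Real.sin (2 * n * ϑ) :=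
          mul_le_mul s1 s2 (by positivity) (le_trans (by positivity) s1)
        have s5 : 0 ≤ Real.sin ϑ * Real.sin (2 * n * ϑ) := le_trans (by positivity) s4
        rw [hε]
        gcongr
  have hx0 : (0 : ℝ) < x := by exact_mod_cast hx
  have hε0 : 0 < ε := lt_of_lt_of_le (by positivity) hεlow
  have hnn : ∀ j, 0 ≤ (killedStep n)^[j] (Pi.single (x : ℤ) (1 : ℝ)) n := fun j =>
    killedStep_iterate_nonneg (fun v => by rw [Pi.single_apply]; split_ifs <;> norm_num) j n
  have hsum : ∑ j ∈ range t, (killedStep n)^[j] (Pi.single (x : ℤ) (1 : ℝ)) n /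
      Real.cos ϑ ^ (j + 1) ≤ Real.pi * x / (2 * δ) := by
    have h5 : ∑ j ∈ range t, (killedStep n)^[j] (Pi.single (x : ℤ) (1 : ℝ)) n /
      Real.cos ϑ ^ (j + 1) ≤ 1 / ε := by
      rw [le_div_iff₀ hε0, mul_comm]
      exact hgreen.trans hFn
    refine h5.trans ?_
    rw [div_le_iff₀ hε0]
    calc (1 : ℝ) = Real.pi * x / (2 * δ) * (2 * δ / (Real.pi * x)) := by field_simp
      _ ≤ _ := by gcongr
  simp_rw [killedStep_iterate_single_comm hnI hxI]
  refine (sum_div_pow_le hnn hc hcc t).trans ?_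
  gcongr
  · exact sum_nonneg fun j _ => div_nonneg (hnn j) (pow_nonneg (hc.trans_le hcc).le _)
  · exact cos_shrunk_freq_div_pow_le hn h0 h1 t

/-- Discounted survival probabilities from `x`. -/
theorem sum_survival_div_le {n x : ℕ} (hx : 1 ≤ x) (hxn : x < n) {δ : ℝ}
    (h0 : 0 < δ) (h1 : δ ≤ 1 / 2) (t : ℕ) :
    ∑ j ∈ range t, (killedStep n)^[j] (interiorInd n) x / Real.cos (freq n) ^ (j + 1) ≤
        Real.exp (5 * δ * t / n ^ 2) * (2 * Real.pi * x * n / δ) := by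
  have hn : 2 ≤ n := by omega
  have hn0 : (0 : ℝ) < n := by exact_mod_cast (show 0 < n by omega)
  have hx0 : (0 : ℝ) < x := by exact_mod_cast hx
  have hθ := freq_pos (n := n) (by omega)
  have hθ4 := freq_le hn
  have hπ := two_mul_freq (n := n) (by omega)
  have hpi := Real.pi_pos
  have hc := cos_freq_pos hn
  have hcc := cos_freq_le_shrunk hn h0 h1
  have hxI : (x : ℤ) ∈ Ioo (0 : ℤ) (2 * n) := by rw [Finset.mem_Ioo]; omega
  set ϑ := freq n * (1 - δ) with hϑ
  have hϑ0 : 0 < ϑ := mul_pos hθ (by linarith)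
  have hϑπ : ϑ ≤ Real.pi := by nlinarith
  have hϑn : ϑ * n = Real.pi / 2 - Real.pi * δ / 2 := by rw [hϑ, ← hπ]; ring
  have hb : δ ≤ Real.cos (ϑ * n) := by
    rw [hϑn, Real.cos_pi_div_two_sub]
    calc δ = 2 / Real.pi * (Real.pi * δ / 2) := by field_simp
      _ ≤ _ := Real.mul_le_sin (by positivity) (by nlinarith)
  set F : ℤ → ℝ := fun v => Real.cos (ϑ * (v - n)) - Real.cos (ϑ * n) with hF
  have hF0 : F 0 = 0 := by
    simp only [hF]
    rw [show ϑ * (((0 : ℤ) : ℝ) - n) = -(ϑ * n) by push_cast; ring, Real.cos_neg, sub_self]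
  have hF1 : F (2 * n) = 0 := by
    simp only [hF]
    rw [show ϑ * (((2 * n : ℤ) : ℝ) - n) = ϑ * n by push_cast; ring, sub_self]
  have hFnonneg : ∀ v, 0 ≤ truncate n F v := by
    intro v
    rw [truncate]
    split_ifs with hv
    · rw [Finset.mem_Ioo] at hv
      have hv0 : (0 : ℝ) < v := by exact_mod_cast hv.1
      have hv1 : (v : ℝ) < 2 * n := by exact_mod_cast hv.2
      simp only [hF]
      rw [sub_nonneg, ← Real.cos_abs (ϑ * (v - n))]
      apply Real.cos_le_cos_of_nonneg_of_le_pi (abs_nonneg _) (by nlinarith)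
      rw [abs_mul, abs_of_pos hϑ0]
      gcongr
      rw [abs_le]
      constructor <;> linarith
    · exact le_rfl
  set ε := Real.cos (ϑ * n) * (1 - Real.cos ϑ) with hε
  have hgreen := sum_killedStep_iterate_le (c := Real.cos ϑ) (ε := ε) (hc.trans_le hcc) hFnonneg
    (supportedIn_interiorInd n) (fun v hv => by
      rw [killedStep_truncate hF0 hF1 hv, truncate, if_pos hv, interiorInd, if_pos hv]
      simp only [hF, hε]
      push_cast
      rw [show ϑ * ((v : ℝ) - 1 - n) = ϑ * (v - n) - ϑ by ring,
        show ϑ * ((v : ℝ) + 1 - n) = ϑ * (v - n) + ϑ by ring, Real.cos_sub, Real.cos_add]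
      apply le_of_eq
      ring) t x
  have hFx : truncate n F x ≤ ϑ * x := by
    rw [truncate, if_pos hxI]
    simp only [hF]
    rw [Real.cos_sub_cos]
    have e1 : (ϑ * (((x : ℤ) : ℝ) - n) - ϑ * n) / 2 = -(ϑ * (n - x / 2)) := by push_cast; ring
    have e2 : (ϑ * (((x : ℤ) : ℝ) - n) + ϑ * n) / 2 = ϑ * x / 2 := by push_cast; ring
    rw [e1, e2, Real.sin_neg]
    have e3 : Real.sin (ϑ * x / 2) ≤ ϑ * x / 2 := Real.sin_le (by positivity)
    have e4 : 0 ≤ Real.sin (ϑ * x / 2) := by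
      apply Real.sin_nonneg_of_nonneg_of_le_pi (by positivity)
      have : (x : ℝ) < n := by exact_mod_cast hxn
      nlinarith
    have e5 := Real.sin_le_one (ϑ * (n - x / 2))
    nlinarith
  have hεlow : δ * (2 / Real.pi ^ 2 * ϑ ^ 2) ≤ ε := by
    have h3 := Real.cos_le_one_sub_mul_cos_sq (x := ϑ) (by rwa [abs_of_pos hϑ0])
    rw [hε]
    gcongr
    · exact h0.le.trans hb
    · linarith
  have hε0 : 0 < ε := lt_of_lt_of_le (by positivity) hεlow
  have hnn : ∀ j, 0 ≤ (killedStep n)^[j] (interiorInd n) x := fun j =>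
    killedStep_iterate_nonneg (interiorInd_nonneg n) j x
  have hϑlow : Real.pi / (4 * n) ≤ ϑ := by
    rw [div_le_iff₀ (by positivity)]
    nlinarith
  have hsum : ∑ j ∈ range t, (killedStep n)^[j] (interiorInd n) x / Real.cos ϑ ^ (j + 1) ≤
      2 * Real.pi * x * n / δ := by
    have h5 : ∑ j ∈ range t, (killedStep n)^[j] (interiorInd n) x / Real.cos ϑ ^ (j + 1) ≤
        ϑ * x / ε := by
      rw [le_div_iff₀ hε0, mul_comm]
      exact hgreen.trans hFx
    refine h5.trans ?_
    rw [div_le_iff₀ hε0]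
    calc ϑ * x = 2 * Real.pi * x * n / δ * (δ * (2 / Real.pi ^ 2 * (ϑ * (Real.pi / (4 * n))))) := by
          field_simp
          ring
      _ ≤ 2 * Real.pi * x * n / δ * (δ * (2 / Real.pi ^ 2 * (ϑ * ϑ))) := by gcongr
      _ = 2 * Real.pi * x * n / δ * (δ * (2 / Real.pi ^ 2 * ϑ ^ 2)) := by ring
      _ ≤ _ := by gcongr
  refine (sum_div_pow_le hnn hc hcc t).trans ?_
  gcongr
  · exact sum_nonneg fun j _ => div_nonneg (hnn j) (pow_nonneg (hc.trans_le hcc).le _)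
  · exact cos_shrunk_freq_div_pow_le hn h0 h1 t

theorem norm_sum_tiltedStep_mul_le {n : ℕ} {x u : ℤ} {z : ℂ} (hz : ‖z‖ = 1)
    (hu : u ∈ Ioo (0 : ℤ) (2 * n)) {f : ℤ → ℂ} {D : ℝ}
    (hf : ∀ v ∈ Ioo (0 : ℤ) (2 * n), ‖f v‖ ≤ D) (s : ℕ) :
    ‖∑ v ∈ Ioo (0 : ℤ) (2 * n), (tiltedStep n x z)^[s] (Pi.single u 1) v * f v‖ ≤
      (killedStep n)^[s] (interiorInd n) u * D := by
  rw [← sum_killedStep_iterate_single hu, sum_mul]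
  refine (norm_sum_le _ _).trans (sum_le_sum fun v hv => ?_)
  rw [norm_mul]
  have h1 : ‖(tiltedStep n x z)^[s] (Pi.single u 1) v‖ ≤
      (killedStep n)^[s] (Pi.single u (1 : ℝ)) v :=
    norm_tiltedStep_iterate_le hz (fun w => by
      rw [Pi.single_apply, Pi.single_apply]; split_ifs <;> simp) s v
  exact mul_le_mul h1 (hf v hv) (norm_nonneg _) ((norm_nonneg _).trans h1)

/-- The error scale in the spectral approximation at time `n ^ 2 * K`. -/
noncomputable def spectralError (n K : ℕ) : ℝ := 2 / n + 8 * n ^ 2 * Real.exp (-K / 2)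

theorem spectralError_nonneg (n K : ℕ) : 0 ≤ spectralError n K := by
  rw [spectralError]; positivity

theorem exp_neg_div_le {n K s : ℕ} (hn : 0 < n) (hs : n ^ 2 * K ≤ s) :
    Real.exp (-s / (2 * n ^ 2)) ≤ Real.exp (-K / 2) := by
  have hn0 : (0 : ℝ) < n := by exact_mod_cast hn
  have hs' : (n : ℝ) ^ 2 * K ≤ s := by exact_mod_cast hs
  rw [Real.exp_le_exp, div_le_div_iff₀ (by positivity) (by norm_num)]
  linarith

theorem killedStep_single_le_spectralError {n K s : ℕ} (hn : 2 ≤ n) (hs : n ^ 2 * K ≤ s)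
    {u : ℤ} (hu : u ∈ Ioo (0 : ℤ) (2 * n)) {x : ℕ} (hx : (x : ℤ) ∈ Ioo (0 : ℤ) (2 * n)) :
    (killedStep n)^[s] (Pi.single u (1 : ℝ)) x ≤
      Real.cos (freq n) ^ s * (freq n * x * spectralError n K) := by
  refine (killedStep_iterate_single_le hn hu hx s).trans ?_
  have h1 := cos_freq_pos hn
  have h2 := exp_neg_div_le (by omega) hs
  have h3 := freq_pos (n := n) (by omega)
  have h4 := spectralError_nonneg n K
  gcongr
  · exact Real.sin_le (by push_cast; positivity)
  · rw [spectralError]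
    gcongr

theorem abs_survival_sub_le_spectralError {n K s : ℕ} (hn : 2 ≤ n) (hs : n ^ 2 * K ≤ s)
    {u : ℤ} (hu : u ∈ Ioo (0 : ℤ) (2 * n)) :
    |(killedStep n)^[s] (interiorInd n) u -
        sineCoeff n (interiorInd n) 1 * Real.cos (freq n) ^ s * Real.sin (freq n * u)| ≤
      Real.cos (freq n) ^ s * spectralError n K := by
  refine (abs_survival_sub_le hn s hu).trans ?_
  have h1 := cos_freq_pos hn
  have h2 := exp_neg_div_le (by omega) hs
  rw [spectralError]
  gcongr
  norm_num

theorem sin_freq_mul_self {n : ℕ} (hn : 0 < n) : Real.sin (freq n * n) = 1 := by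
  rw [show freq n * n = Real.pi / 2 by have := two_mul_freq hn; linarith, Real.sin_pi_div_two]

theorem abs_survival_center_sub_le {n K s : ℕ} (hn : 2 ≤ n) (hs : n ^ 2 * K ≤ s) :
    |(killedStep n)^[s] (interiorInd n) n / Real.cos (freq n) ^ s -
        sineCoeff n (interiorInd n) 1| ≤ spectralError n K := by
  have h1 := cos_freq_pos hn
  have h := abs_survival_sub_le_spectralError hn hs (u := n)
    (by rw [Finset.mem_Ioo]; omega)
  rw [Int.cast_natCast, sin_freq_mul_self (by omega), mul_one] at h
  rw [show (killedStep n)^[s] (interiorInd n) n / Real.cos (freq n) ^ s -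
      sineCoeff n (interiorInd n) 1 = ((killedStep n)^[s] (interiorInd n) n -
        sineCoeff n (interiorInd n) 1 * Real.cos (freq n) ^ s) / Real.cos (freq n) ^ s by
      field_simp, abs_div, abs_of_pos (pow_pos h1 s), div_le_iff₀ (pow_pos h1 s), mul_comm (spectralError n K)]
  exact h

theorem survival_center_le {n K s : ℕ} (hn : 2 ≤ n) (hs : n ^ 2 * K ≤ s) :
    (killedStep n)^[s] (interiorInd n) n ≤ Real.cos (freq n) ^ s * (2 + spectralError n K) := by
  have h1 := cos_freq_pos hn
  have h2 := (abs_le.1 (abs_survival_center_sub_le hn hs)).2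
  have h3 := (abs_le.1 (abs_sineCoeff_le (n := n) (by omega) (interiorInd_abs_le n) 1)).2
  rw [mul_comm, ← div_le_iff₀ (pow_pos h1 s)]
  linarith

/-- In the last `n ^ 2 * K` steps the tilt may be ignored. -/
theorem norm_sum_tiltedStep_sub_le_spectralError {n x K s : ℕ} (hx : 1 ≤ x) (hxn : x < n)
    (hK : 2 ≤ K) (hs : n ^ 2 * K ≤ s) {z : ℂ} (hz : ‖z‖ = 1) :
    ‖∑ v ∈ Ioo (0 : ℤ) (2 * n), (tiltedStep n x z)^[s + n ^ 2 * K] (Pi.single (n : ℤ) 1) v -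
      ∑ v ∈ Ioo (0 : ℤ) (2 * n), (tiltedStep n x z)^[s] (Pi.single (n : ℤ) 1) v *
        ((killedStep n)^[n ^ 2 * K] (interiorInd n) v : ℝ)‖ ≤
      Real.cos (freq n) ^ (s + n ^ 2 * K) *
        (2 * Real.pi ^ 2 * Real.exp 5 * x ^ 2 * (K * spectralError n K)) := by
  have hn : 2 ≤ n := by omega
  have hn0 : (0 : ℝ) < n := by exact_mod_cast (show 0 < n by omega)
  have hK2 : (2 : ℝ) ≤ K := by exact_mod_cast hK
  have hK0 : (0 : ℝ) < K := by linarith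
  have hxI : (x : ℤ) ∈ Ioo (0 : ℤ) (2 * n) := by rw [Finset.mem_Ioo]; omega
  have hnI : (n : ℤ) ∈ Ioo (0 : ℤ) (2 * n) := by rw [Finset.mem_Ioo]; omega
  have hc := cos_freq_pos hn
  have hc1 := Real.cos_le_one (freq n)
  have hθ := freq_pos (n := n) (by omega)
  have hB := spectralError_nonneg n K
  set B := spectralError n K
  set lam := Real.cos (freq n)
  set m := n ^ 2 * K with hm
  have hterm : ∀ r ∈ range m, 2 * (killedStep n)^[s + m - r] (Pi.single (n : ℤ) (1 : ℝ)) x *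
        (killedStep n)^[r] (interiorInd n) x ≤
      lam ^ (s + m) * (2 * (freq n * x * B)) *
        ((killedStep n)^[r] (interiorInd n) x / lam ^ (r + 1)) := by
    intro r hr
    rw [Finset.mem_range] at hr
    have h1 := killedStep_single_le_spectralError (K := K) (s := s + m - r) hn (by omega) hnI hxI
    have h2 : 0 ≤ (killedStep n)^[r] (interiorInd n) x :=
      killedStep_iterate_nonneg (interiorInd_nonneg n) r x
    have h3 : lam ^ (s + m - r) ≤ lam ^ (s + m) / lam ^ (r + 1) := by
      rw [le_div_iff₀ (pow_pos hc _), ← pow_add]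
      exact pow_le_pow_of_le_one hc.le hc1 (by omega)
    calc _ ≤ 2 * (lam ^ (s + m) / lam ^ (r + 1) * (freq n * x * B)) *
          (killedStep n)^[r] (interiorInd n) x := by
          gcongr
          exact h1.trans (by gcongr)
      _ = _ := by ring
  refine (norm_sum_tiltedStep_sub_le hz hnI hxI s m).trans ((sum_le_sum hterm).trans ?_)
  rw [← mul_sum]
  have hsum := sum_survival_div_le hx hxn (δ := 1 / K) (by positivity)
    (one_div_le_one_div_of_le (by norm_num) hK2) m
  have h5 : 5 * (1 / (K : ℝ)) * m / n ^ 2 = 5 := by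
    rw [hm]; push_cast; field_simp
  rw [h5] at hsum
  calc _ ≤ lam ^ (s + m) * (2 * (freq n * x * B)) *
        (Real.exp 5 * (2 * Real.pi * x * n / (1 / K))) := by gcongr
    _ = _ := by rw [freq]; field_simp

/-- Quantitative spectral approximation of the tilted mass by a perturbed eigenfunction. -/
theorem norm_sum_tiltedStep_div_sub_le {n x K s : ℕ} (hx : 1 ≤ x) (hxn : x < n)
    (hK : 2 ≤ K) (hs : n ^ 2 * K ≤ s) {z : ℂ} (hz : ‖z‖ = 1) {g : ℤ → ℂ} {c d : ℂ} {D M : ℝ}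
    (hg0 : SupportedIn n g)
    (hg : ∀ v ∈ Ioo (0 : ℤ) (2 * n), killedStep n g v =
      c * (if v = x then g v / z else g v) + if v = x then d else 0)
    (hD : ∀ v ∈ Ioo (0 : ℤ) (2 * n),
      ‖(Real.sin (freq n * v) : ℂ) - (if v = x then g v / z else g v)‖ ≤ D)
    (hM : ∀ i ≤ s, (‖c‖ / Real.cos (freq n)) ^ i ≤ M) :
    ‖(∑ v ∈ Ioo (0 : ℤ) (2 * n), (tiltedStep n x z)^[s + n ^ 2 * K] (Pi.single (n : ℤ) 1) v) /
        (Real.cos (freq n) : ℂ) ^ (s + n ^ 2 * K) -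
      sineCoeff n (interiorInd n) 1 * ((c / Real.cos (freq n)) ^ s * g n)‖ ≤
      2 * Real.pi ^ 2 * Real.exp 5 * x ^ 2 * (K * spectralError n K) +
        (2 + spectralError n K) * spectralError n K + 2 * ((2 + spectralError n K) * D) +
        2 * (‖d‖ * (M * (Real.exp (5 * s / n ^ 3) * (Real.pi * x * n / 2)))) := by
  have hn : 2 ≤ n := by omega
  have hn0 : (0 : ℝ) < n := by exact_mod_cast (show 0 < n by omega)
  have hn2 : (2 : ℝ) ≤ n := by exact_mod_cast hn
  have hxI : (x : ℤ) ∈ Ioo (0 : ℤ) (2 * n) := by rw [Finset.mem_Ioo]; omega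
  have hnI : (n : ℤ) ∈ Ioo (0 : ℤ) (2 * n) := by rw [Finset.mem_Ioo]; omega
  have hc := cos_freq_pos hn
  have hB := spectralError_nonneg n K
  have hE1 := norm_sum_tiltedStep_sub_le_spectralError hx hxn hK hs hz
  have hQ := survival_center_le hn hs
  have hsc := (abs_le.1 (abs_sineCoeff_le (n := n) (by omega) (interiorInd_abs_le n) 1)).2
  have hsc0 : 0 ≤ sineCoeff n (interiorInd n) 1 := by
    have := half_le_sineCoeff_interiorInd hn; linarith
  set B := spectralError n K
  set lam := Real.cos (freq n)
  set σ := sineCoeff n (interiorInd n) 1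
  set m := n ^ 2 * K with hm
  set g' : ℤ → ℂ := fun v => if v = x then g v / z else g v with hg'
  set μ := (tiltedStep n x z)^[s] (Pi.single (n : ℤ) 1) with hμ
  have hD0 : 0 ≤ D := (norm_nonneg _).trans (hD _ hnI)
  have hls := pow_pos hc s
  have hlm := pow_pos hc m
  have hE2 : ‖∑ v ∈ Ioo (0 : ℤ) (2 * n), μ v * (((killedStep n)^[m] (interiorInd n) v : ℝ) -
      (σ * lam ^ m * Real.sin (freq n * v) : ℝ))‖ ≤ lam ^ (s + m) * ((2 + B) * B) := by
    refine (norm_sum_tiltedStep_mul_le hz hnI (D := lam ^ m * B) (fun v hv => ?_) s).trans ?_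
    · rw [← Complex.ofReal_sub, Complex.norm_real]
      exact abs_survival_sub_le_spectralError hn le_rfl hv
    · calc _ ≤ lam ^ s * (2 + B) * (lam ^ m * B) := by gcongr
        _ = _ := by rw [pow_add]; ring
  have hE3 : ‖∑ v ∈ Ioo (0 : ℤ) (2 * n), μ v * ((Real.sin (freq n * v) : ℂ) - g' v)‖ ≤
      lam ^ s * ((2 + B) * D) := by
    refine (norm_sum_tiltedStep_mul_le hz hnI hD s).trans ?_
    calc _ ≤ lam ^ s * (2 + B) * D := by gcongr
      _ = _ := by ring
  have hE4 : ‖∑ v ∈ Ioo (0 : ℤ) (2 * n), μ v * g' v - c ^ s * g n‖ ≤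
      lam ^ s * (‖d‖ * (M * (Real.exp (5 * s / n ^ 3) * (Real.pi * x * n / 2)))) := by
    refine (norm_sum_tiltedStep_mul_sub_le hz hnI hxI (by omega) hg0 hg s).trans ?_
    have hsum := sum_killedStep_single_div_le hx hxn (δ := 1 / n) (by positivity)
      (one_div_le_one_div_of_le (by norm_num) hn2) s
    have h5 : 5 * (1 / (n : ℝ)) * s / n ^ 2 = 5 * s / n ^ 3 := by field_simp
    have h6 : Real.pi * x / (2 * (1 / n)) = Real.pi * x * n / 2 := by field_simp
    rw [h5, h6] at hsum
    have hM0 : 0 ≤ M := (hM 0 (Nat.zero_le _)).trans' (by simp)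
    calc _ ≤ ‖d‖ * (lam ^ s * (M * ∑ j ∈ range s,
            (killedStep n)^[j] (Pi.single (n : ℤ) (1 : ℝ)) x / lam ^ (j + 1))) := by
          gcongr
          rw [mul_sum, mul_sum]
          refine sum_le_sum fun j hj => ?_
          rw [Finset.mem_range] at hj
          have h7 : 0 ≤ (killedStep n)^[j] (Pi.single (n : ℤ) (1 : ℝ)) x :=
            killedStep_iterate_nonneg (fun v => by
              rw [Pi.single_apply]; split_ifs <;> norm_num) j x
          have h8 : lam ^ s = lam ^ (s - 1 - j) * lam ^ (j + 1) := by
            rw [← pow_add]; congr 1; omega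
          calc ‖c‖ ^ (s - 1 - j) * (killedStep n)^[j] (Pi.single (n : ℤ) (1 : ℝ)) x
              = lam ^ s * ((‖c‖ / lam) ^ (s - 1 - j) *
                ((killedStep n)^[j] (Pi.single (n : ℤ) (1 : ℝ)) x / lam ^ (j + 1))) := by
                rw [h8, div_pow]; field_simp
            _ ≤ _ := by
                gcongr
                exact hM _ (by omega)
      _ = lam ^ s * (‖d‖ * (M * ∑ j ∈ range s,
            (killedStep n)^[j] (Pi.single (n : ℤ) (1 : ℝ)) x / lam ^ (j + 1))) := by ring
      _ ≤ _ := by gcongr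
  have hlamC : (lam : ℂ) ≠ 0 := by exact_mod_cast hc.ne'
  set T := ∑ v ∈ Ioo (0 : ℤ) (2 * n), (tiltedStep n x z)^[s + m] (Pi.single (n : ℤ) 1) v
  have hsplit : T / (lam : ℂ) ^ (s + m) - σ * ((c / lam) ^ s * g n) =
      ((T - ∑ v ∈ Ioo (0 : ℤ) (2 * n), μ v * ((killedStep n)^[m] (interiorInd n) v : ℝ)) +
        (∑ v ∈ Ioo (0 : ℤ) (2 * n), μ v * (((killedStep n)^[m] (interiorInd n) v : ℝ) -
          (σ * lam ^ m * Real.sin (freq n * v) : ℝ)))) / (lam : ℂ) ^ (s + m) +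
      σ * ((∑ v ∈ Ioo (0 : ℤ) (2 * n), μ v * ((Real.sin (freq n * v) : ℂ) - g' v)) +
        (∑ v ∈ Ioo (0 : ℤ) (2 * n), μ v * g' v - c ^ s * g n)) / (lam : ℂ) ^ s := by
    have e1 : ∑ v ∈ Ioo (0 : ℤ) (2 * n), μ v * (((killedStep n)^[m] (interiorInd n) v : ℝ) -
          (σ * lam ^ m * Real.sin (freq n * v) : ℝ)) =
        ∑ v ∈ Ioo (0 : ℤ) (2 * n), μ v * ((killedStep n)^[m] (interiorInd n) v : ℝ) -
          σ * lam ^ m * ∑ v ∈ Ioo (0 : ℤ) (2 * n), μ v * (Real.sin (freq n * v) : ℂ) := by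
      rw [mul_sum, ← sum_sub_distrib]
      refine sum_congr rfl fun v _ => ?_
      push_cast
      ring
    have e2 : ∑ v ∈ Ioo (0 : ℤ) (2 * n), μ v * ((Real.sin (freq n * v) : ℂ) - g' v) =
        ∑ v ∈ Ioo (0 : ℤ) (2 * n), μ v * (Real.sin (freq n * v) : ℂ) -
          ∑ v ∈ Ioo (0 : ℤ) (2 * n), μ v * g' v := by
      rw [← sum_sub_distrib]
      exact sum_congr rfl fun v _ => by ring
    rw [e1, e2, pow_add, div_pow]
    field_simp
    ring
  rw [hsplit]
  have hA : ‖((T - ∑ v ∈ Ioo (0 : ℤ) (2 * n), μ v * ((killedStep n)^[m] (interiorInd n) v : ℝ)) +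
        (∑ v ∈ Ioo (0 : ℤ) (2 * n), μ v * (((killedStep n)^[m] (interiorInd n) v : ℝ) -
          (σ * lam ^ m * Real.sin (freq n * v) : ℝ)))) / (lam : ℂ) ^ (s + m)‖ ≤
      2 * Real.pi ^ 2 * Real.exp 5 * x ^ 2 * (K * B) + (2 + B) * B := by
    rw [norm_div, norm_pow, Complex.norm_real, Real.norm_of_nonneg hc.le,
      div_le_iff₀ (pow_pos hc _)]
    refine (norm_add_le _ _).trans ((add_le_add hE1 hE2).trans (le_of_eq ?_))
    ring
  have hC : ‖σ * ((∑ v ∈ Ioo (0 : ℤ) (2 * n), μ v * ((Real.sin (freq n * v) : ℂ) - g' v)) +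
        (∑ v ∈ Ioo (0 : ℤ) (2 * n), μ v * g' v - c ^ s * g n)) / (lam : ℂ) ^ s‖ ≤
      2 * ((2 + B) * D) +
        2 * (‖d‖ * (M * (Real.exp (5 * s / n ^ 3) * (Real.pi * x * n / 2)))) := by
    rw [norm_div, norm_mul, norm_pow, Complex.norm_real, Complex.norm_real,
      Real.norm_of_nonneg hc.le, Real.norm_of_nonneg hsc0, div_le_iff₀ hls]
    have hsum := (norm_add_le _ _).trans (add_le_add hE3 hE4)
    refine (mul_le_mul hsc hsum (norm_nonneg _) (by norm_num)).trans (le_of_eq ?_)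
    ring
  refine (norm_add_le _ _).trans ((add_le_add hA hC).trans (le_of_eq ?_))
  ring

/-- Two-sided sine profile with angle `ϑ`, glued at `x` and vanishing at `0` and `2n`. -/
noncomputable def gluedSine (n x : ℕ) (ϑ : ℂ) (v : ℤ) : ℂ :=
  if v ≤ (x : ℤ) then
    Complex.sin (ϑ * (2 * n - x)) / Complex.sin (ϑ * x) * Complex.sin (ϑ * v)
  else Complex.sin (ϑ * (2 * n - v))

/-- The defect at `x` of `gluedSine` in the tilted eigenvalue equation. -/
noncomputable def gluedDefect (n x : ℕ) (z ϑ : ℂ) : ℂ :=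
  Complex.cos ϑ * Complex.sin (ϑ * (2 * n - x)) * (1 - 1 / z) -
    Complex.sin ϑ / Complex.sin (ϑ * x) * Complex.sin (2 * n * ϑ) / 2

theorem killedStep_gluedSine {n x : ℕ} (hxn : x < n) {z ϑ : ℂ} (hz : z ≠ 0)
    (hϑ : Complex.sin (ϑ * x) ≠ 0) {v : ℤ} (hv : v ∈ Ioo (0 : ℤ) (2 * n)) :
    killedStep n (truncate n (gluedSine n x ϑ)) v =
      Complex.cos ϑ * (if v = x then truncate n (gluedSine n x ϑ) v / z else
        truncate n (gluedSine n x ϑ) v) + if v = x then gluedDefect n x z ϑ else 0 := by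
  set L : ℤ → ℂ := fun v =>
    Complex.sin (ϑ * (2 * n - x)) / Complex.sin (ϑ * x) * Complex.sin (ϑ * v) with hL
  set R : ℤ → ℂ := fun v => Complex.sin (ϑ * (2 * n - v)) with hR
  have hLrec : ∀ v, (L (v - 1) + L (v + 1)) / 2 = Complex.cos ϑ * L v := fun v => by
    simp only [hL]
    push_cast
    rw [show ϑ * ((v : ℂ) - 1) = ϑ * v - ϑ by ring, show ϑ * ((v : ℂ) + 1) = ϑ * v + ϑ by ring,
      Complex.sin_sub, Complex.sin_add]
    ring
  have hRrec : ∀ v, (R (v - 1) + R (v + 1)) / 2 = Complex.cos ϑ * R v := fun v => by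
    simp only [hR]
    push_cast
    rw [show ϑ * (2 * n - ((v : ℂ) - 1)) = ϑ * (2 * n - v) + ϑ by ring,
      show ϑ * (2 * n - ((v : ℂ) + 1)) = ϑ * (2 * n - v) - ϑ by ring, Complex.sin_sub,
      Complex.sin_add]
    ring
  have hLR : L x = R x := by
    simp only [hL, hR]
    push_cast
    exact div_mul_cancel₀ _ hϑ
  have hkink : (R (x + 1) - L (x + 1)) / 2 =
      -(Complex.sin ϑ / Complex.sin (ϑ * x) * Complex.sin (2 * n * ϑ) / 2) := by
    simp only [hL, hR]
    push_cast
    rw [show ϑ * (2 * n - ((x : ℂ) + 1)) = ϑ * (2 * n - x) - ϑ by ring,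
      show ϑ * ((x : ℂ) + 1) = ϑ * x + ϑ by ring,
      show 2 * n * ϑ = ϑ * (2 * n - x) + ϑ * x by ring, Complex.sin_sub, Complex.sin_add,
      Complex.sin_add]
    field_simp
    ring
  have hglue : gluedSine n x ϑ = fun v : ℤ => if v ≤ (x : ℤ) then L v else R v := rfl
  have h0 : gluedSine n x ϑ 0 = 0 := by
    rw [gluedSine, if_pos (by omega)]; simp
  have h1 : gluedSine n x ϑ (2 * n) = 0 := by
    rw [gluedSine, if_neg (by omega)]; simp
  rw [killedStep_truncate h0 h1 hv, truncate, if_pos hv, hglue]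
  simp only
  rw [glue_recurrence hLrec hRrec hLR, hkink]
  by_cases hvx : v = x
  · subst hvx
    simp only [le_refl, if_true, hLR, gluedDefect]
    simp only [hR]
    push_cast
    field_simp
    ring
  · simp only [if_neg hvx]

theorem norm_sin_add_sub_sin_le (a : ℝ) {e : ℂ} (he : ‖e‖ ≤ 1) :
    ‖Complex.sin (a + e) - Complex.sin a‖ ≤ 2 * ‖e‖ := by
  have h1 : ‖Complex.exp (e * Complex.I) - 1‖ ≤ 2 * ‖e‖ := by
    have := Complex.norm_exp_sub_one_le (x := e * Complex.I) (by simpa using he)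
    simpa using this
  have h2 : ‖Complex.exp (-e * Complex.I) - 1‖ ≤ 2 * ‖e‖ := by
    have := Complex.norm_exp_sub_one_le (x := -e * Complex.I) (by simpa using he)
    simpa using this
  have h3 : Complex.sin (a + e) - Complex.sin a =
      (Complex.exp ((-a : ℝ) * Complex.I) * (Complex.exp (-e * Complex.I) - 1) -
        Complex.exp (a * Complex.I) * (Complex.exp (e * Complex.I) - 1)) * Complex.I / 2 := by
    rw [Complex.sin, Complex.sin, neg_add, add_mul, add_mul, Complex.exp_add, Complex.exp_add]
    push_cast
    ring
  rw [h3, norm_div, norm_mul, Complex.norm_I, mul_one, Complex.norm_two, div_le_iff₀ (by norm_num)]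
  refine (norm_sub_le _ _).trans ?_
  rw [norm_mul, norm_mul, Complex.norm_exp_ofReal_mul_I, Complex.norm_exp_ofReal_mul_I]
  linarith

/-- Uniform distance between the sine profile and the tilted profile. -/
theorem norm_sin_sub_gluedSine_le {n x : ℕ} (hxn : x < n) {z e : ℂ} (hz : ‖z‖ = 1)
    (he : 2 * n * ‖e‖ ≤ 1) (hθ : ‖freq n + e‖ * x ≤ 1) {v : ℤ} (hv : v ∈ Ioo (0 : ℤ) (2 * n)) :
    ‖(Real.sin (freq n * v) : ℂ) -
        (if v = x then truncate n (gluedSine n x (freq n + e)) v / z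
          else truncate n (gluedSine n x (freq n + e)) v)‖ ≤
      4 * n * ‖e‖ + (freq n * x +
        ‖Complex.sin ((freq n + e) * (2 * n - x)) / Complex.sin ((freq n + e) * x)‖ *
          (2 * (‖freq n + e‖ * x))) := by
  have hn : 0 < n := by omega
  have hfreq := freq_pos hn
  have hvI := hv
  rw [Finset.mem_Ioo] at hv
  have hv0 : (0 : ℝ) < v := by exact_mod_cast hv.1
  rw [truncate, if_pos hvI, gluedSine]
  by_cases hvx : v ≤ x
  · rw [if_pos hvx]
    have hvx' : (v : ℝ) ≤ x := by exact_mod_cast hvx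
    set r := Complex.sin ((freq n + e) * (2 * n - x)) / Complex.sin ((freq n + e) * x)
    have h1 : ‖(Real.sin (freq n * v) : ℂ)‖ ≤ freq n * x := by
      rw [Complex.norm_real, Real.norm_eq_abs]
      refine Real.abs_sin_le_abs.trans ?_
      rw [abs_of_pos (by positivity)]
      gcongr
    have h2 : ‖(freq n + e) * (v : ℂ)‖ ≤ ‖freq n + e‖ * x := by
      rw [norm_mul, Complex.norm_intCast, abs_of_pos hv0]
      gcongr
    have h3 : ‖Complex.sin ((freq n + e) * v)‖ ≤ 2 * (‖freq n + e‖ * x) := by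
      have := norm_sin_add_sub_sin_le 0 (e := (freq n + e) * v) (h2.trans hθ)
      simp only [Complex.ofReal_zero, zero_add, Complex.sin_zero, sub_zero] at this
      linarith
    have h4 : ‖if v = x then r * Complex.sin ((freq n + e) * v) / z
        else r * Complex.sin ((freq n + e) * v)‖ ≤ ‖r‖ * (2 * (‖freq n + e‖ * x)) := by
      split_ifs
      · rw [norm_div, hz, div_one, norm_mul]
        gcongr
      · rw [norm_mul]
        gcongr
    have h5 : 0 ≤ 4 * n * ‖e‖ := by positivity
    refine (norm_sub_le _ _).trans ((add_le_add h1 h4).trans ?_)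
    linarith
  · rw [if_neg hvx, if_neg (by omega)]
    have hv1 : (v : ℝ) < 2 * n := by exact_mod_cast hv.2
    have h1 : Real.sin (freq n * v) = Real.sin (freq n * (2 * n - v)) := by
      rw [← Real.sin_pi_sub]
      congr 1
      have := two_mul_freq hn
      linarith
    have h2 : ‖e * (2 * n - v)‖ ≤ 2 * n * ‖e‖ := by
      rw [norm_mul, show (2 * n - v : ℂ) = ((2 * n - v : ℝ) : ℂ) by push_cast; ring,
        Complex.norm_real, Real.norm_of_nonneg (by linarith), mul_comm]
      gcongr
      linarith
    have h3 := norm_sin_add_sub_sin_le (freq n * (2 * n - v)) (h2.trans he)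
    rw [h1, norm_sub_rev, show (freq n + e) * (2 * n - v : ℂ) =
      (freq n * (2 * n - v) : ℝ) + e * (2 * n - v) by push_cast; ring, Complex.ofReal_sin]
    have h5 : 0 ≤ freq n * x +
        ‖Complex.sin ((freq n + e) * (2 * n - x)) / Complex.sin ((freq n + e) * x)‖ *
          (2 * (‖freq n + e‖ * x)) := by positivity
    linarith

theorem tendsto_mul_comp_of_hasDerivAt {f : ℂ → ℂ} (hf : HasDerivAt f 1 0) (hf0 : f 0 = 0)
    {b w : ℕ → ℂ} {l : ℂ} (hw : Tendsto w atTop (𝓝 0))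
    (h : Tendsto (fun n => b n * w n) atTop (𝓝 l)) :
    Tendsto (fun n => b n * f (w n)) atTop (𝓝 l) := by
  have h1 : Tendsto (fun n => dslope f 0 (w n)) atTop (𝓝 1) := by
    have := (continuousAt_dslope_same.2 hf.differentiableAt).tendsto.comp hw
    rwa [dslope_same, hf.deriv] at this
  have h2 := h.mul h1
  rw [mul_one] at h2
  refine h2.congr fun n => ?_
  have := sub_smul_dslope f 0 (w n)
  rw [hf0, sub_zero, sub_zero, smul_eq_mul] at this
  rw [mul_assoc, this]

theorem tendsto_mul_sin {b w : ℕ → ℂ} {l : ℂ} (hw : Tendsto w atTop (𝓝 0))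
    (h : Tendsto (fun n => b n * w n) atTop (𝓝 l)) :
    Tendsto (fun n => b n * Complex.sin (w n)) atTop (𝓝 l) :=
  tendsto_mul_comp_of_hasDerivAt (by simpa using Complex.hasDerivAt_sin 0) Complex.sin_zero hw h

theorem tendsto_one_add_pow {s : ℕ → ℕ} {a : ℕ → ℂ} {l : ℂ} (ha : Tendsto a atTop (𝓝 0))
    (h : Tendsto (fun n => (s n : ℂ) * a n) atTop (𝓝 l)) :
    Tendsto (fun n => (1 + a n) ^ s n) atTop (𝓝 (Complex.exp l)) := by
  have hlog : HasDerivAt (fun w : ℂ => Complex.log (1 + w)) 1 0 := by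
    simpa using ((hasDerivAt_id (0 : ℂ)).const_add 1).clog (by simp)
  have h1 := (Complex.continuous_exp.tendsto _).comp
    (tendsto_mul_comp_of_hasDerivAt hlog (by simp) ha h)
  refine h1.congr' ?_
  filter_upwards [ha.eventually_ne (show (0 : ℂ) ≠ -1 by simp)] with n hn
  have hne : 1 + a n ≠ 0 := fun h0 => hn (by linear_combination h0)
  simp only [Function.comp]
  rw [Complex.exp_nat_mul, Complex.exp_log hne]

theorem tendsto_natCast_inv : Tendsto (fun n : ℕ => ((n : ℂ))⁻¹) atTop (𝓝 0) :=
  tendsto_inv_atTop_nhds_zero_nat (𝕜 := ℂ)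

theorem tendsto_zero_of_natCast_mul {w : ℕ → ℂ} {l : ℂ}
    (h : Tendsto (fun n : ℕ => (n : ℂ) * w n) atTop (𝓝 l)) : Tendsto w atTop (𝓝 0) := by
  have h1 := tendsto_natCast_inv.mul h
  rw [zero_mul] at h1
  refine h1.congr' ?_
  filter_upwards [eventually_gt_atTop 0] with n hn
  have : (n : ℂ) ≠ 0 := by exact_mod_cast hn.ne'
  field_simp

theorem tendsto_natCast_mul_sin {w : ℕ → ℂ} {l : ℂ}
    (h : Tendsto (fun n : ℕ => (n : ℂ) * w n) atTop (𝓝 l)) :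
    Tendsto (fun n : ℕ => (n : ℂ) * Complex.sin (w n)) atTop (𝓝 l) :=
  tendsto_mul_sin (tendsto_zero_of_natCast_mul h) h

/-- The frequency `π / (2n)` perturbed at second order. -/
noncomputable def tiltedFreq (y : ℂ) (n : ℕ) : ℂ := freq n + Real.pi * y / (4 * n ^ 2)

theorem two_mul_tiltedFreq (y : ℂ) {n : ℕ} (hn : 0 < n) :
    2 * n * tiltedFreq y n = Real.pi + Real.pi * y / 2 * (n : ℂ)⁻¹ := by
  have : (n : ℂ) ≠ 0 := by exact_mod_cast hn.ne'
  rw [tiltedFreq, freq]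
  push_cast
  field_simp
  ring

theorem tendsto_natCast_mul_tiltedFreq (y : ℂ) :
    Tendsto (fun n : ℕ => (n : ℂ) * tiltedFreq y n) atTop (𝓝 (Real.pi / 2)) := by
  have h1 : Tendsto (fun n : ℕ => ((Real.pi : ℂ) + Real.pi * y / 2 * (n : ℂ)⁻¹) / 2) atTop
      (𝓝 ((Real.pi + Real.pi * y / 2 * 0) / 2)) :=
    ((tendsto_natCast_inv.const_mul _).const_add _).div_const 2
  rw [mul_zero, add_zero] at h1
  refine h1.congr' ?_
  filter_upwards [eventually_gt_atTop 0] with n hn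
  rw [← two_mul_tiltedFreq y hn]
  ring

theorem tendsto_tiltedFreq (y : ℂ) : Tendsto (tiltedFreq y) atTop (𝓝 0) :=
  tendsto_zero_of_natCast_mul (tendsto_natCast_mul_tiltedFreq y)

theorem tendsto_natCast_mul_sin_tiltedFreq_mul (y a : ℂ) :
    Tendsto (fun n : ℕ => (n : ℂ) * Complex.sin (tiltedFreq y n * a)) atTop
      (𝓝 (Real.pi / 2 * a)) := by
  refine tendsto_natCast_mul_sin (((tendsto_natCast_mul_tiltedFreq y).mul_const a).congr fun n => ?_)
  ring

theorem tendsto_natCast_mul_sin_two_mul_tiltedFreq (y : ℂ) :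
    Tendsto (fun n : ℕ => (n : ℂ) * Complex.sin (2 * n * tiltedFreq y n)) atTop
      (𝓝 (-(Real.pi * y / 2))) := by
  have h1 : Tendsto (fun n : ℕ => (n : ℂ) * (Real.pi * y / 2 * (n : ℂ)⁻¹)) atTop
      (𝓝 (Real.pi * y / 2)) := by
    refine tendsto_const_nhds.congr' ?_
    filter_upwards [eventually_gt_atTop 0] with n hn
    have : (n : ℂ) ≠ 0 := by exact_mod_cast hn.ne'
    field_simp
  refine (tendsto_natCast_mul_sin h1).neg.congr' ?_
  filter_upwards [eventually_gt_atTop 0] with n hn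
  rw [two_mul_tiltedFreq y hn, add_comm, Complex.sin_add_pi]
  ring

theorem tendsto_natCast_mul_sin_tiltedFreq_sub (y : ℂ) (x : ℕ) :
    Tendsto (fun n : ℕ => (n : ℂ) * Complex.sin (tiltedFreq y n * (2 * n - x))) atTop
      (𝓝 (-(Real.pi / 2 * (y - x)))) := by
  have h1 : Tendsto (fun n : ℕ => (n : ℂ) * (Real.pi * y / 2 * (n : ℂ)⁻¹ - tiltedFreq y n * x))
      atTop (𝓝 (Real.pi / 2 * (y - x))) := by
    have h2 := ((tendsto_natCast_mul_tiltedFreq y).mul_const (x : ℂ)).const_sub (Real.pi * y / 2)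
    rw [show (Real.pi : ℂ) * y / 2 - Real.pi / 2 * x = Real.pi / 2 * (y - x) by ring] at h2
    refine h2.congr' ?_
    filter_upwards [eventually_gt_atTop 0] with n hn
    have : (n : ℂ) ≠ 0 := by exact_mod_cast hn.ne'
    field_simp
  refine (tendsto_natCast_mul_sin h1).neg.congr' ?_
  filter_upwards [eventually_gt_atTop 0] with n hn
  rw [show tiltedFreq y n * (2 * n - x) = 2 * n * tiltedFreq y n - tiltedFreq y n * x by ring,
    two_mul_tiltedFreq y hn, show (Real.pi : ℂ) + Real.pi * y / 2 * (n : ℂ)⁻¹ - tiltedFreq y n * x =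
      Real.pi * y / 2 * (n : ℂ)⁻¹ - tiltedFreq y n * x + Real.pi by ring, Complex.sin_add_pi]
  ring

theorem eventually_sin_tiltedFreq_mul_ne_zero (y : ℂ) {x : ℕ} (hx : 1 ≤ x) :
    ∀ᶠ n in atTop, Complex.sin (tiltedFreq y n * x) ≠ 0 := by
  have hne : (Real.pi / 2 * x : ℂ) ≠ 0 := by
    have := Real.pi_ne_zero
    have : (x : ℂ) ≠ 0 := by exact_mod_cast (show x ≠ 0 by omega)
    simp_all
  filter_upwards [(tendsto_natCast_mul_sin_tiltedFreq_mul y x).eventually_ne hne] with n hn h0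
  exact hn (by rw [h0, mul_zero])

theorem tendsto_sin_div_sin_tiltedFreq (y : ℂ) {x : ℕ} (hx : 1 ≤ x) {f : ℕ → ℂ} {l : ℂ}
    (hf : Tendsto (fun n : ℕ => (n : ℂ) * f n) atTop (𝓝 l)) :
    Tendsto (fun n => f n / Complex.sin (tiltedFreq y n * x)) atTop
      (𝓝 (l / (Real.pi / 2 * x))) := by
  have hne : (Real.pi / 2 * x : ℂ) ≠ 0 := by
    have := Real.pi_ne_zero
    have : (x : ℂ) ≠ 0 := by exact_mod_cast (show x ≠ 0 by omega)
    simp_all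
  refine (hf.div (tendsto_natCast_mul_sin_tiltedFreq_mul y x) hne).congr' ?_
  filter_upwards [eventually_gt_atTop 0] with n hn
  have : (n : ℂ) ≠ 0 := by exact_mod_cast hn.ne'
  exact mul_div_mul_left _ _ this

theorem tendsto_natCast_mul_gluedDefect {z y : ℂ} (hz : z ≠ 0) {x : ℕ} (hx : 1 ≤ x)
    (hy : y * (2 * x - (2 * x - 1) * z) = 2 * x ^ 2 * (1 - z)) :
    Tendsto (fun n : ℕ => (n : ℂ) * gluedDefect n x z (tiltedFreq y n)) atTop (𝓝 0) := by
  have hpi : (Real.pi : ℂ) ≠ 0 := by exact_mod_cast Real.pi_ne_zero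
  have hx0 : (x : ℂ) ≠ 0 := by exact_mod_cast (show x ≠ 0 by omega)
  have hcos : Tendsto (fun n => Complex.cos (tiltedFreq y n)) atTop (𝓝 1) := by
    have := (Complex.continuous_cos.tendsto 0).comp (tendsto_tiltedFreq y)
    rwa [Complex.cos_zero] at this
  have h1 := (hcos.mul (tendsto_natCast_mul_sin_tiltedFreq_sub y x)).mul_const (1 - 1 / z)
  have h2 := tendsto_sin_div_sin_tiltedFreq y hx (f := fun n => Complex.sin (tiltedFreq y n))
    (by simpa using tendsto_natCast_mul_sin_tiltedFreq_mul y 1)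
  have h3 := h1.sub ((h2.mul (tendsto_natCast_mul_sin_two_mul_tiltedFreq y)).div_const 2)
  have h4 : (1 : ℂ) * -(Real.pi / 2 * (y - x)) * (1 - 1 / z) -
      Real.pi / 2 / (Real.pi / 2 * x) * -(Real.pi * y / 2) / 2 = 0 := by
    field_simp
    linear_combination Real.pi * hy
  rw [h4] at h3
  refine h3.congr fun n => ?_
  rw [gluedDefect]
  ring

theorem tendsto_freq : Tendsto freq atTop (𝓝 0) := by
  have h := (tendsto_inv_atTop_nhds_zero_nat (𝕜 := ℝ)).const_mul (Real.pi / 2)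
  rw [mul_zero] at h
  refine h.congr fun n => ?_
  rw [freq]
  field_simp

theorem tendsto_cos_freq : Tendsto (fun n => Real.cos (freq n)) atTop (𝓝 1) := by
  have := (Real.continuous_cos.tendsto 0).comp tendsto_freq
  rwa [Real.cos_zero] at this

theorem tendsto_cube_mul_eigenvalue_sub_one (y : ℂ) :
    Tendsto (fun n : ℕ => (n : ℂ) ^ 3 *
      (Complex.cos (tiltedFreq y n) / Real.cos (freq n) - 1)) atTop
      (𝓝 (-(Real.pi ^ 2 * y / 8))) := by
  have hinv : Tendsto (fun n : ℕ => (((n : ℂ))⁻¹) ^ 2) atTop (𝓝 0) := by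
    simpa using tendsto_natCast_inv.pow 2
  have h1 : Tendsto (fun n : ℕ => (n : ℂ) * ((tiltedFreq y n + tiltedFreq 0 n) / 2)) atTop
      (𝓝 (Real.pi / 2)) := by
    have := ((tendsto_natCast_mul_tiltedFreq y).add (tendsto_natCast_mul_tiltedFreq 0)).div_const 2
    rw [show ((Real.pi : ℂ) / 2 + Real.pi / 2) / 2 = Real.pi / 2 by ring] at this
    exact this.congr fun n => by ring
  have h2 : Tendsto (fun n : ℕ => (n : ℂ) ^ 2 * (Real.pi * y / 8 * ((n : ℂ)⁻¹) ^ 2)) atTop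
      (𝓝 (Real.pi * y / 8)) := by
    refine tendsto_const_nhds.congr' ?_
    filter_upwards [eventually_gt_atTop 0] with n hn
    have : (n : ℂ) ≠ 0 := by exact_mod_cast hn.ne'
    field_simp
  have h2' : Tendsto (fun n : ℕ => Real.pi * y / 8 * ((n : ℂ)⁻¹) ^ 2) atTop (𝓝 0) := by
    simpa using hinv.const_mul (Real.pi * y / 8)
  have hcos : Tendsto (fun n => (Real.cos (freq n) : ℂ)) atTop (𝓝 1) := by
    exact_mod_cast (Complex.continuous_ofReal.tendsto 1).comp tendsto_cos_freq
  have h3 := (((tendsto_natCast_mul_sin h1).mul (tendsto_mul_sin h2' h2)).const_mul (-2)).div hcos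
    one_ne_zero
  rw [show -2 * ((Real.pi : ℂ) / 2 * (Real.pi * y / 8)) / 1 = -(Real.pi ^ 2 * y / 8) by ring] at h3
  refine h3.congr' ?_
  filter_upwards [eventually_ge_atTop 2] with n hn
  have hc : (Real.cos (freq n) : ℂ) ≠ 0 := by exact_mod_cast (cos_freq_pos hn).ne'
  have h0 : tiltedFreq 0 n = freq n := by simp [tiltedFreq]
  have e1 : (tiltedFreq y n - freq n) / 2 = Real.pi * y / 8 * ((n : ℂ)⁻¹) ^ 2 := by
    have : (n : ℂ) ≠ 0 := by exact_mod_cast (show n ≠ 0 by omega)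
    rw [tiltedFreq]
    field_simp
    ring
  have e2 := Complex.cos_sub_cos (tiltedFreq y n) (freq n)
  rw [e1] at e2
  simp only [Pi.div_apply]
  rw [h0, div_sub_one hc, Complex.ofReal_cos, e2]
  ring

theorem tendsto_nat_sqrt_atTop : Tendsto Nat.sqrt atTop atTop :=
  tendsto_atTop_atTop.2 fun b => ⟨b * b, fun _ hn => Nat.le_sqrt.2 hn⟩

theorem tendsto_sqrt_mul_spectralError :
    Tendsto (fun n : ℕ => (Nat.sqrt n : ℝ) * spectralError n (Nat.sqrt n)) atTop (𝓝 0) := by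
  have hbound : Tendsto (fun k : ℕ => 2 * ((k : ℝ))⁻¹ + 256 * Real.exp (1 / 2) *
      ((((k : ℝ) + 1) / 2) ^ 5 * Real.exp (-(((k : ℝ) + 1) / 2)))) atTop (𝓝 0) := by
    have h1 := (tendsto_inv_atTop_nhds_zero_nat (𝕜 := ℝ)).const_mul 2
    have h2 : Tendsto (fun k : ℕ => ((k : ℝ) + 1) / 2) atTop atTop :=
      (tendsto_atTop_add_const_right _ 1 tendsto_natCast_atTop_atTop).atTop_div_const (by norm_num)
    have h3 := ((Real.tendsto_pow_mul_exp_neg_atTop_nhds_zero 5).comp h2).const_mul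
      (256 * Real.exp (1 / 2))
    simpa using h1.add h3
  refine squeeze_zero' (Eventually.of_forall fun n =>
    mul_nonneg (Nat.cast_nonneg _) (spectralError_nonneg _ _)) ?_
    (hbound.comp tendsto_nat_sqrt_atTop)
  filter_upwards [eventually_gt_atTop 0] with n hn
  have hn0 : (0 : ℝ) < n := by exact_mod_cast hn
  simp only [Function.comp]
  have hk1 : (Nat.sqrt n : ℝ) ^ 2 ≤ n := by exact_mod_cast Nat.sqrt_le' n
  have hk2 : (n : ℝ) ≤ ((Nat.sqrt n : ℝ) + 1) ^ 2 := by
    exact_mod_cast (Nat.lt_succ_sqrt' n).le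
  have hk0 : (0 : ℝ) < Nat.sqrt n := by exact_mod_cast Nat.sqrt_pos.2 hn
  set k : ℝ := (Nat.sqrt n : ℝ)
  have e1 : Real.exp (-k / 2) = Real.exp (1 / 2) * Real.exp (-((k + 1) / 2)) := by
    rw [← Real.exp_add]; congr 1; ring
  have e2 : k * (2 / n) ≤ 2 * k⁻¹ := by
    rw [← div_eq_mul_inv, mul_div_assoc', div_le_div_iff₀ hn0 hk0]
    nlinarith
  have e3 : k * (8 * (n : ℝ) ^ 2 * Real.exp (-k / 2)) ≤
      256 * Real.exp (1 / 2) * (((k + 1) / 2) ^ 5 * Real.exp (-((k + 1) / 2))) := by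
    rw [e1]
    calc k * (8 * (n : ℝ) ^ 2 * (Real.exp (1 / 2) * Real.exp (-((k + 1) / 2))))
        ≤ (k + 1) * (8 * ((k + 1) ^ 2) ^ 2 *
          (Real.exp (1 / 2) * Real.exp (-((k + 1) / 2)))) := by
          gcongr
          linarith
      _ = _ := by ring
  rw [spectralError, mul_add]
  exact add_le_add e2 e3

theorem tendsto_spectralError :
    Tendsto (fun n : ℕ => spectralError n (Nat.sqrt n)) atTop (𝓝 0) := by
  refine squeeze_zero' (Eventually.of_forall fun n => spectralError_nonneg _ _) ?_
    tendsto_sqrt_mul_spectralError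
  filter_upwards [eventually_gt_atTop 0] with n hn
  have h1 : (1 : ℝ) ≤ Nat.sqrt n := by exact_mod_cast Nat.sqrt_pos.2 hn
  exact le_mul_of_one_le_left (spectralError_nonneg _ _) h1

theorem tendsto_sqrt_div : Tendsto (fun n : ℕ => (Nat.sqrt n : ℝ) / n) atTop (𝓝 0) := by
  have h : Tendsto (fun n : ℕ => ((Nat.sqrt n : ℝ))⁻¹) atTop (𝓝 0) :=
    (tendsto_inv_atTop_nhds_zero_nat (𝕜 := ℝ)).comp tendsto_nat_sqrt_atTop
  refine squeeze_zero' (Eventually.of_forall fun n => by positivity) ?_ h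
  filter_upwards [eventually_gt_atTop 0] with n hn
  have hn0 : (0 : ℝ) < n := by exact_mod_cast hn
  have hk0 : (0 : ℝ) < Nat.sqrt n := by exact_mod_cast Nat.sqrt_pos.2 hn
  have hk1 : (Nat.sqrt n : ℝ) ^ 2 ≤ n := by exact_mod_cast Nat.sqrt_le' n
  rw [← one_div, div_le_div_iff₀ hn0 hk0]
  nlinarith

/-- Ratios of sequences sharing a common bounded factor. -/
theorem tendsto_div_of_sub_mul_tendsto_zero {a r : ℕ → ℂ} {c σ : ℕ → ℝ} {l : ℂ}
    (ha : Tendsto (fun n => a n - σ n * r n) atTop (𝓝 0)) (hr : Tendsto r atTop (𝓝 l))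
    (hc : Tendsto (fun n => c n - σ n) atTop (𝓝 0)) (hσ : ∀ᶠ n in atTop, σ n ∈ Set.Icc (1 / 2) 2) :
    Tendsto (fun n => a n / c n) atTop (𝓝 l) := by
  have hcC : Tendsto (fun n => ((c n - σ n : ℝ) : ℂ)) atTop (𝓝 0) := by
    exact_mod_cast (Complex.continuous_ofReal.tendsto 0).comp hc
  have h1 : Tendsto (fun n => (σ n : ℂ) * (r n - l)) atTop (𝓝 0) := by
    have h0 : Tendsto (fun n => r n - l) atTop (𝓝 0) := by simpa using hr.sub_const l
    refine isBoundedUnder_le_mul_tendsto_zero ⟨2, ?_⟩ h0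
    rw [eventually_map]
    filter_upwards [hσ] with n hn
    simp only [Function.comp, Complex.norm_real, Real.norm_eq_abs]
    rw [abs_le]
    constructor <;> linarith [hn.1, hn.2]
  have h2 : Tendsto (fun n => a n - l * c n) atTop (𝓝 0) := by
    have := (ha.add h1).sub (hcC.const_mul l)
    rw [mul_zero, sub_zero, add_zero] at this
    refine this.congr fun n => ?_
    push_cast
    ring
  have hc4 : ∀ᶠ n in atTop, 1 / 4 < c n := by
    filter_upwards [hσ, hc.eventually_const_lt (show -(1 / 4) < (0 : ℝ) by norm_num)] with n hn hn'
    linarith [hn.1]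
  have h3 : Tendsto (fun n => ((c n : ℂ))⁻¹ * (a n - l * c n)) atTop (𝓝 0) := by
    refine isBoundedUnder_le_mul_tendsto_zero ⟨4, ?_⟩ h2
    rw [eventually_map]
    filter_upwards [hc4] with n hn
    simp only [Function.comp, norm_inv, Complex.norm_real, Real.norm_eq_abs]
    rw [abs_of_pos (by linarith), inv_le_comm₀ (by linarith) (by norm_num)]
    linarith
  have h4 := h3.const_add l
  rw [add_zero] at h4
  refine h4.congr' ?_
  filter_upwards [hc4] with n hn
  have : (c n : ℂ) ≠ 0 := by exact_mod_cast (show c n ≠ 0 by linarith)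
  field_simp
  ring

theorem tendsto_killedStep_center_sub_sineCoeff {t : ℕ → ℕ}
    (ht : ∀ᶠ n in atTop, n ^ 2 * Nat.sqrt n ≤ t n) :
    Tendsto (fun n : ℕ => (killedStep n)^[t n] (interiorInd n) n / Real.cos (freq n) ^ t n -
      sineCoeff n (interiorInd n) 1) atTop (𝓝 0) := by
  refine squeeze_zero_norm' ?_ tendsto_spectralError
  filter_upwards [ht, eventually_ge_atTop 2] with n h1 h2
  exact abs_survival_center_sub_le h2 h1

/-- The perturbed dominant eigenvalue and eigenfunction give the tilted mass. -/
theorem tendsto_sum_tiltedStep_div_sub {x : ℕ} (hx : 1 ≤ x) {z y : ℂ} (hz : ‖z‖ = 1)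
    (hy : y * (2 * x - (2 * x - 1) * z) = 2 * x ^ 2 * (1 - z)) {β : ℝ} {s : ℕ → ℕ}
    (hs : ∀ᶠ n in atTop, n ^ 2 * Nat.sqrt n ≤ s n)
    (hsβ : Tendsto (fun n : ℕ => (s n : ℝ) / (n : ℝ) ^ 3) atTop (𝓝 β)) :
    Tendsto (fun n : ℕ => (∑ v ∈ Ioo (0 : ℤ) (2 * n),
        (tiltedStep n x z)^[s n + n ^ 2 * Nat.sqrt n] (Pi.single (n : ℤ) 1) v) /
          (Real.cos (freq n) : ℂ) ^ (s n + n ^ 2 * Nat.sqrt n) -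
      sineCoeff n (interiorInd n) 1 *
        ((Complex.cos (tiltedFreq y n) / Real.cos (freq n)) ^ s n *
          Complex.sin (tiltedFreq y n * n))) atTop (𝓝 0) := by
  have hz0 : z ≠ 0 := by rintro rfl; simp at hz
  set e : ℕ → ℂ := fun n => tiltedFreq y n - freq n with he
  set a : ℕ → ℂ := fun n => Complex.cos (tiltedFreq y n) / Real.cos (freq n) - 1 with ha
  set r : ℕ → ℂ := fun n =>
    Complex.sin (tiltedFreq y n * (2 * n - x)) / Complex.sin (tiltedFreq y n * x) with hr
  have hne : Tendsto (fun n : ℕ => (n : ℝ) * ‖e n‖) atTop (𝓝 0) := by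
    have h1 := ((tendsto_natCast_mul_tiltedFreq y).sub (tendsto_natCast_mul_tiltedFreq 0)).norm
    rw [sub_self, norm_zero] at h1
    refine h1.congr fun n => ?_
    rw [← mul_sub, norm_mul, Complex.norm_natCast, he]
    simp [tiltedFreq]
  have hrlim : Tendsto (fun n => ‖r n‖) atTop (𝓝 _) :=
    (tendsto_sin_div_sin_tiltedFreq y hx (tendsto_natCast_mul_sin_tiltedFreq_sub y x)).norm
  have htf : Tendsto (fun n => ‖tiltedFreq y n‖) atTop (𝓝 0) := by
    simpa using (tendsto_tiltedFreq y).norm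
  have hD : Tendsto (fun n : ℕ => 4 * n * ‖e n‖ + (freq n * x + ‖r n‖ *
      (2 * (‖tiltedFreq y n‖ * x)))) atTop (𝓝 0) := by
    have h1 := (hne.const_mul 4).add ((tendsto_freq.mul_const (x : ℝ)).add
      (hrlim.mul ((htf.mul_const (x : ℝ)).const_mul 2)))
    simp only [mul_zero, zero_mul, add_zero] at h1
    exact h1.congr fun n => by ring
  have hd : Tendsto (fun n : ℕ => (n : ℝ) * ‖gluedDefect n x z (tiltedFreq y n)‖) atTop (𝓝 0) := by
    have h1 := (tendsto_natCast_mul_gluedDefect hz0 hx hy).norm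
    rw [norm_zero] at h1
    exact h1.congr fun n => by rw [norm_mul, Complex.norm_natCast]
  have hM : Tendsto (fun n => Real.exp (s n * ‖a n‖)) atTop
      (𝓝 (Real.exp (β * ‖-(Real.pi ^ 2 * y / 8)‖))) := by
    refine (Real.continuous_exp.tendsto _).comp ?_
    refine (hsβ.mul (tendsto_cube_mul_eigenvalue_sub_one y).norm).congr' ?_
    filter_upwards [eventually_gt_atTop 0] with n hn
    have hn0 : (n : ℝ) ≠ 0 := by exact_mod_cast hn.ne'
    rw [norm_mul, norm_pow, Complex.norm_natCast]
    field_simp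
    rfl
  have hexp : Tendsto (fun n : ℕ => Real.exp (5 * s n / n ^ 3)) atTop (𝓝 (Real.exp (5 * β))) := by
    refine (Real.continuous_exp.tendsto _).comp ((hsβ.const_mul 5).congr fun n => ?_)
    ring
  have hB := tendsto_spectralError
  have hE := (((tendsto_sqrt_mul_spectralError.const_mul
    (2 * Real.pi ^ 2 * Real.exp 5 * (x : ℝ) ^ 2)).add ((hB.const_add 2).mul hB)).add
      (((hB.const_add 2).mul hD).const_mul 2)).add
      (((hd.mul (hM.mul hexp)).mul_const (Real.pi * x / 2)).const_mul 2)
  simp only [mul_zero, zero_mul, add_zero] at hE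
  refine squeeze_zero_norm' ?_ hE
  have hK : ∀ᶠ n in atTop, 2 ≤ Nat.sqrt n := tendsto_nat_sqrt_atTop.eventually_ge_atTop 2
  have h2e : ∀ᶠ n : ℕ in atTop, (n : ℝ) * ‖e n‖ ≤ 1 / 2 :=
    (hne.eventually_lt_const (by norm_num)).mono fun _ h => h.le
  have htfx : ∀ᶠ n : ℕ in atTop, ‖tiltedFreq y n‖ * x ≤ 1 := by
    have h1 := htf.mul_const (x : ℝ)
    rw [zero_mul] at h1
    exact (h1.eventually_lt_const (by norm_num)).mono fun _ h => h.le
  filter_upwards [hs, hK, h2e, htfx, eventually_gt_atTop x,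
    eventually_sin_tiltedFreq_mul_ne_zero y hx] with n hsn hKn hen htn hxn hsin
  have hn : 2 ≤ n := by omega
  have hnI : (n : ℤ) ∈ Ioo (0 : ℤ) (2 * n) := by rw [Finset.mem_Ioo]; omega
  have hc := cos_freq_pos hn
  have hsum : (freq n : ℂ) + e n = tiltedFreq y n := by simp [he]
  have hDn : ∀ v ∈ Ioo (0 : ℤ) (2 * n), _ := fun v hv =>
    norm_sin_sub_gluedSine_le (e := e n) hxn hz (by linarith) (by rwa [hsum]) hv
  simp only [hsum] at hDn
  have hMn : ∀ i ≤ s n, (‖Complex.cos (tiltedFreq y n)‖ / Real.cos (freq n)) ^ i ≤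
      Real.exp (s n * ‖a n‖) := by
    intro i hi
    have h1 : ‖Complex.cos (tiltedFreq y n)‖ / Real.cos (freq n) ≤ Real.exp ‖a n‖ := by
      have h2 : ‖Complex.cos (tiltedFreq y n)‖ / Real.cos (freq n) = ‖a n + 1‖ := by
        rw [ha, sub_add_cancel, norm_div, Complex.norm_real, Real.norm_of_nonneg hc.le]
      rw [h2]
      refine (norm_add_le _ _).trans ?_
      rw [norm_one]
      exact Real.add_one_le_exp _
    calc _ ≤ Real.exp ‖a n‖ ^ i := by gcongr
      _ = Real.exp (i * ‖a n‖) := by rw [Real.exp_nat_mul]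
      _ ≤ _ := by gcongr
  have hmain := norm_sum_tiltedStep_div_sub_le hx hxn hKn hsn hz (supportedIn_truncate n _)
    (fun v hv => killedStep_gluedSine hxn hz0 hsin hv) hDn hMn
  have hgn : truncate n (gluedSine n x (tiltedFreq y n)) n =
      Complex.sin (tiltedFreq y n * n) := by
    rw [truncate, if_pos hnI, gluedSine, if_neg (by omega)]
    push_cast
    congr 1
    ring
  rw [hgn] at hmain
  refine hmain.trans (le_of_eq ?_)
  simp only [hr]
  ring

theorem tendsto_eigenvalue_pow (y : ℂ) {β : ℝ} {s : ℕ → ℕ}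
    (hsβ : Tendsto (fun n : ℕ => (s n : ℝ) / (n : ℝ) ^ 3) atTop (𝓝 β)) :
    Tendsto (fun n : ℕ => (Complex.cos (tiltedFreq y n) / Real.cos (freq n)) ^ s n *
      Complex.sin (tiltedFreq y n * n)) atTop
      (𝓝 (Complex.exp (β * -(Real.pi ^ 2 * y / 8)))) := by
  have h0 := tendsto_cube_mul_eigenvalue_sub_one y
  have hsβC : Tendsto (fun n : ℕ => (s n : ℂ) / (n : ℂ) ^ 3) atTop (𝓝 β) := by
    refine ((Complex.continuous_ofReal.tendsto β).comp hsβ).congr fun n => ?_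
    simp [Function.comp]
  have hinv : Tendsto (fun n : ℕ => (((n : ℂ))⁻¹) ^ 3) atTop (𝓝 0) := by
    simpa using tendsto_natCast_inv.pow 3
  have ha : Tendsto (fun n => Complex.cos (tiltedFreq y n) / Real.cos (freq n) - 1) atTop (𝓝 0) := by
    have h1 := hinv.mul h0
    rw [zero_mul] at h1
    refine h1.congr' ?_
    filter_upwards [eventually_gt_atTop 0] with n hn
    have : (n : ℂ) ≠ 0 := by exact_mod_cast hn.ne'
    field_simp
  have hsa : Tendsto (fun n => (s n : ℂ) *
      (Complex.cos (tiltedFreq y n) / Real.cos (freq n) - 1)) atTop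
      (𝓝 (β * -(Real.pi ^ 2 * y / 8))) := by
    refine (hsβC.mul h0).congr' ?_
    filter_upwards [eventually_gt_atTop 0] with n hn
    have : (n : ℂ) ≠ 0 := by exact_mod_cast hn.ne'
    field_simp
  have hsin : Tendsto (fun n : ℕ => Complex.sin (tiltedFreq y n * n)) atTop (𝓝 1) := by
    have h1 := (Complex.continuous_sin.tendsto _).comp (tendsto_natCast_mul_tiltedFreq y)
    rw [Complex.sin_pi_div_two] at h1
    exact h1.congr fun n => by simp only [Function.comp, mul_comm]
  have h2 := (tendsto_one_add_pow ha hsa).mul hsin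
  rw [mul_one] at h2
  exact h2.congr fun n => by rw [add_sub_cancel]

/-- The ratio of tilted to untilted mass converges on the time scale `n ^ 3`. -/
theorem tendsto_sum_tiltedStep_div_sum_killedStep {x : ℕ} (hx : 1 ≤ x) {z y : ℂ} (hz : ‖z‖ = 1)
    (hy : y * (2 * x - (2 * x - 1) * z) = 2 * x ^ 2 * (1 - z)) {β : ℝ} (hβ : 0 < β) {t : ℕ → ℕ}
    (ht : Tendsto (fun n : ℕ => (t n : ℝ) / (n : ℝ) ^ 3) atTop (𝓝 β)) :
    Tendsto (fun n : ℕ =>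
      (∑ v ∈ Ioo (0 : ℤ) (2 * n), (tiltedStep n x z)^[t n] (Pi.single (n : ℤ) 1) v) /
        ((∑ v ∈ Ioo (0 : ℤ) (2 * n),
          (killedStep n)^[t n] (Pi.single (n : ℤ) (1 : ℝ)) v : ℝ) : ℂ)) atTop
      (𝓝 (Complex.exp (β * -(Real.pi ^ 2 * y / 8)))) := by
  have hlt : ∀ᶠ n : ℕ in atTop, 2 * (n ^ 2 * Nat.sqrt n) ≤ t n := by
    filter_upwards [ht.eventually_const_lt (half_lt_self hβ),
      tendsto_sqrt_div.eventually_lt_const (show (0 : ℝ) < β / 4 by positivity),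
      eventually_gt_atTop 0] with n h1 h2 hn
    have hn0 : (0 : ℝ) < n := by exact_mod_cast hn
    rw [lt_div_iff₀ (by positivity)] at h1
    rw [div_lt_iff₀ hn0] at h2
    have h3 : (2 : ℝ) * (n ^ 2 * Nat.sqrt n) ≤ t n := by
      calc (2 : ℝ) * (n ^ 2 * Nat.sqrt n) ≤ 2 * (n ^ 2 * (β / 4 * n)) := by gcongr
        _ = β / 2 * n ^ 3 := by ring
        _ ≤ _ := h1.le
    exact_mod_cast h3
  set s : ℕ → ℕ := fun n => t n - n ^ 2 * Nat.sqrt n with hs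
  have hst : ∀ᶠ n : ℕ in atTop, s n + n ^ 2 * Nat.sqrt n = t n := by
    filter_upwards [hlt] with n hn
    simp only [hs]
    omega
  have hsle : ∀ᶠ n : ℕ in atTop, n ^ 2 * Nat.sqrt n ≤ s n := by
    filter_upwards [hlt] with n hn
    simp only [hs]
    omega
  have hsβ : Tendsto (fun n : ℕ => (s n : ℝ) / (n : ℝ) ^ 3) atTop (𝓝 β) := by
    have h1 := ht.sub tendsto_sqrt_div
    rw [sub_zero] at h1
    refine h1.congr' ?_
    filter_upwards [hst, eventually_gt_atTop 0] with n h2 hn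
    have hn0 : (n : ℝ) ≠ 0 := by exact_mod_cast hn.ne'
    rw [← h2]
    push_cast
    field_simp
    ring
  have hA := tendsto_sum_tiltedStep_div_sub hx hz hy hsle hsβ
  have hC := tendsto_killedStep_center_sub_sineCoeff (t := t) (hlt.mono fun n hn => by omega)
  refine (tendsto_div_of_sub_mul_tendsto_zero hA (tendsto_eigenvalue_pow y hsβ) hC ?_).congr' ?_
  · filter_upwards [eventually_ge_atTop 2] with n hn
    exact ⟨half_le_sineCoeff_interiorInd hn,
      (abs_le.1 (abs_sineCoeff_le (by omega) (interiorInd_abs_le n) 1)).2⟩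
  · filter_upwards [hst, eventually_ge_atTop 2] with n h1 hn
    have hc : (Real.cos (freq n) : ℂ) ≠ 0 := by exact_mod_cast (cos_freq_pos hn).ne'
    rw [h1, sum_killedStep_iterate_single (by rw [Finset.mem_Ioo]; omega)]
    push_cast
    push_cast at hc
    exact div_div_div_cancel_right₀ (pow_ne_zero _ hc) _ _

theorem two_mul_sub_ne_zero {x : ℕ} (hx : 1 ≤ x) {z : ℂ} (hz : ‖z‖ = 1) :
    (2 * x - (2 * x - 1) * z : ℂ) ≠ 0 := by
  intro h
  have h1 : (2 * x : ℂ) = (2 * x - 1 : ℝ) * z := by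
    push_cast
    linear_combination h
  have h2 := congrArg norm h1
  have hx1 : (1 : ℝ) ≤ x := by exact_mod_cast hx
  rw [norm_mul, norm_mul, hz, Complex.norm_two, Complex.norm_natCast, Complex.norm_real,
    Real.norm_of_nonneg (by linarith)] at h2
  linarith

theorem tendsto_floor_cube_div {α : ℝ} (hα : 0 < α) :
    Tendsto (fun n : ℕ => (⌊4 * α * (n : ℝ) ^ 3 / Real.pi ^ 2⌋₊ : ℝ) / (n : ℝ) ^ 3) atTop
      (𝓝 (4 * α / Real.pi ^ 2)) := by
  have h1 : Tendsto (fun n : ℕ => (n : ℝ) ^ 3) atTop atTop :=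
    (tendsto_pow_atTop (by norm_num)).comp tendsto_natCast_atTop_atTop
  refine ((tendsto_nat_floor_mul_div_atTop (a := 4 * α / Real.pi ^ 2) (by positivity)).comp
    h1).congr fun n => ?_
  simp only [Function.comp]
  rw [div_mul_eq_mul_div]

/-- fix `α > 0` and an integer `x ≥ 1`; set `t* = ⌊4αn³/π²⌋` and
let `L_n(x) = #{0 ≤ s ≤ t* : S_s = x}` be the local time at `x` of the simple
random walk started at `n` under the conditional law
`P_n[· ∣ τ_{{0,2n}} > t*]` (the conditioned walk on the ring with `2n` sites
run up to time `t*`).  Then `L_n(x)` converges in distribution to the local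
time `ℓ(x)` of one-dimensional random interlacements at level `α` (a compound
Poisson sum of `N ~ Poisson(αx/2)` i.i.d. `Geometric(1/(2x))` variables),
stated equivalently via characteristic functions: for every `t ∈ ℝ`,
`E[e^{itL_n(x)}] → exp(αx²(e^{it}-1)/(2x-(2x-1)e^{it}))`. -/
theorem ring_local_time_converges_to_interlacement_local_time
    {Ω : Type*} [MeasurableSpace Ω] (P : ℤ → Measure Ω) (S : ℕ → Ω → ℤ)
    (hS : IsSRW P S) (α : ℝ) (hα : 0 < α) (x : ℕ) (hx : 1 ≤ x) (t : ℝ) :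
    Tendsto
      (fun n : ℕ =>
        ∫ ω, Complex.exp (Complex.I * t *
            ((((Finset.range (⌊4 * α * (n : ℝ) ^ 3 / Real.pi ^ 2⌋₊ + 1)).filter
                (fun s => S s ω = (x : ℤ))).card : ℕ) : ℂ))
          ∂(ProbabilityTheory.cond (P (n : ℤ))
              {ω | ∀ s ≤ ⌊4 * α * (n : ℝ) ^ 3 / Real.pi ^ 2⌋₊,
                S s ω ∉ ({0, (2 * n : ℤ)} : Set ℤ)}))
      atTop
      (𝓝 (Complex.exp (((α : ℂ) * (x : ℂ) ^ 2) * (Complex.exp (Complex.I * t) - 1)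
          / (2 * (x : ℂ) - (2 * (x : ℂ) - 1) * Complex.exp (Complex.I * t))))) := by
  set z : ℂ := Complex.exp (Complex.I * t) with hzdef
  have hz : ‖z‖ = 1 := by rw [hzdef, mul_comm, Complex.norm_exp_ofReal_mul_I]
  have hden := two_mul_sub_ne_zero hx hz
  have hpi : (Real.pi : ℂ) ≠ 0 := by exact_mod_cast Real.pi_ne_zero
  have hlim := tendsto_sum_tiltedStep_div_sum_killedStep hx hz
    (div_mul_cancel₀ (2 * (x : ℂ) ^ 2 * (1 - z)) hden)
    (show 0 < 4 * α / Real.pi ^ 2 by have := Real.pi_pos; positivity) (tendsto_floor_cube_div hα)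
  have hval : ((4 * α / Real.pi ^ 2 : ℝ) : ℂ) *
      -(Real.pi ^ 2 * (2 * (x : ℂ) ^ 2 * (1 - z) / (2 * x - (2 * x - 1) * z)) / 8) =
      ((α : ℂ) * (x : ℂ) ^ 2) * (z - 1) / (2 * (x : ℂ) - (2 * (x : ℂ) - 1) * z) := by
    push_cast
    field_simp
    ring
  rw [hval] at hlim
  refine hlim.congr' ?_
  filter_upwards [eventually_gt_atTop x] with n hn
  rw [← hS.integral_cond (by omega) (x : ℤ) (by omega) z hz]
  refine integral_congr_ae (Eventually.of_forall fun ω => ?_)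
  simp only
  rw [mul_comm (Complex.I * t), Complex.exp_nat_mul]
end
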